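/- arXiv:2001.10521 — 10 statements merged into one kernel-verified Lean document; each statement's English description precedes it below -/
import Mathlib

section
/- Let p be a prime and let G be a finite p-group of order p^n with n ≥ 4 such that G is not cyclic and exp(G) ≤ p^{n-2}. Then the number of cyclic subgroups of G satisfies |C(G)| > (n-1)p + 2. -/
/-- The number of cyclic subgroups of a group `G` (including the trivial subgroup). -/
noncomputable def numCyclicSubgroups (G : Type*) [Group G] : ℕ :=
  Nat.card {H : Subgroup G // IsCyclic H}

open Finset in
theorem card_zpowers_eq_le_totient {G : Type*} [Group G] [Fintype G] [DecidableEq (Subgroup G)]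
    (H : Subgroup G) [IsCyclic H] :
    #{x : G | Subgroup.zpowers x = H} ≤ (Nat.card H).totient := by
  classical
  rw [← IsCyclic.card_orderOf_eq_totient (α := H) (d := Nat.card H)
    (by rw [Nat.card_eq_fintype_card])]
  have hsub : ({x : G | Subgroup.zpowers x = H} : Finset G) ⊆
      ({a : H | orderOf a = Nat.card H} : Finset H).image Subtype.val := by
    intro x hx
    obtain rfl : Subgroup.zpowers x = H := by simpa using hx
    simp only [mem_image, mem_filter, mem_univ, true_and]
    exact ⟨⟨x, Subgroup.mem_zpowers x⟩, by rw [Subgroup.orderOf_mk, Nat.card_zpowers], rfl⟩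
  exact (card_le_card hsub).trans card_image_le

theorem sum_inv_totient_orderOf_le_numCyclicSubgroups (G : Type*) [Group G] [Fintype G] :
    ∑ x : G, ((orderOf x).totient : ℚ)⁻¹ ≤ numCyclicSubgroups G := by
  classical
  have : Fintype {H : Subgroup G // IsCyclic H} := Fintype.ofFinite _
  let z : G → {H : Subgroup G // IsCyclic H} := fun x => ⟨Subgroup.zpowers x, inferInstance⟩
  rw [numCyclicSubgroups, Nat.card_eq_fintype_card, ← Finset.sum_fiberwise Finset.univ z,
    ← Finset.card_univ, Finset.cast_card]
  refine Finset.sum_le_sum fun H _ => ?_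
  have : IsCyclic H.1 := H.2
  have hpos : (0 : ℚ) < (Nat.card H.1).totient := by
    exact_mod_cast Nat.totient_pos.2 Nat.card_pos
  have hterm : ∀ x ∈ ({x : G | z x = H} : Finset G),
      ((orderOf x).totient : ℚ)⁻¹ = ((Nat.card H.1).totient : ℚ)⁻¹ := by
    intro x hx
    obtain rfl : z x = H := by simpa using hx
    rw [← Nat.card_zpowers]
  rw [Finset.sum_congr rfl hterm, Finset.sum_const, nsmul_eq_mul, ← div_eq_mul_inv, div_le_one hpos]
  have hle := card_zpowers_eq_le_totient H.1
  simp only [z, Subtype.ext_iff]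
  exact_mod_cast hle

theorem exists_monoidHom_eq_pow_of_center_index_dvd {G : Type*} [Group G]
    [(Subgroup.center G).FiniteIndex] {d : ℕ} (h : (Subgroup.center G).index ∣ d) :
    ∃ f : G →* G, ∀ g, f g = g ^ d := by
  obtain ⟨c, rfl⟩ := h
  let f := MonoidHom.transferCenterPow G
  refine ⟨⟨⟨fun g => (f g ^ c : Subgroup.center G), by simp⟩, fun a b => ?_⟩, fun g => ?_⟩
  · simp [Commute.mul_pow (mul_comm' (f a) (f b))]
  · simp [f, pow_mul]

theorem pow_prime_pow_eq_one_of_not_isCyclic {G : Type*} [Group G] {p m : ℕ} (hp : p.Prime)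
    (hG : Nat.card G = p ^ (m + 1)) (hnc : ¬ IsCyclic G) (g : G) : g ^ p ^ m = 1 := by
  have : Finite G := Nat.finite_of_card_ne_zero (by rw [hG]; exact (pow_pos hp.pos _).ne')
  obtain ⟨i, hi, ho⟩ := (Nat.dvd_prime_pow hp).1 (hG ▸ orderOf_dvd_natCard g)
  rw [← orderOf_dvd_iff_pow_eq_one, ho]
  refine pow_dvd_pow p (Nat.lt_succ_iff.1 (lt_of_le_of_ne hi fun h => hnc ?_))
  exact isCyclic_of_orderOf_eq_card g (by rw [ho, hG, h])

theorem sup_eq_top_of_card_eq_prime_pow {G : Type*} [Group G] {p m : ℕ} (hp : p.Prime)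
    (hG : Nat.card G = p ^ (m + 1)) {A B : Subgroup G} (hA : Nat.card A = p ^ m)
    (hB : Nat.card B = p ^ m) (hAB : A ≠ B) : A ⊔ B = ⊤ := by
  have : Finite G := Nat.finite_of_card_ne_zero (by rw [hG]; exact (pow_pos hp.pos _).ne')
  obtain ⟨i, hi, ho⟩ := (Nat.dvd_prime_pow hp).1 (hG ▸ (A ⊔ B).card_subgroup_dvd_card)
  apply Subgroup.eq_top_of_card_eq
  rw [ho, hG]
  congr 1
  by_contra hne
  have hle : Nat.card ↥(A ⊔ B) ≤ p ^ m := by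
    rw [ho]; exact Nat.pow_le_pow_right hp.pos (by omega)
  have h1 := Subgroup.eq_of_le_of_card_ge (le_sup_left : A ≤ A ⊔ B) (by rwa [hA])
  have h2 := Subgroup.eq_of_le_of_card_ge (le_sup_right : B ≤ A ⊔ B) (by rwa [hB])
  exact hAB (h1.trans h2.symm)

theorem index_of_card_eq_prime_pow {G : Type*} [Group G] {p m : ℕ} (hp : p.Prime)
    (hG : Nat.card G = p ^ (m + 1)) {A : Subgroup G} (hA : Nat.card A = p ^ m) : A.index = p := by
  have := A.card_mul_index
  rw [hA, hG, pow_succ] at this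
  exact Nat.eq_of_mul_eq_mul_left (pow_pos hp.pos _) this

theorem center_index_dvd_sq_of_card_eq_prime_pow {G : Type*} [Group G] {p m : ℕ} (hp : p.Prime)
    (hG : Nat.card G = p ^ (m + 1)) {A B : Subgroup G} [IsMulCommutative A] [IsMulCommutative B]
    (hA : Nat.card A = p ^ m) (hB : Nat.card B = p ^ m) (hAB : A ≠ B) :
    (Subgroup.center G).index ∣ p ^ 2 := by
  have : Finite G := Nat.finite_of_card_ne_zero (by rw [hG]; exact (pow_pos hp.pos _).ne')
  have hcen : A ⊓ B ≤ Subgroup.center G := by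
    intro x hx
    have htop : (⊤ : Subgroup G) ≤ Subgroup.centralizer {x} := by
      rw [← sup_eq_top_of_card_eq_prime_pow hp hG hA hB hAB, sup_le_iff]
      refine ⟨fun y hy => ?_, fun y hy => ?_⟩ <;> rw [Subgroup.mem_centralizer_singleton_iff]
      · exact congrArg Subtype.val (mul_comm' (⟨y, hy⟩ : A) ⟨x, hx.1⟩)
      · exact congrArg Subtype.val (mul_comm' (⟨y, hy⟩ : B) ⟨x, hx.2⟩)
    exact Subgroup.mem_center_iff.2 fun g =>
      Subgroup.mem_centralizer_singleton_iff.1 (htop (Subgroup.mem_top g))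
  have hle : (A ⊓ B).index ≤ p ^ 2 := by
    have := Subgroup.index_inf_le (H := A) (K := B)
    rwa [index_of_card_eq_prime_pow hp hG hA, index_of_card_eq_prime_pow hp hG hB, ← sq] at this
  refine (Subgroup.index_dvd_of_le hcen).trans ?_
  obtain ⟨i, -, ho⟩ := (Nat.dvd_prime_pow hp).1 (hG ▸ (A ⊓ B).index_dvd_card)
  rw [ho] at hle ⊢
  exact pow_dvd_pow p ((Nat.pow_le_pow_iff_right hp.one_lt).1 hle)

theorem exists_le_card_eq_prime_pow {G : Type*} [Group G] {p m : ℕ} (hp : p.Prime)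
    (hG : Nat.card G = p ^ (m + 1)) (hnc : ¬ IsCyclic G) (g : G) :
    ∃ A : Subgroup G, Nat.card A = p ^ m ∧ g ∈ A := by
  have : Finite G := Nat.finite_of_card_ne_zero (by rw [hG]; exact (pow_pos hp.pos _).ne')
  have : Fact p.Prime := ⟨hp⟩
  obtain ⟨i, hi, ho⟩ := (Nat.dvd_prime_pow hp).1 (orderOf_dvd_of_pow_eq_one
    (pow_prime_pow_eq_one_of_not_isCyclic hp hG hnc g))
  obtain ⟨A, hA, hle⟩ := Sylow.exists_subgroup_card_pow_prime_le p (m := m)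
    (hG ▸ pow_dvd_pow p m.le_succ) (Subgroup.zpowers g) (by rw [Nat.card_zpowers, ho]) hi
  exact ⟨A, hA, hle (Subgroup.mem_zpowers g)⟩

theorem le_card_pow_eq_one_of_forall_isCyclic {G : Type*} [Group G] {p m k : ℕ} (hp : p.Prime)
    (hk : 2 ≤ k) (hkm : k ≤ m) (hG : Nat.card G = p ^ (m + 1)) (hnc : ¬ IsCyclic G)
    (hcyc : ∀ A : Subgroup G, Nat.card A = p ^ m → IsCyclic A) :
    p ^ (k + 1) ≤ Nat.card {x : G // x ^ p ^ k = 1} := by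
  have : Finite G := Nat.finite_of_card_ne_zero (by rw [hG]; exact (pow_pos hp.pos _).ne')
  obtain ⟨A, hA, -⟩ := exists_le_card_eq_prime_pow hp hG hnc 1
  have hAtop : A ≠ ⊤ := by
    rintro rfl
    rw [Subgroup.card_top, hG] at hA
    exact absurd (Nat.pow_right_injective hp.two_le hA) (by simp)
  obtain ⟨b, hb⟩ : ∃ b, b ∉ A := by
    by_contra! h
    exact hAtop (Subgroup.eq_top_iff' A |>.2 h)
  obtain ⟨B, hB, hbB⟩ := exists_le_card_eq_prime_pow hp hG hnc b
  have := hcyc A hA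
  have := hcyc B hB
  have hAB : A ≠ B := by rintro rfl; exact hb hbB
  obtain ⟨f, hf⟩ := exists_monoidHom_eq_pow_of_center_index_dvd (d := p ^ k)
    ((center_index_dvd_sq_of_card_eq_prime_pow hp hG hA hB hAB).trans (pow_dvd_pow p hk))
  have hAn : A.Normal := by
    apply Subgroup.normal_of_index_eq_minFac_card
    rw [index_of_card_eq_prime_pow hp hG hA, hG, hp.pow_minFac (Nat.succ_ne_zero m)]
  have hmem : ∀ g, f g ∈ A := by
    intro g
    obtain ⟨l, rfl⟩ : ∃ l, k = l + 1 := ⟨k - 1, by omega⟩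
    rw [hf, pow_succ', pow_mul]
    refine A.pow_mem ?_ _
    have := A.pow_index_mem g
    rwa [index_of_card_eq_prime_pow hp hG hA] at this
  have hrange : Nat.card f.range ≤ p ^ (m - k) := by
    classical
    have : Fintype A := Fintype.ofFinite _
    refine le_trans ?_ (IsCyclic.card_pow_eq_one_le (α := A) (pow_pos hp.pos (m - k)))
    rw [← Fintype.card_subtype, ← Nat.card_eq_fintype_card]
    have hval : ∀ y : f.range, y.1 ∈ A ∧ y.1 ^ p ^ (m - k) = 1 := by
      rintro ⟨_, g, rfl⟩
      refine ⟨hmem g, ?_⟩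
      change f g ^ p ^ (m - k) = 1
      rw [hf, ← pow_mul, ← pow_add, Nat.add_sub_cancel' hkm]
      exact pow_prime_pow_eq_one_of_not_isCyclic hp hG hnc g
    refine Nat.card_le_card_of_injective
      (fun y : f.range => (⟨⟨y.1, (hval y).1⟩, Subtype.ext (hval y).2⟩ :
        {a : A // a ^ p ^ (m - k) = 1})) fun y z hyz => ?_
    exact Subtype.ext (congrArg (fun a => a.1.1) hyz)
  have hker : Nat.card f.ker = Nat.card {x : G // x ^ p ^ k = 1} :=
    Nat.card_congr (Equiv.subtypeEquivRight fun x => by rw [MonoidHom.mem_ker, hf])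
  have hmul := f.ker.card_mul_index
  rw [Subgroup.index_ker, hG, hker] at hmul
  refine Nat.le_of_mul_le_mul_right (c := p ^ (m - k)) ?_ (pow_pos hp.pos _)
  rw [← pow_add, show k + 1 + (m - k) = m + 1 by omega, ← hmul]
  exact Nat.mul_le_mul_left _ hrange

theorem le_card_pow_eq_one_of_not_isCyclic {p m k : ℕ} (hp : p.Prime) (hk : 2 ≤ k) (hkm : k ≤ m)
    (G : Type*) [Group G] (hG : Nat.card G = p ^ (m + 1)) (hnc : ¬ IsCyclic G) :
    p ^ (k + 1) ≤ Nat.card {x : G // x ^ p ^ k = 1} := by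
  have : Finite G := Nat.finite_of_card_ne_zero (by rw [hG]; exact (pow_pos hp.pos _).ne')
  induction m, hkm using Nat.le_induction generalizing G with
  | base => rw [Nat.card_congr (Equiv.subtypeUnivEquiv
      (pow_prime_pow_eq_one_of_not_isCyclic hp hG hnc)), hG]
  | succ m hkm ih =>
    by_cases hcyc : ∀ A : Subgroup G, Nat.card A = p ^ (m + 1) → IsCyclic A
    · exact le_card_pow_eq_one_of_forall_isCyclic hp hk (by omega) hG hnc hcyc
    · push Not at hcyc
      obtain ⟨A, hA, hAnc⟩ := hcyc
      refine (ih A hA hAnc inferInstance).trans (Nat.card_le_card_of_injective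
        (fun x : {x : A // x ^ p ^ k = 1} =>
          (⟨x.1.1, congrArg Subtype.val x.2⟩ : {x : G // x ^ p ^ k = 1})) fun x y hxy => ?_)
      exact Subtype.ext (Subtype.ext (congrArg (fun a => a.1) hxy))

theorem prime_le_card_pow_eq_one {G : Type*} [Group G] [Finite G] {p : ℕ} (hp : p.Prime)
    (hdvd : p ∣ Nat.card G) : p ≤ Nat.card {x : G // x ^ p = 1} := by
  have : Fact p.Prime := ⟨hp⟩
  obtain ⟨g, hg⟩ := exists_prime_orderOf_dvd_card' p hdvd
  calc p = Nat.card (Subgroup.zpowers g) := by rw [Nat.card_zpowers, hg]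
    _ ≤ _ := Nat.card_le_card_of_injective
      (fun y : Subgroup.zpowers g => (⟨y.1, by
        obtain ⟨i, hi⟩ := y.2
        rw [← hi, ← zpow_natCast, zpow_comm, zpow_natCast, ← hg]
        simp [pow_orderOf_eq_one]⟩ : {x : G // x ^ p = 1})) fun y z hyz =>
          Subtype.ext (congrArg (fun a => a.1) hyz)

theorem inv_totient_orderOf_eq_sum {G : Type*} [Group G] [DecidableEq G] {p E : ℕ} (hp : p.Prime)
    {x : G} (hx : x ^ p ^ E = 1) :
    ((orderOf x).totient : ℚ)⁻¹ = ((p ^ E).totient : ℚ)⁻¹ + ∑ i ∈ Finset.range E,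
      if x ^ p ^ i = 1 then ((p ^ i).totient : ℚ)⁻¹ - ((p ^ (i + 1)).totient : ℚ)⁻¹ else 0 := by
  obtain ⟨j, hj, ho⟩ := (Nat.dvd_prime_pow hp).1 (orderOf_dvd_of_pow_eq_one hx)
  have hiff : ∀ i, x ^ p ^ i = 1 ↔ j ≤ i := fun i => by
    rw [← orderOf_dvd_iff_pow_eq_one, ho, Nat.pow_dvd_pow_iff_le_right hp.one_lt]
  simp only [hiff, ho]
  clear hx
  induction E, hj using Nat.le_induction with
  | base =>
    rw [Finset.sum_eq_zero, add_zero]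
    intro i hi
    rw [if_neg (by simpa using hi)]
  | succ E hE ih => rw [Finset.sum_range_succ, if_pos hE, ih]; ring

theorem sum_inv_totient_orderOf {G : Type*} [Group G] [Fintype G] {p E : ℕ} (hp : p.Prime)
    (hx : ∀ x : G, x ^ p ^ E = 1) :
    ∑ x : G, ((orderOf x).totient : ℚ)⁻¹ = Nat.card G * ((p ^ E).totient : ℚ)⁻¹ +
      ∑ i ∈ Finset.range E, Nat.card {x : G // x ^ p ^ i = 1} *
        (((p ^ i).totient : ℚ)⁻¹ - ((p ^ (i + 1)).totient : ℚ)⁻¹) := by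
  classical
  rw [Finset.sum_congr rfl fun x _ => inv_totient_orderOf_eq_sum hp (hx x),
    Finset.sum_add_distrib, Finset.sum_comm]
  congr 1
  · simp [Nat.card_eq_fintype_card]
  · refine Finset.sum_congr rfl fun i _ => ?_
    rw [← Finset.sum_filter, Finset.sum_const, nsmul_eq_mul, ← Fintype.card_subtype,
      ← Nat.card_eq_fintype_card]

theorem cast_totient_prime_pow_succ {p : ℕ} (hp : p.Prime) (i : ℕ) :
    ((p ^ (i + 1)).totient : ℚ) = p ^ i * (p - 1) := by
  rw [Nat.totient_prime_pow_succ hp]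
  push_cast [hp.one_le]
  rfl

theorem inv_totient_sub_inv_totient {p : ℕ} (hp : p.Prime) (i : ℕ) :
    ((p ^ (i + 1)).totient : ℚ)⁻¹ - ((p ^ (i + 2)).totient : ℚ)⁻¹ = ((p : ℚ) ^ (i + 1))⁻¹ := by
  rw [cast_totient_prime_pow_succ hp, cast_totient_prime_pow_succ hp (i + 1)]
  have h0 : (p : ℚ) ≠ 0 := by exact_mod_cast hp.ne_zero
  have h1 : (p : ℚ) - 1 ≠ 0 := sub_ne_zero.2 (by exact_mod_cast hp.one_lt.ne')
  field_simp
  ring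

theorem secondMin_aux {p n : ℕ} (hp : p.Prime) (hn : 4 ≤ n) (G : Type*) [Group G]
    (hG : Nat.card G = p ^ n) (hnc : ¬ IsCyclic G)
    (hexp : Monoid.exponent G ≤ p ^ (n - 2)) :
    (n - 1) * p + 2 < numCyclicSubgroups G := by
  have : Finite G := Nat.finite_of_card_ne_zero (by rw [hG]; exact (pow_pos hp.pos _).ne')
  have : Fintype G := Fintype.ofFinite G
  obtain ⟨m, rfl⟩ : ∃ m, n = m + 4 := ⟨n - 4, by omega⟩
  have hx : ∀ x : G, x ^ p ^ (m + 2) = 1 := by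
    obtain ⟨i, -, ho⟩ := (Nat.dvd_prime_pow hp).1 (hG ▸ Group.exponent_dvd_nat_card (G := G))
    rw [ho, Nat.pow_le_pow_iff_right hp.one_lt] at hexp
    exact fun x => Monoid.exponent_dvd_iff_forall_pow_eq_one.1
      (ho ▸ pow_dvd_pow p (show i ≤ m + 2 by omega)) x
  have hp0 : (0 : ℚ) < p := by exact_mod_cast hp.pos
  have hp1 : (0 : ℚ) < p - 1 := sub_pos.2 (by exact_mod_cast hp.one_lt)
  have hle := sum_inv_totient_orderOf_le_numCyclicSubgroups G
  rw [sum_inv_totient_orderOf hp hx, Finset.sum_range_succ', Finset.sum_range_succ'] at hle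
  have hterm : ∀ i ∈ Finset.range m, (p : ℚ) ≤ Nat.card {x : G // x ^ p ^ (i + 1 + 1) = 1} *
      (((p ^ (i + 1 + 1)).totient : ℚ)⁻¹ - ((p ^ (i + 1 + 1 + 1)).totient : ℚ)⁻¹) := by
    intro i hi
    have hi := Finset.mem_range.1 hi
    rw [inv_totient_sub_inv_totient hp, ← div_eq_mul_inv, le_div_iff₀ (by positivity), ← pow_succ']
    exact_mod_cast le_card_pow_eq_one_of_not_isCyclic (k := i + 2) (m := m + 3) hp (by omega)
      (by omega) G hG hnc
  have hsum := Finset.sum_le_sum hterm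
  rw [Finset.sum_const, Finset.card_range, nsmul_eq_mul] at hsum
  have hone : (1 : ℚ) ≤ Nat.card {x : G // x ^ p ^ (0 + 1) = 1} *
      (((p ^ (0 + 1)).totient : ℚ)⁻¹ - ((p ^ (0 + 1 + 1)).totient : ℚ)⁻¹) := by
    rw [inv_totient_sub_inv_totient hp, ← div_eq_mul_inv, le_div_iff₀ (by positivity), one_mul]
    simp only [zero_add, pow_one]
    exact_mod_cast prime_le_card_pow_eq_one hp (hG ▸ dvd_pow_self p (by omega))
  have hzero : (Nat.card {x : G // x ^ p ^ 0 = 1} : ℚ) *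
      (((p ^ 0).totient : ℚ)⁻¹ - ((p ^ (0 + 1)).totient : ℚ)⁻¹) = 1 - ((p : ℚ) - 1)⁻¹ := by
    rw [cast_totient_prime_pow_succ hp]
    simp
  have htop : (Nat.card G : ℚ) * ((p ^ (m + 2)).totient : ℚ)⁻¹ =
      (p : ℚ) ^ 2 + p + 1 + ((p : ℚ) - 1)⁻¹ := by
    rw [hG, cast_totient_prime_pow_succ hp]
    push_cast
    field_simp
    ring
  rw [hzero, htop] at hle
  have hfin : ((m + 3) * p + 2 : ℚ) < numCyclicSubgroups G := by
    nlinarith [mul_pos hp1 hp1]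
  rw [show m + 4 - 1 = m + 3 by omega]
  exact_mod_cast hfin
end

section
/- Let p be an odd prime, n ≥ 3 an integer, and G a group of order p^n that is not cyclic. Then the number of cyclic subgroups of G satisfies |C(G)| ≥ (n-1)p + 2. -/
section NumCyclicSubgroups

open scoped commutatorElement

variable {G : Type*} [Group G]

/-- The power formula in a group where a commutator is central. -/
theorem mul_pow_of_central_commutator {x y c : G} (hc : ∀ g, Commute c g)
    (h : y * x = c * (x * y)) (m : ℕ) :
    y ^ m * x = c ^ m * (x * y ^ m) ∧ (x * y) ^ m = c ^ m.choose 2 * (x ^ m * y ^ m) := by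
  induction m with
  | zero => simp
  | succ m ih =>
    obtain ⟨h1, h2⟩ := ih
    have comm : ∀ (k : ℕ) (g : G), g * c ^ k = c ^ k * g := fun k g => ((hc g).pow_left k).eq.symm
    constructor
    · calc y ^ (m + 1) * x = y * (y ^ m * x) := by rw [pow_succ', mul_assoc]
        _ = y * c ^ m * (x * y ^ m) := by rw [h1, mul_assoc]
        _ = c ^ m * (y * x) * y ^ m := by rw [comm]; simp only [mul_assoc]
        _ = c ^ (m + 1) * (x * y ^ (m + 1)) := by
          rw [h, pow_succ c, pow_succ' y]; simp only [mul_assoc]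
    · calc (x * y) ^ (m + 1) = c ^ m.choose 2 * x ^ m * (y ^ m * x) * y := by
            rw [pow_succ, h2]; simp only [mul_assoc]
        _ = c ^ m.choose 2 * (x ^ m * c ^ m) * x * y ^ m * y := by
            rw [h1]; simp only [mul_assoc]
        _ = c ^ (m.choose 2 + m) * (x ^ m * x) * (y ^ m * y) := by
            rw [comm, pow_add]; simp only [mul_assoc]
        _ = c ^ (m + 1).choose 2 * (x ^ (m + 1) * y ^ (m + 1)) := by
            have hchoose : (m + 1).choose 2 = m.choose 2 + m := by
              rw [Nat.choose_succ_succ' m 1, Nat.choose_one_right, add_comm]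
            rw [← pow_succ, ← pow_succ, hchoose, mul_assoc]

/-- If `p` is an odd prime and all commutators and `p`-th powers are central, then the `p`-th power
map is multiplicative. -/
theorem mul_pow_prime_of_central {p : ℕ} (hp : p.Prime) (hodd : Odd p)
    (hcomm : ∀ x y : G, ⁅x, y⁆ ∈ Subgroup.center G) (hpow : ∀ x : G, x ^ p ∈ Subgroup.center G)
    (x y : G) : (x * y) ^ p = x ^ p * y ^ p := by
  have hc : ∀ g, Commute ⁅y, x⁆ g := fun g => ((Subgroup.mem_center_iff.1 (hcomm y x)) g).symm
  have h : y * x = ⁅y, x⁆ * (x * y) := by rw [commutatorElement_def]; group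
  obtain ⟨h1, h2⟩ := mul_pow_of_central_commutator hc h p
  have hcp : ⁅y, x⁆ ^ p = 1 := by
    rw [← Subgroup.mem_center_iff.1 (hpow y) x] at h1
    exact right_eq_mul.1 h1
  have hp2 : 2 < p := lt_of_le_of_ne hp.two_le (by rintro rfl; exact absurd hodd (by decide))
  obtain ⟨k, hk⟩ := hp.dvd_choose_self two_ne_zero hp2
  rw [h2, hk, pow_mul, hcp, one_pow, one_mul]

/-- A subgroup of index `p` in a group of order `p ^ (m + 1)` is maximal. -/
theorem eq_top_of_lt_of_card_eq_prime_pow {p m : ℕ} (hp : p.Prime) (hG : Nat.card G = p ^ (m + 1))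
    {M K : Subgroup G} (hM : Nat.card M = p ^ m) (hMK : M < K) : K = ⊤ := by
  have : Finite G := Nat.finite_of_card_ne_zero (by rw [hG]; exact (pow_pos hp.pos _).ne')
  obtain ⟨k, hk, hKk⟩ := (Nat.dvd_prime_pow hp).1 (hG ▸ K.card_subgroup_dvd_card)
  have hmk : m < k := by
    by_contra! hkm
    refine hMK.ne (Subgroup.eq_of_le_of_card_ge hMK.le ?_)
    rw [hKk, hM]
    exact Nat.pow_le_pow_right hp.pos hkm
  apply Subgroup.eq_top_of_card_eq
  rw [hKk, hG, show k = m + 1 by omega]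

theorem index_eq_of_card_eq_prime_pow {p m : ℕ} (hp : p.Prime) (hG : Nat.card G = p ^ (m + 1))
    {M : Subgroup G} (hM : Nat.card M = p ^ m) : M.index = p := by
  have h := M.card_mul_index
  rw [hG, hM, pow_succ] at h
  exact Nat.eq_of_mul_eq_mul_left (pow_pos hp.pos _) h

theorem normal_of_card_eq_prime_pow {p m : ℕ} (hp : p.Prime) (hG : Nat.card G = p ^ (m + 1))
    {M : Subgroup G} (hM : Nat.card M = p ^ m) : M.Normal := by
  apply Subgroup.normal_of_index_eq_minFac_card
  rw [hG, hp.pow_minFac m.succ_ne_zero, index_eq_of_card_eq_prime_pow hp hG hM]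

theorem commutatorElement_mem_of_card_eq_prime_pow {p m : ℕ} (hp : p.Prime)
    (hG : Nat.card G = p ^ (m + 1)) {M : Subgroup G} (hM : Nat.card M = p ^ m) (x y : G) :
    ⁅x, y⁆ ∈ M := by
  have : Fact p.Prime := ⟨hp⟩
  have := normal_of_card_eq_prime_pow hp hG hM
  have hcyc : IsCyclic (G ⧸ M) := isCyclic_of_prime_card (p := p)
    (index_eq_of_card_eq_prime_pow hp hG hM)
  refine Subgroup.Normal.quotient_commutative_iff_commutator_le.1 hcyc.isMulCommutative ?_
  exact Subgroup.commutator_mem_commutator (Subgroup.mem_top x) (Subgroup.mem_top y)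

/-- For odd `p`, a noncyclic group of order `p ^ n` with `n ≥ 3` has a noncyclic maximal
subgroup. -/
theorem exists_not_isCyclic_card_eq_prime_pow {p m : ℕ} (hp : p.Prime) (hodd : Odd p) (hm : 2 ≤ m)
    (hG : Nat.card G = p ^ (m + 1)) (hnc : ¬ IsCyclic G) :
    ∃ M : Subgroup G, Nat.card M = p ^ m ∧ ¬ IsCyclic M := by
  have : Fact p.Prime := ⟨hp⟩
  have : Finite G := Nat.finite_of_card_ne_zero (by rw [hG]; exact (pow_pos hp.pos _).ne')
  by_contra! hall
  obtain ⟨M, hM⟩ := Sylow.exists_subgroup_card_pow_prime p (G := G) (n := m)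
    (hG ▸ pow_dvd_pow p m.le_succ)
  have hMtop : M ≠ ⊤ := by
    rintro rfl
    rw [Subgroup.card_top, hG] at hM
    have := Nat.pow_right_injective hp.two_le hM
    omega
  obtain ⟨x, hx⟩ : ∃ x, x ∉ M := by
    by_contra! h
    exact hMtop (eq_top_iff.2 fun x _ => h x)
  obtain ⟨k, hk, hxk⟩ := (Nat.dvd_prime_pow hp).1 (hG ▸ orderOf_dvd_natCard x)
  have hkm : k ≤ m := by
    by_contra! h
    refine hnc (isCyclic_of_orderOf_eq_card x ?_)
    rw [hxk, hG, show k = m + 1 by omega]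
  obtain ⟨N, hN, hxN⟩ := Sylow.exists_subgroup_card_pow_prime_le p
    (hG ▸ pow_dvd_pow p m.le_succ) (Subgroup.zpowers x) ((Nat.card_zpowers x).trans hxk) hkm
  replace hxN : x ∈ N := hxN (Subgroup.mem_zpowers x)
  have hMc := hall M hM
  have hNc := hall N hN
  have hMn := normal_of_card_eq_prime_pow hp hG hM
  have hNn := normal_of_card_eq_prime_pow hp hG hN
  have hsup : M ⊔ N = ⊤ := by
    refine eq_top_of_lt_of_card_eq_prime_pow hp hG hM (lt_of_le_of_ne le_sup_left fun h => hx ?_)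
    rw [h]
    exact (le_sup_right : N ≤ M ⊔ N) hxN
  have hcen : M ⊓ N ≤ Subgroup.center G := by
    intro z hz
    have aux : ∀ K : Subgroup G, IsCyclic K → z ∈ K → K ≤ Subgroup.centralizer {z} := by
      intro K hK hzK g hg
      have := hK.isMulCommutative
      rw [Subgroup.mem_centralizer_singleton_iff]
      exact congrArg Subtype.val (IsMulCommutative.is_comm.comm (⟨g, hg⟩ : K) ⟨z, hzK⟩)
    have htop : (⊤ : Subgroup G) ≤ Subgroup.centralizer {z} :=
      hsup ▸ sup_le (aux M hMc hz.1) (aux N hNc hz.2)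
    exact Subgroup.mem_center_iff.2 fun g =>
      Subgroup.mem_centralizer_singleton_iff.1 (htop (Subgroup.mem_top g))
  have hpow : ∀ g : G, g ^ p ∈ M ⊓ N := fun g =>
    ⟨index_eq_of_card_eq_prime_pow hp hG hM ▸ M.pow_index_mem g,
      index_eq_of_card_eq_prime_pow hp hG hN ▸ N.pow_index_mem g⟩
  have hmul := mul_pow_prime_of_central hp hodd
    (fun a b => hcen ⟨commutatorElement_mem_of_card_eq_prime_pow hp hG hM a b,
      commutatorElement_mem_of_card_eq_prime_pow hp hG hN a b⟩) (fun a => hcen (hpow a))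
  let f : G →* G := ⟨⟨fun g => g ^ p, one_pow p⟩, hmul⟩
  obtain ⟨r, hr, hfr⟩ := (Nat.dvd_prime_pow hp).1 (hG ▸ f.range.card_subgroup_dvd_card)
  have hrange : f.range ≤ M ⊓ N := by
    rintro _ ⟨g, rfl⟩
    exact hpow g
  have hrm : r < m := by
    by_contra! h
    have h1 : f.range = N := by
      refine Subgroup.eq_of_le_of_card_ge (hrange.trans inf_le_right) ?_
      rw [hfr, hN]
      exact Nat.pow_le_pow_right hp.pos h
    have h2 : f.range ≤ M := hrange.trans inf_le_left
    exact hx (h2 (h1 ▸ hxN))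
  have hker : p ^ 2 ∣ Nat.card f.ker := by
    obtain ⟨s, hs, hfs⟩ := (Nat.dvd_prime_pow hp).1 (hG ▸ f.ker.card_subgroup_dvd_card)
    have h := f.ker.card_mul_index
    rw [Subgroup.index_ker, hfr, hfs, hG, ← pow_add] at h
    have := Nat.pow_right_injective hp.two_le h
    rw [hfs]
    exact pow_dvd_pow p (by omega)
  obtain ⟨K, hK⟩ := Sylow.exists_subgroup_card_pow_prime p hker
  have hK' : Nat.card (K.map f.ker.subtype) = p ^ 2 := by
    rw [Subgroup.card_map_of_injective f.ker.subtype_injective, hK]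
  obtain ⟨L, hL, hKL⟩ := Sylow.exists_subgroup_card_pow_prime_le p
    (hG ▸ pow_dvd_pow p m.le_succ) _ hK' hm
  have hLc := hall L hL
  have hKc : IsCyclic (K.map f.ker.subtype) :=
    isCyclic_of_injective (Subgroup.inclusion hKL) (Subgroup.inclusion_injective hKL)
  obtain ⟨g, hg⟩ := (Subgroup.isCyclic_iff_exists_zpowers_eq_top _).1 hKc
  have hgK : g ∈ K.map f.ker.subtype := hg ▸ Subgroup.mem_zpowers g
  have hgp : g ^ p = 1 := by
    obtain ⟨a, -, rfl⟩ := hgK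
    exact a.2
  have hord := orderOf_dvd_of_pow_eq_one hgp
  rw [← Nat.card_zpowers, hg, hK'] at hord
  have := Nat.le_of_dvd hp.pos hord
  nlinarith [hp.two_le]

/-- A cyclic subgroup `⟨g⟩` has at most `φ(orderOf g)` generators. -/
theorem ncard_zpowers_eq_le_totient [Finite G] (g : G) :
    {x : G | Subgroup.zpowers x = Subgroup.zpowers g}.ncard ≤ (orderOf g).totient := by
  classical
  have := Fintype.ofFinite G
  have h := IsCyclic.card_orderOf_eq_totient (α := Subgroup.zpowers g) (d := orderOf g)
    (by rw [Fintype.card_zpowers])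
  rw [← h, ← Set.ncard_coe_finset]
  refine (Set.ncard_le_ncard ?_ (Set.toFinite _)).trans
    (Set.ncard_image_le (f := Subtype.val) (Set.toFinite _))
  intro x hx
  have hx : Subgroup.zpowers x = Subgroup.zpowers g := hx
  refine ⟨⟨x, hx ▸ Subgroup.mem_zpowers x⟩, ?_, rfl⟩
  simp only [Finset.coe_filter, Finset.mem_univ, true_and, Set.mem_ofPred_eq, Subgroup.orderOf_mk]
  rw [← Nat.card_zpowers, hx, Nat.card_zpowers]

theorem numCyclicSubgroups_eq_ncard : numCyclicSubgroups G = {H : Subgroup G | IsCyclic H}.ncard :=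
  rfl

/-- Passing to a noncyclic group of order `p ^ (m + 1)` from a maximal subgroup adds at least `p`
cyclic subgroups. -/
theorem numCyclicSubgroups_add_prime_le {p m : ℕ} (hp : p.Prime) (hm : 1 ≤ m)
    (hG : Nat.card G = p ^ (m + 1)) (hnc : ¬ IsCyclic G) {M : Subgroup G}
    (hM : Nat.card M = p ^ m) : numCyclicSubgroups M + p ≤ numCyclicSubgroups G := by
  classical
  have : Finite G := Nat.finite_of_card_ne_zero (by rw [hG]; exact (pow_pos hp.pos _).ne')
  have := Fintype.ofFinite G
  have hinj : Function.Injective (Subgroup.map M.subtype) :=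
    Subgroup.map_injective M.subtype_injective
  set A : Set (Subgroup G) := Subgroup.map M.subtype '' {H : Subgroup M | IsCyclic H} with hA
  set S : Finset G := Finset.univ.filter (fun x => x ∉ M)
  set B : Finset (Subgroup G) := S.image Subgroup.zpowers
  have hAB : Disjoint A (B : Set (Subgroup G)) := by
    rw [Set.disjoint_left]
    rintro _ ⟨H, -, rfl⟩ hH
    obtain ⟨x, hx, hxH⟩ := Finset.mem_image.1 (Finset.mem_coe.1 hH)
    refine (Finset.mem_filter.1 hx).2 (Subgroup.map_subtype_le H ?_)
    exact hxH ▸ Subgroup.mem_zpowers x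
  have hsub : A ∪ B ⊆ {H : Subgroup G | IsCyclic H} := by
    rintro K (⟨H, hH, rfl⟩ | hK)
    · have hH : IsCyclic H := hH
      exact isCyclic_of_surjective (M.subtype.subgroupMap H) (M.subtype.subgroupMap_surjective H)
    · obtain ⟨x, -, rfl⟩ := Finset.mem_image.1 (Finset.mem_coe.1 hK)
      exact inferInstanceAs (IsCyclic (Subgroup.zpowers x))
  have hcardA : A.ncard = numCyclicSubgroups M := by
    rw [hA, Set.ncard_image_of_injective _ hinj, numCyclicSubgroups_eq_ncard]
  have hcardS : S.card + p ^ m = p ^ (m + 1) := by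
    have h := Finset.card_filter_add_card_filter_not (s := (Finset.univ : Finset G)) (· ∈ M)
    rw [Finset.card_univ, ← Nat.card_eq_fintype_card, hG, ← Fintype.card_subtype,
      ← Nat.card_eq_fintype_card] at h
    rw [← h, ← hM, add_comm]
  have hfib : S.card ≤ (p ^ m).totient * B.card := by
    refine Finset.card_le_mul_card_image S _ fun H hH => ?_
    obtain ⟨g, -, rfl⟩ := Finset.mem_image.1 hH
    have hle : (orderOf g).totient ≤ (p ^ m).totient := by
      obtain ⟨k, hk, hgk⟩ := (Nat.dvd_prime_pow hp).1 (hG ▸ orderOf_dvd_natCard g)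
      have hkm : k ≤ m := by
        by_contra! h
        refine hnc (isCyclic_of_orderOf_eq_card g ?_)
        rw [hgk, hG, show k = m + 1 by omega]
      rw [hgk]
      exact Nat.le_of_dvd (Nat.totient_pos.2 (pow_pos hp.pos _))
        (Nat.totient_dvd_of_dvd (pow_dvd_pow p hkm))
    refine le_trans ?_ ((ncard_zpowers_eq_le_totient g).trans hle)
    rw [← Set.ncard_coe_finset]
    refine Set.ncard_le_ncard (fun x hx => ?_) (Set.toFinite _)
    exact (Finset.mem_filter.1 (Finset.mem_coe.1 hx)).2
  have hpB : p ≤ B.card := by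
    obtain ⟨j, rfl⟩ : ∃ j, m = j + 1 := ⟨m - 1, by omega⟩
    obtain ⟨q, rfl⟩ : ∃ q, p = q + 1 := ⟨p - 1, by have := hp.pos; omega⟩
    rw [Nat.totient_prime_pow_succ hp, Nat.add_sub_cancel] at hfib
    have hpos : 0 < (q + 1) ^ j * q :=
      Nat.mul_pos (pow_pos hp.pos _) (by have := hp.two_le; omega)
    refine Nat.le_of_mul_le_mul_left (le_trans (le_of_eq ?_) hfib) hpos
    have : (q + 1) ^ (j + 1 + 1) = (q + 1) ^ j * q * (q + 1) + (q + 1) ^ (j + 1) := by ring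
    omega
  calc numCyclicSubgroups M + p ≤ A.ncard + (B : Set (Subgroup G)).ncard := by
        rw [hcardA, Set.ncard_coe_finset]; omega
    _ = (A ∪ B).ncard := (Set.ncard_union_eq hAB).symm
    _ ≤ numCyclicSubgroups G := Set.ncard_le_ncard hsub (Set.toFinite _)

theorem two_le_numCyclicSubgroups {p : ℕ} (hp : p.Prime) (hG : Nat.card G = p) :
    2 ≤ numCyclicSubgroups G := by
  have : Fact p.Prime := ⟨hp⟩
  have : Finite G := Nat.finite_of_card_ne_zero (by rw [hG]; exact hp.ne_zero)
  have : Nontrivial G := Finite.one_lt_card_iff_nontrivial.1 (hG ▸ hp.one_lt)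
  have hcyc : IsCyclic G := isCyclic_of_prime_card hG
  have hne : (⊥ : Subgroup G) ≠ ⊤ := bot_ne_top
  rw [numCyclicSubgroups_eq_ncard, ← Set.ncard_pair hne]
  refine Set.ncard_le_ncard ?_ (Set.toFinite _)
  rintro H (rfl | rfl)
  · exact inferInstanceAs (IsCyclic (⊥ : Subgroup G))
  · exact inferInstanceAs (IsCyclic (⊤ : Subgroup G))

end NumCyclicSubgroups

theorem mul_prime_add_two_le_numCyclicSubgroups {p m : ℕ} (hp : p.Prime) (hodd : Odd p)
    (hm : 1 ≤ m) (G : Type*) [Group G] (hG : Nat.card G = p ^ (m + 1)) (hnc : ¬ IsCyclic G) :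
    m * p + 2 ≤ numCyclicSubgroups G := by
  induction m, hm using Nat.le_induction generalizing G with
  | base =>
    have : Fact p.Prime := ⟨hp⟩
    have : Finite G := Nat.finite_of_card_ne_zero (by rw [hG]; exact (pow_pos hp.pos _).ne')
    obtain ⟨M, hM⟩ := Sylow.exists_subgroup_card_pow_prime p (G := G) (n := 1)
      (hG ▸ pow_dvd_pow p (Nat.le_succ 1))
    have h1 := numCyclicSubgroups_add_prime_le hp le_rfl hG hnc hM
    have h2 := two_le_numCyclicSubgroups hp (hM.trans (pow_one p))
    omega
  | succ m hm ih =>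
    obtain ⟨M, hM, hMnc⟩ := exists_not_isCyclic_card_eq_prime_pow hp hodd (by omega) hG hnc
    have h1 := numCyclicSubgroups_add_prime_le hp (by omega) hG hnc hM
    have h2 := ih M hM hMnc
    rw [add_mul, one_mul]
    omega

theorem secondMin_odd_ineq {p n : ℕ} (hp : p.Prime) (hodd : Odd p) (hn : 3 ≤ n)
    (G : Type*) [Group G] (hG : Nat.card G = p ^ n) (hnc : ¬ IsCyclic G) :
    (n - 1) * p + 2 ≤ numCyclicSubgroups G := by
  obtain ⟨m, rfl⟩ : ∃ m, n = m + 1 := ⟨n - 1, by omega⟩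
  exact mul_prime_add_two_le_numCyclicSubgroups hp hodd (by omega) G hG hnc
end

section
/- Let p be an odd prime, n ≥ 3 an integer, and G a group of order p^n that is not cyclic. Then |C(G)| = (n-1)p + 2 if and only if G is isomorphic to C_p × C_{p^{n-1}} or to the modular p-group M(p^n). -/
/-- `G` is (isomorphic to) the modular `p`-group
`M(p^n) = ⟨x, y | x^(p^(n-1)) = y^p = 1, y⁻¹xy = x^(1+p^(n-2))⟩` of order `p^n`:
it has order `p^n` and is generated by two elements satisfying the defining relations. -/
def IsModularPGroup (G : Type*) [Group G] (p n : ℕ) : Prop :=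
  Nat.card G = p ^ n ∧ ∃ x y : G, x ^ p ^ (n - 1) = 1 ∧ y ^ p = 1 ∧
    y⁻¹ * x * y = x ^ (1 + p ^ (n - 2)) ∧ Subgroup.closure {x, y} = ⊤

/-- Every cyclic subgroup has exactly `φ(|K|)` generators, so each contributes `1` to the sum. -/
theorem numCyclicSubgroups_eq_sum {G : Type*} [Group G] [Fintype G] :
    (numCyclicSubgroups G : ℚ) = ∑ g : G, ((orderOf g).totient : ℚ)⁻¹ := by
  classical
  rw [← Finset.sum_fiberwise_of_maps_to (s := Finset.univ)
    (t := Finset.univ.image (Subgroup.zpowers : G → Subgroup G)) (g := Subgroup.zpowers)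
    (fun g hg => Finset.mem_image_of_mem _ hg)]
  have hcount : numCyclicSubgroups G =
      (Finset.univ.image (Subgroup.zpowers : G → Subgroup G)).card := by
    rw [numCyclicSubgroups, Nat.card_eq_fintype_card, Fintype.card_subtype]
    congr 1
    ext K
    simp [Subgroup.isCyclic_iff_exists_zpowers_eq_top]
  rw [hcount, Finset.card_eq_sum_ones, Nat.cast_sum]
  refine Finset.sum_congr rfl fun K hK => ?_
  obtain ⟨g, -, rfl⟩ := Finset.mem_image.mp hK
  have hfib : (Finset.univ.filter fun x : G => Subgroup.zpowers x = Subgroup.zpowers g).card =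
      (orderOf g).totient := by
    have h := IsCyclic.card_orderOf_eq_totient (α := Subgroup.zpowers g)
      (d := orderOf g) (by rw [Fintype.card_zpowers])
    rw [← h, ← Finset.card_map (Function.Embedding.subtype _)]
    congr 1
    ext x
    simp only [Finset.mem_filter, Finset.mem_univ, true_and, Finset.mem_map,
      Function.Embedding.subtype_apply, Subtype.exists, Subgroup.orderOf_mk]
    constructor
    · intro hx
      refine ⟨x, hx ▸ Subgroup.mem_zpowers x, ?_, rfl⟩
      rw [← Nat.card_zpowers, hx, Nat.card_zpowers]
    · rintro ⟨y, hy, hyo, rfl⟩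
      refine Subgroup.eq_of_le_of_card_ge (by simpa using hy) ?_
      rw [Nat.card_zpowers, Nat.card_zpowers, hyo]
  rw [Finset.sum_congr rfl (g := fun _ => ((orderOf g).totient : ℚ)⁻¹), Finset.sum_const, hfib,
    nsmul_eq_mul, mul_inv_cancel₀, Nat.cast_one]
  · exact_mod_cast (Nat.totient_pos.mpr (orderOf_pos g)).ne'
  · intro x hx
    rw [Finset.mem_filter] at hx
    rw [← Nat.card_zpowers x, hx.2, Nat.card_zpowers]

section CentralCommutator

variable {G : Type*} [Group G] {w b z : G}

theorem zpow_mul_zpow_of_central (hz : w * b = b * w * z) (hzw : Commute z w)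
    (hzb : Commute z b) (k l : ℤ) : w ^ k * b ^ l = b ^ l * w ^ k * z ^ (k * l) := by
  have h1 : SemiconjBy b (w * z) w := by rw [SemiconjBy, hz, mul_assoc]
  have h2 : b * (w ^ k * z ^ k) = w ^ k * b := by
    rw [← hzw.symm.mul_zpow]; exact h1.zpow_right k
  have h3 : SemiconjBy (w ^ k) (b * (z ^ k)⁻¹) b := by
    rw [SemiconjBy, ← mul_assoc, ← h2]; group
  have h4 := h3.zpow_right l
  rw [SemiconjBy, (hzb.symm.zpow_right k).inv_right.mul_zpow] at h4
  rw [← h4, zpow_mul, inv_zpow, mul_assoc, mul_assoc, inv_mul_cancel, mul_one]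

theorem mul_pow_mul_pow_choose_of_central {x y c : G} (h : x * y = y * x * c) (hcx : Commute c x)
    (hcy : Commute c y) (n : ℕ) : (x * y) ^ n * c ^ n.choose 2 = x ^ n * y ^ n := by
  induction n with
  | zero => simp
  | succ n ih =>
    have h1 : x * y ^ n = y ^ n * x * c ^ n := by
      simpa using zpow_mul_zpow_of_central h hcx hcy 1 n
    have hc : Commute (c ^ n.choose 2) (x * y) := (hcx.mul_right hcy).pow_left _
    calc (x * y) ^ (n + 1) * c ^ (n + 1).choose 2
        = (x * y) ^ n * ((x * y) * c ^ n.choose 2) * c ^ n := by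
          have h2 : (n + 1).choose 2 = n.choose 2 + n := by
            rw [Nat.choose_succ_succ' n 1, Nat.choose_one_right, add_comm]
          rw [h2, pow_add c, pow_succ (x * y)]
          simp only [mul_assoc]
      _ = x ^ n * (y ^ n * x * (y * c ^ n)) := by
          rw [← hc.eq, ← mul_assoc, ih]; simp only [mul_assoc]
      _ = x ^ n * (y ^ n * x * c ^ n) * y := by
          rw [← (hcy.pow_left n).eq]; simp only [mul_assoc]
      _ = x ^ (n + 1) * y ^ (n + 1) := by
          rw [← h1, pow_succ x, pow_succ y]; simp only [mul_assoc]

theorem mul_pow_of_central {x y c : G} {p : ℕ} (hp : p.Prime) (hodd : Odd p)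
    (h : x * y = y * x * c) (hcx : Commute c x) (hcy : Commute c y) (hc : c ^ p = 1) :
    (x * y) ^ p = x ^ p * y ^ p := by
  have hdvd : p ∣ p.choose 2 := hp.dvd_choose_self two_ne_zero <| by
    rcases hodd with ⟨k, rfl⟩
    have := hp.two_le
    omega
  obtain ⟨k, hk⟩ := hdvd
  have := mul_pow_mul_pow_choose_of_central h hcx hcy p
  rwa [hk, pow_mul, hc, one_pow, mul_one] at this

theorem mul_pow_of_mem_products {p : ℕ} (hp : p.Prime) (hodd : Odd p)
    (hz : w * b = b * w * z) (hzw : Commute z w) (hzb : Commute z b) (hzp : z ^ p = 1)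
    (hgen : ∀ g : G, ∃ k l : ℤ, g = w ^ k * b ^ l) (g h : G) :
    (g * h) ^ p = g ^ p * h ^ p := by
  obtain ⟨k, l, rfl⟩ := hgen g
  obtain ⟨k', l', rfl⟩ := hgen h
  have hcomm (i r s : ℤ) : Commute (z ^ i) (w ^ r * b ^ s) :=
    ((hzw.zpow_right r).mul_right (hzb.zpow_right s)).zpow_left i
  have hmul (k l k' l' : ℤ) : w ^ k * b ^ l * (w ^ k' * b ^ l') =
      w ^ (k + k') * b ^ (l + l') * z ^ (-(k' * l)) := by
    have h1 : b ^ l * w ^ k' = w ^ k' * b ^ l * z ^ (-(k' * l)) := by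
      rw [zpow_mul_zpow_of_central hz hzw hzb, zpow_neg, mul_inv_cancel_right]
    have h2 : Commute (z ^ (-(k' * l))) (b ^ l') := (hzb.zpow_right _).zpow_left _
    calc w ^ k * b ^ l * (w ^ k' * b ^ l') = w ^ k * (b ^ l * w ^ k') * b ^ l' := by
          simp only [mul_assoc]
      _ = w ^ k * w ^ k' * b ^ l * (z ^ (-(k' * l)) * b ^ l') := by
          rw [h1]; simp only [mul_assoc]
      _ = _ := by rw [h2.eq, zpow_add, zpow_add]; simp only [mul_assoc]
  refine mul_pow_of_central hp hodd (c := z ^ (k * l' - k' * l)) ?_ (hcomm _ _ _) (hcomm _ _ _) ?_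
  · rw [hmul, hmul, mul_assoc _ (z ^ _), ← zpow_add, add_comm k', add_comm l']
    congr 2
    ring
  · rw [← zpow_natCast, zpow_comm, zpow_natCast, hzp, one_zpow]

end CentralCommutator

section CyclicMaximal

variable {G : Type*} [Group G] {p m : ℕ} {w : G}

theorem zpowers_normal_of_card (hp : p.Prime) (hcard : Nat.card G = p ^ (m + 1))
    (hw : orderOf w = p ^ m) : (Subgroup.zpowers w).index = p ∧ (Subgroup.zpowers w).Normal := by
  have hi : (Subgroup.zpowers w).index = p := by
    have := (Subgroup.zpowers w).index_mul_card
    rw [Nat.card_zpowers, hcard, hw, pow_succ'] at this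
    exact Nat.eq_of_mul_eq_mul_right (pow_pos hp.pos m) this
  refine ⟨hi, Subgroup.normal_of_index_eq_minFac_card ?_⟩
  rw [hi, hcard, hp.pow_minFac m.succ_ne_zero]

theorem eq_top_of_notMem_zpowers (hp : p.Prime) (hcard : Nat.card G = p ^ (m + 1))
    (hw : orderOf w = p ^ m) {b : G} (hb : b ∉ Subgroup.zpowers w) {K : Subgroup G}
    (hwK : w ∈ K) (hbK : b ∈ K) : K = ⊤ := by
  have : Finite G := Nat.finite_of_card_ne_zero (by rw [hcard]; exact (pow_pos hp.pos _).ne')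
  have hle : Subgroup.zpowers w ≤ K := by simpa using hwK
  have h1 := Subgroup.relIndex_mul_index hle
  rw [(zpowers_normal_of_card hp hcard hw).1] at h1
  rcases (Nat.dvd_prime hp).mp ⟨_, h1.symm⟩ with h | h
  · exact absurd (Subgroup.relIndex_eq_one.mp h hbK) hb
  · rw [h] at h1
    exact Subgroup.index_eq_one.mp (Nat.eq_of_mul_eq_mul_left hp.pos (by rw [h1, mul_one]))

theorem exists_eq_zpow_mul_zpow (hp : p.Prime) (hcard : Nat.card G = p ^ (m + 1))
    (hw : orderOf w = p ^ m) {b : G} (hb : b ∉ Subgroup.zpowers w) (g : G) :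
    ∃ k l : ℤ, g = w ^ k * b ^ l := by
  have := (zpowers_normal_of_card hp hcard hw).2
  have htop : Subgroup.zpowers w ⊔ Subgroup.zpowers b = ⊤ :=
    eq_top_of_notMem_zpowers hp hcard hw hb (Subgroup.mem_sup_left (Subgroup.mem_zpowers w))
      (Subgroup.mem_sup_right (Subgroup.mem_zpowers b))
  obtain ⟨-, ⟨k, rfl⟩, -, ⟨l, rfl⟩, h⟩ :=
    Subgroup.mem_sup_of_normal_left.mp (htop ▸ Subgroup.mem_top g)
  exact ⟨k, l, h.symm⟩

theorem exists_commutator_eq_zpow (hp : p.Prime) (hodd : Odd p) (hm : 1 ≤ m)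
    (hcard : Nat.card G = p ^ (m + 1)) (hw : orderOf w = p ^ m) (b : G) :
    ∃ j : ℤ, w * b = b * w * w ^ (j * p ^ (m - 1)) ∧ Commute (w ^ (j * p ^ (m - 1) : ℤ)) b ∧
      (w ^ (j * p ^ (m - 1) : ℤ)) ^ p = 1 := by
  have : Fact p.Prime := ⟨hp⟩
  obtain ⟨hi, hn⟩ := zpowers_normal_of_card hp hcard hw
  have hpm : (p : ℤ) ^ m = p ^ (m - 1) * p := by rw [← pow_succ, Nat.sub_add_cancel hm]
  obtain ⟨r, hr⟩ := hn.conj_mem' w (Subgroup.mem_zpowers w) b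
  have hr : SemiconjBy b (w ^ r) w := by
    simp only at hr
    rw [SemiconjBy, hr]; group
  have hpow (n : ℕ) : SemiconjBy (b ^ n) (w ^ (r ^ n)) w := by
    induction n with
    | zero => simp
    | succ n ih =>
      have := ih.zpow_right r
      rw [← zpow_mul, ← pow_succ] at this
      rw [pow_succ']
      exact hr.mul_left this
  have hone : w ^ (r ^ p - 1) = 1 := by
    obtain ⟨s, hs⟩ := (Subgroup.zpowers w).pow_index_mem b
    have h := hpow p
    rw [hi] at hs
    simp only at hs
    rw [SemiconjBy, ← hs, (Commute.refl w).zpow_left s |>.symm.eq] at h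
    rw [zpow_sub, zpow_one, mul_left_cancel h, mul_inv_cancel]
  rw [← orderOf_dvd_iff_zpow_eq_one, hw] at hone
  push_cast at hone
  have hfermat : (p : ℤ) ∣ r - 1 := by
    have h1 : (p : ℤ) ∣ r ^ p - 1 := (dvd_pow_self _ (by omega)).trans hone
    rw [← ZMod.intCast_zmod_eq_zero_iff_dvd] at h1 ⊢
    push_cast at h1 ⊢
    rwa [ZMod.pow_card] at h1
  have hlte : (p : ℤ) ^ (m - 1) ∣ r - 1 := by
    have h := Int.emultiplicity_pow_sub_pow hp hodd (x := r) (y := 1) hfermat (fun h => by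
      have := dvd_sub h hfermat
      rw [sub_sub_cancel] at this
      exact hp.one_lt.ne' (by exact_mod_cast Int.eq_one_of_dvd_one (by positivity) this)) p
    rw [one_pow] at h
    rw [pow_dvd_iff_le_emultiplicity] at hone ⊢
    have hpp := emultiplicity_pow_self_of_prime hp.prime 1
    rw [pow_one] at hpp
    rw [h, hpp, ← Nat.sub_add_cancel hm] at hone
    push_cast at hone
    exact (ENat.add_le_add_iff_right ENat.one_ne_top).mp hone
  obtain ⟨j, hj⟩ := hlte
  have hrj : r = j * p ^ (m - 1) + 1 := by linarith
  refine ⟨j, ?_, ?_, ?_⟩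
  · rw [mul_assoc, mul_self_zpow, ← hrj]; exact hr.eq.symm
  · have h1 := hr.zpow_right (r - 1)
    have h2 : w ^ (r * (r - 1)) = w ^ (r - 1) := by
      rw [← mul_inv_eq_one, ← zpow_neg, ← zpow_add, ← orderOf_dvd_iff_zpow_eq_one, hw]
      push_cast
      obtain ⟨c, hc⟩ := hfermat
      refine ⟨j * c, ?_⟩
      rw [hpm]
      linear_combination (r - 1) * hj + p ^ (m - 1) * j * hc
    rw [← zpow_mul, h2, hj, mul_comm _ j] at h1
    exact h1.eq.symm
  · rw [← zpow_natCast, ← zpow_mul, ← orderOf_dvd_iff_zpow_eq_one, hw]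
    push_cast
    rw [mul_assoc, ← hpm]
    exact dvd_mul_left _ _

theorem exists_notMem_zpowers (hp : p.Prime) (hcard : Nat.card G = p ^ (m + 1))
    (hw : orderOf w = p ^ m) : ∃ b, b ∉ Subgroup.zpowers w := by
  by_contra! h
  have hi := (zpowers_normal_of_card hp hcard hw).1
  rw [(Subgroup.eq_top_iff' _).mpr h, Subgroup.index_top] at hi
  exact hp.one_lt.ne hi

theorem mul_pow_prime (hp : p.Prime) (hodd : Odd p) (hm : 1 ≤ m)
    (hcard : Nat.card G = p ^ (m + 1)) (hw : orderOf w = p ^ m) (g h : G) :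
    (g * h) ^ p = g ^ p * h ^ p := by
  obtain ⟨b, hb⟩ := exists_notMem_zpowers hp hcard hw
  obtain ⟨j, hj, hcomm, hpow⟩ := exists_commutator_eq_zpow hp hodd hm hcard hw b
  exact mul_pow_of_mem_products hp hodd hj ((Commute.refl w).zpow_left _) hcomm hpow
    (exists_eq_zpow_mul_zpow hp hcard hw hb) g h

theorem pow_eq_one_of_not_isCyclic (hp : p.Prime) (hcard : Nat.card G = p ^ (m + 1))
    (hnc : ¬ IsCyclic G) (g : G) : g ^ p ^ m = 1 := by
  have : Finite G := Nat.finite_of_card_ne_zero (by rw [hcard]; exact (pow_pos hp.pos _).ne')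
  have hdvd := orderOf_dvd_natCard g
  rw [hcard] at hdvd
  obtain ⟨k, hk, hgk⟩ := (Nat.dvd_prime_pow hp).mp hdvd
  have hkm : k ≠ m + 1 := by
    rintro rfl
    exact hnc (isCyclic_of_orderOf_eq_card g (hgk.trans hcard.symm))
  rw [← orderOf_dvd_iff_pow_eq_one, hgk]
  exact pow_dvd_pow p (by omega)

theorem exists_complement_generator (hp : p.Prime) (hodd : Odd p) (hm : 1 ≤ m)
    (hcard : Nat.card G = p ^ (m + 1)) (hw : orderOf w = p ^ m) (hnc : ¬ IsCyclic G) :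
    ∃ a, a ∉ Subgroup.zpowers w ∧ a ^ p = 1 := by
  obtain ⟨b, hb⟩ := exists_notMem_zpowers hp hcard hw
  obtain ⟨hi, hn⟩ := zpowers_normal_of_card hp hcard hw
  obtain ⟨s, hs⟩ := (Subgroup.zpowers w).pow_index_mem b
  simp only [hi] at hs
  have hps : (p : ℤ) ∣ s := by
    have h := pow_eq_one_of_not_isCyclic hp hcard hnc b
    rw [← Nat.sub_add_cancel hm, pow_succ', pow_mul, ← hs, ← zpow_natCast, ← zpow_mul,
      ← orderOf_dvd_iff_zpow_eq_one, hw, ← Nat.sub_add_cancel hm, Nat.add_sub_cancel] at h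
    push_cast at h
    rw [pow_succ', mul_dvd_mul_iff_right (pow_ne_zero _ (by exact_mod_cast hp.ne_zero))] at h
    exact h
  obtain ⟨t, rfl⟩ := hps
  refine ⟨b * w ^ (-t), fun h => hb ?_, ?_⟩
  · exact (Subgroup.mul_mem_cancel_right _
      (Subgroup.zpow_mem _ (Subgroup.mem_zpowers w) _)).mp h
  · rw [mul_pow_prime hp hodd hm hcard hw, ← hs, ← zpow_natCast (w ^ (-t)), ← zpow_mul, ← zpow_add]
    convert zpow_zero w
    ring

theorem card_pow_eq_one (hp : p.Prime) (hodd : Odd p) (hcard : Nat.card G = p ^ (m + 1))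
    (hw : orderOf w = p ^ m) (hnc : ¬ IsCyclic G) {i : ℕ} (hi : 1 ≤ i) (him : i ≤ m) :
    Nat.card {g : G // g ^ p ^ i = 1} = p ^ (i + 1) := by
  have hm := hi.trans him
  obtain ⟨a, ha, hap⟩ := exists_complement_generator hp hodd hm hcard hw hnc
  have hmul (i : ℕ) (g h : G) : (g * h) ^ p ^ i = g ^ p ^ i * h ^ p ^ i := by
    induction i with
    | zero => simp
    | succ i ih =>
      rw [pow_succ, pow_mul, ih, mul_pow_prime hp hodd hm hcard hw]
      simp only [pow_mul]
  let f : G →* G := MonoidHom.mk' (fun g => g ^ p ^ i) (hmul i)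
  have hker : Nat.card {g : G // g ^ p ^ i = 1} = Nat.card f.ker := rfl
  have hrange : f.range = Subgroup.zpowers (w ^ p ^ i) := by
    apply le_antisymm
    · rintro - ⟨g, rfl⟩
      obtain ⟨k, l, rfl⟩ := exists_eq_zpow_mul_zpow hp hcard hw ha g
      refine ⟨k, ?_⟩
      have hai : a ^ p ^ i = 1 := by
        rw [← Nat.sub_add_cancel hi, pow_succ', pow_mul, hap, one_pow]
      change _ = (w ^ k * a ^ l) ^ p ^ i
      simp only
      rw [hmul, ← zpow_natCast (a ^ l), zpow_comm, zpow_natCast, hai, one_zpow, mul_one,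
        ← zpow_natCast, ← zpow_natCast, zpow_comm]
    · rw [Subgroup.zpowers_le]
      exact ⟨w, rfl⟩
  have hindex := f.ker.card_mul_index
  rw [Subgroup.index_ker, hrange, Nat.card_zpowers, hcard,
    orderOf_pow_of_dvd (pow_ne_zero _ hp.ne_zero) (hw ▸ pow_dvd_pow p him), hw,
    Nat.pow_div him hp.pos] at hindex
  rw [hker]
  refine Nat.eq_of_mul_eq_mul_right (pow_pos hp.pos (m - i)) (hindex.trans ?_)
  rw [← pow_add]
  congr 1
  omega

theorem sum_inv_totient_pow_eq_one [Fintype G] [DecidableEq G] (hp : p.Prime) (hodd : Odd p)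
    (hcard : Nat.card G = p ^ (m + 1)) (hw : orderOf w = p ^ m) (hnc : ¬ IsCyclic G) {i : ℕ}
    (hi : 1 ≤ i) (him : i ≤ m) :
    ∑ g : G with g ^ p ^ i = 1, ((orderOf g).totient : ℚ)⁻¹ = i * p + 2 := by
  have : Fact p.Prime := ⟨hp⟩
  have hp1 : (1 : ℚ) < p := by exact_mod_cast hp.one_lt
  have hp0 : (p : ℚ) - 1 ≠ 0 := (sub_pos.mpr hp1).ne'
  have hstep (i : ℕ) : ∑ g : G with g ^ p ^ (i + 1) = 1, ((orderOf g).totient : ℚ)⁻¹ =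
      ∑ g : G with g ^ p ^ i = 1, ((orderOf g).totient : ℚ)⁻¹ +
      ((Nat.card {g : G // g ^ p ^ (i + 1) = 1} : ℚ) - Nat.card {g : G // g ^ p ^ i = 1}) *
        ((p : ℚ) ^ i * (p - 1))⁻¹ := by
    have hsub : (Finset.univ.filter fun g : G => g ^ p ^ i = 1) ⊆
        Finset.univ.filter fun g : G => g ^ p ^ (i + 1) = 1 := by
      intro g
      simp only [Finset.mem_filter, Finset.mem_univ, true_and]
      intro h
      rw [pow_succ, pow_mul, h, one_pow]
    rw [← Finset.sum_sdiff hsub, add_comm]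
    congr 1
    rw [Finset.sum_congr rfl (g := fun _ => ((p : ℚ) ^ i * (p - 1))⁻¹), Finset.sum_const,
      nsmul_eq_mul, Finset.card_sdiff_of_subset hsub, Nat.cast_sub (Finset.card_le_card hsub)]
    · simp only [Nat.card_eq_fintype_card, Fintype.card_subtype]
    · intro g hg
      simp only [Finset.mem_sdiff, Finset.mem_filter, Finset.mem_univ, true_and] at hg
      rw [orderOf_eq_prime_pow hg.2 hg.1, Nat.totient_prime_pow_succ hp]
      push_cast [hp.one_le]
      rfl
  induction i, hi using Nat.le_induction with
  | base =>
    rw [hstep 0, card_pow_eq_one hp hodd hcard hw hnc (i := 0 + 1) le_rfl him]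
    simp only [pow_zero, pow_one, Finset.filter_eq', Finset.mem_univ, if_true]
    simp
    field_simp
    ring
  | succ i hi ih =>
    rw [hstep i, ih (by omega), card_pow_eq_one hp hodd hcard hw hnc (by omega) him,
      card_pow_eq_one hp hodd hcard hw hnc hi (by omega)]
    have : (p : ℚ) ≠ 0 := by positivity
    push_cast
    field_simp
    ring

theorem numCyclicSubgroups_eq_of_orderOf (hp : p.Prime) (hodd : Odd p) (hm : 1 ≤ m)
    (hcard : Nat.card G = p ^ (m + 1)) (hw : orderOf w = p ^ m) (hnc : ¬ IsCyclic G) :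
    numCyclicSubgroups G = m * p + 2 := by
  classical
  have : Finite G := Nat.finite_of_card_ne_zero (by rw [hcard]; exact (pow_pos hp.pos _).ne')
  have := Fintype.ofFinite G
  have h := sum_inv_totient_pow_eq_one hp hodd hcard hw hnc hm le_rfl
  rw [Finset.filter_true_of_mem fun g _ => pow_eq_one_of_not_isCyclic hp hcard hnc g,
    ← numCyclicSubgroups_eq_sum] at h
  exact_mod_cast h

theorem nonempty_mulEquiv_of_commute (hp : p.Prime) (hcard : Nat.card G = p ^ (m + 1))
    (hw : orderOf w = p ^ m) {a : G} (ha : a ∉ Subgroup.zpowers w) (hap : a ^ p = 1)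
    (hcomm : Commute w a) : Nonempty (G ≃* Multiplicative (ZMod p × ZMod (p ^ m))) := by
  have : Fact p.Prime := ⟨hp⟩
  have : Finite G := Nat.finite_of_card_ne_zero (by rw [hcard]; exact (pow_pos hp.pos _).ne')
  have haord : orderOf a = p := orderOf_eq_prime hap fun h => ha (h ▸ Subgroup.one_mem _)
  have hc (x : Subgroup.zpowers a) (y : Subgroup.zpowers w) :
      Commute ((Subgroup.zpowers a).subtype x) ((Subgroup.zpowers w).subtype y) := by
    obtain ⟨-, k, rfl⟩ := x
    obtain ⟨-, l, rfl⟩ := y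
    exact (hcomm.symm.zpow_left k).zpow_right l
  let f := (Subgroup.zpowers a).subtype.noncommCoprod (Subgroup.zpowers w).subtype hc
  have hsurj : Function.Surjective f := by
    rw [← MonoidHom.range_eq_top]
    refine eq_top_of_notMem_zpowers hp hcard hw ha
      ⟨(1, ⟨w, Subgroup.mem_zpowers w⟩), by simp [f]⟩ ⟨(⟨a, Subgroup.mem_zpowers a⟩, 1), by simp [f]⟩
  have hbij : Function.Bijective f := by
    refine (Nat.bijective_iff_surjective_and_card f).mpr ⟨hsurj, ?_⟩
    rw [Nat.card_prod, Nat.card_zpowers, Nat.card_zpowers, haord, hw, hcard, pow_succ']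
  have ea : Multiplicative (ZMod p) ≃* Subgroup.zpowers a := by
    have := zmodCyclicMulEquiv (G := Subgroup.zpowers a) inferInstance
    rwa [Nat.card_zpowers, haord] at this
  have ew : Multiplicative (ZMod (p ^ m)) ≃* Subgroup.zpowers w := by
    have := zmodCyclicMulEquiv (G := Subgroup.zpowers w) inferInstance
    rwa [Nat.card_zpowers, hw] at this
  exact ⟨((MulEquiv.prodMultiplicative _ _).trans
    ((ea.prodCongr ew).trans (MulEquiv.ofBijective f hbij))).symm⟩

theorem nonempty_mulEquiv_or_isModularPGroup (hp : p.Prime) (hodd : Odd p) (hm : 1 ≤ m)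
    (hcard : Nat.card G = p ^ (m + 1)) (hw : orderOf w = p ^ m) (hnc : ¬ IsCyclic G) :
    Nonempty (G ≃* Multiplicative (ZMod p × ZMod (p ^ m))) ∨ IsModularPGroup G p (m + 1) := by
  obtain ⟨a, ha, hap⟩ := exists_complement_generator hp hodd hm hcard hw hnc
  obtain ⟨j, hj, hcomm, -⟩ := exists_commutator_eq_zpow hp hodd hm hcard hw a
  have hpm : (p : ℤ) ^ m = p * p ^ (m - 1) := by rw [← pow_succ', Nat.sub_add_cancel hm]
  by_cases hpj : (p : ℤ) ∣ j
  · left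
    refine nonempty_mulEquiv_of_commute hp hcard hw ha hap ?_
    have hone : w ^ (j * p ^ (m - 1) : ℤ) = 1 := by
      rw [← orderOf_dvd_iff_zpow_eq_one, hw]
      push_cast
      rw [hpm]
      exact mul_dvd_mul_right hpj _
    rwa [hone, mul_one] at hj
  · right
    obtain ⟨v, u, huv⟩ := (Nat.prime_iff_prime_int.mp hp).coprime_iff_not_dvd.mpr hpj
    have hy : w * a ^ u = a ^ u * w * w ^ p ^ (m - 1) := by
      have h := zpow_mul_zpow_of_central hj ((Commute.refl w).zpow_left _) hcomm 1 u
      rw [zpow_one, one_mul, ← zpow_mul] at h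
      rw [h, mul_right_inj, ← zpow_natCast, ← mul_inv_eq_one, ← zpow_neg, ← zpow_add,
        ← orderOf_dvd_iff_zpow_eq_one, hw]
      push_cast
      refine ⟨-v, ?_⟩
      rw [hpm]
      linear_combination (p : ℤ) ^ (m - 1) * huv
    refine ⟨hcard, w, a ^ u, ?_, ?_, ?_, ?_⟩
    · rw [Nat.add_sub_cancel, ← hw, pow_orderOf_eq_one]
    · rw [← zpow_natCast, zpow_comm, zpow_natCast, hap, one_zpow]
    · rw [mul_assoc, hy, pow_add, pow_one, show m + 1 - 2 = m - 1 by omega]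
      group
    · refine eq_top_of_notMem_zpowers hp hcard hw (b := a ^ u) (fun h => ha ?_)
        (Subgroup.subset_closure (by simp)) (Subgroup.subset_closure (by simp))
      have h1 : a = (a ^ u) ^ j := by
        have hv : a ^ (v * p) = 1 := by rw [zpow_mul, zpow_comm, zpow_natCast a, hap, one_zpow]
        rw [← zpow_mul, ← one_mul (a ^ (u * j)), ← hv, ← zpow_add, huv, zpow_one]
      rw [h1]
      exact Subgroup.zpow_mem _ h j

theorem exists_orderOf_eq (hp : p.Prime) (hcard : Nat.card G = p ^ (m + 1))
    (h : Nonempty (G ≃* Multiplicative (ZMod p × ZMod (p ^ m))) ∨ IsModularPGroup G p (m + 1)) :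
    ∃ w : G, orderOf w = p ^ m := by
  have : Finite G := Nat.finite_of_card_ne_zero (by rw [hcard]; exact (pow_pos hp.pos _).ne')
  rcases h with ⟨⟨e⟩⟩ | ⟨-, x, y, hx, hy, hxy, htop⟩
  · refine ⟨e.symm (Multiplicative.ofAdd (0, 1)), ?_⟩
    rw [MulEquiv.orderOf_eq, orderOf_ofAdd_eq_addOrderOf, Prod.addOrderOf]
    simp [ZMod.addOrderOf_one]
  · rw [Nat.add_sub_cancel] at hx
    have hynorm : y⁻¹ ∈ Subgroup.normalizer (Subgroup.zpowers x : Set G) := by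
      apply Subgroup.mem_normalizer_fintype
      rintro - ⟨k, rfl⟩
      have h : y⁻¹ * x ^ k * y⁻¹⁻¹ = (x ^ (1 + p ^ (m + 1 - 2))) ^ k := by
        rw [← hxy, ← conj_zpow, inv_inv]
      rw [h]
      exact zpow_mem (pow_mem (Subgroup.mem_zpowers x) _) k
    have hn : (Subgroup.zpowers x).Normal := by
      rw [← Subgroup.normalizer_eq_top_iff, eq_top_iff, ← htop, Subgroup.closure_le]
      rintro g (rfl | rfl)
      · exact Subgroup.le_normalizer (Subgroup.mem_zpowers _)
      · exact inv_mem_iff.mp hynorm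
    have hsup : Subgroup.zpowers x ⊔ Subgroup.zpowers y = ⊤ := by
      rw [eq_top_iff, ← htop, Subgroup.closure_le]
      rintro g (rfl | rfl)
      · exact Subgroup.mem_sup_left (Subgroup.mem_zpowers _)
      · exact Subgroup.mem_sup_right (Subgroup.mem_zpowers _)
    have hle : Nat.card G ≤ orderOf x * orderOf y := by
      have h := Set.natCard_mul_le (s := (Subgroup.zpowers x : Set G))
        (t := (Subgroup.zpowers y : Set G))
      rw [← Subgroup.normal_mul, hsup] at h
      simpa [Nat.card_zpowers] using h
    refine ⟨x, le_antisymm (Nat.le_of_dvd (pow_pos hp.pos m) (orderOf_dvd_of_pow_eq_one hx)) ?_⟩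
    rw [hcard, pow_succ] at hle
    have hyp := Nat.le_of_dvd hp.pos (orderOf_dvd_of_pow_eq_one hy)
    exact Nat.le_of_mul_le_mul_right (hle.trans (Nat.mul_le_mul_left _ hyp)) hp.pos

end CyclicMaximal

theorem lt_numCyclicSubgroups {G : Type*} [Group G] {p n e : ℕ} {w : G} (hp : p.Prime)
    (hodd : Odd p) (he : 1 ≤ e) (hen : e + 2 ≤ n) (hcard : Nat.card G = p ^ n)
    (hw : orderOf w = p ^ e) (hexp : ∀ g : G, orderOf g ∣ p ^ e) :
    (n - 1) * p + 2 < numCyclicSubgroups G := by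
  classical
  have : Fact p.Prime := ⟨hp⟩
  have : Finite G := Nat.finite_of_card_ne_zero (by rw [hcard]; exact (pow_pos hp.pos _).ne')
  have := Fintype.ofFinite G
  obtain ⟨H, hH, hwH⟩ := Sylow.exists_subgroup_card_pow_prime_le p (m := e + 1)
    (hcard ▸ pow_dvd_pow p (by omega)) (Subgroup.zpowers w) ((Nat.card_zpowers w).trans hw)
    (by omega)
  rw [Subgroup.zpowers_le] at hwH
  have hnc : ¬ IsCyclic H := by
    intro hc
    obtain ⟨g, hg⟩ := hc.exists_ofOrder_eq_natCard
    have h := hexp g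
    rw [Subgroup.orderOf_coe, hg, hH, Nat.pow_dvd_pow_iff_le_right hp.one_lt] at h
    omega
  have hcount := numCyclicSubgroups_eq_of_orderOf (w := ⟨w, hwH⟩) hp hodd he hH
    (by rw [Subgroup.orderOf_mk, hw]) hnc
  have hinside : ∑ g : G with g ∈ H, ((orderOf g).totient : ℚ)⁻¹ = e * p + 2 := by
    have h := numCyclicSubgroups_eq_sum (G := H)
    rw [hcount] at h
    push_cast at h
    rw [h, ← Finset.sum_subtype_eq_sum_filter]
    simp
  have houtside : ((p : ℚ) ^ n - p ^ (e + 1)) * ((p : ℚ) ^ (e - 1) * (p - 1))⁻¹ ≤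
      ∑ g : G with g ∉ H, ((orderOf g).totient : ℚ)⁻¹ := by
    have hc : ((Finset.univ.filter fun g : G => g ∉ H).card : ℚ) = p ^ n - p ^ (e + 1) := by
      have h := Finset.card_filter_add_card_filter_not (s := (Finset.univ : Finset G)) (· ∈ H)
      rw [Finset.card_univ, ← Nat.card_eq_fintype_card, hcard, ← Fintype.card_subtype,
        ← Nat.card_eq_fintype_card] at h
      have h' : Nat.card {x // x ∈ H} = p ^ (e + 1) := hH
      rw [h'] at h
      rw [eq_sub_iff_add_eq', ← Nat.cast_pow, ← Nat.cast_pow, ← Nat.cast_add, h]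
    rw [← hc, ← nsmul_eq_mul]
    refine Finset.card_nsmul_le_sum _ _ _ fun g _ => ?_
    refine inv_anti₀ (by exact_mod_cast Nat.totient_pos.mpr (orderOf_pos g)) ?_
    have h := Nat.le_of_dvd (Nat.totient_pos.mpr (pow_pos hp.pos e))
      (Nat.totient_dvd_of_dvd (hexp g))
    rw [Nat.totient_prime_pow hp he] at h
    have h2 : ((p - 1 : ℕ) : ℚ) = p - 1 := by push_cast [hp.one_le]; rfl
    rw [← h2]
    exact_mod_cast h
  obtain ⟨k, rfl⟩ : ∃ k, n = e + 1 + k := ⟨n - (e + 1), by omega⟩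
  obtain ⟨d, rfl⟩ : ∃ d, e = d + 1 := ⟨e - 1, by omega⟩
  have hp1 : (1 : ℚ) < p := by exact_mod_cast hp.one_lt
  have hk : (1 : ℚ) ≤ k := by exact_mod_cast (by omega : 1 ≤ k)
  have hbern : 1 + (k : ℚ) * (p - 1) ≤ p ^ k := by
    simpa using one_add_mul_le_pow (a := (p : ℚ) - 1) (by linarith) k
  have hbound : (k : ℚ) * p <
      ((p : ℚ) ^ (d + 1 + 1 + k) - p ^ (d + 1 + 1)) * ((p : ℚ) ^ (d + 1 - 1) * (p - 1))⁻¹ := by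
    rw [Nat.add_sub_cancel, ← div_eq_mul_inv,
      lt_div_iff₀ (mul_pos (by positivity) (sub_pos.mpr hp1))]
    have h1 : (k : ℚ) * (p - 1) < p * (p ^ k - 1) := by
      have : 0 < (k : ℚ) * (p - 1) := mul_pos (by linarith) (by linarith)
      nlinarith
    calc (k : ℚ) * p * (p ^ d * (p - 1)) = (p ^ (d + 1)) * (k * (p - 1)) := by ring
      _ < p ^ (d + 1) * (p * (p ^ k - 1)) := mul_lt_mul_of_pos_left h1 (by positivity)
      _ = _ := by ring
  have htotal := numCyclicSubgroups_eq_sum (G := G)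
  rw [← Finset.sum_filter_add_sum_filter_not _ (· ∈ H), hinside] at htotal
  have hfinal : ((d + 1 + k : ℕ) : ℚ) * p + 2 < numCyclicSubgroups G := by
    rw [htotal]
    push_cast at *
    linarith
  rw [show d + 1 + 1 + k - 1 = d + 1 + k by omega]
  exact_mod_cast hfinal

theorem secondMin_odd_eq {p n : ℕ} (hp : p.Prime) (hodd : Odd p) (hn : 3 ≤ n)
    (G : Type*) [Group G] (hG : Nat.card G = p ^ n) (hnc : ¬ IsCyclic G) :
    numCyclicSubgroups G = (n - 1) * p + 2 ↔
      Nonempty (G ≃* Multiplicative (ZMod p × ZMod (p ^ (n - 1)))) ∨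
        IsModularPGroup G p n := by
  obtain ⟨m, rfl⟩ : ∃ m, n = m + 1 := ⟨n - 1, by omega⟩
  rw [Nat.add_sub_cancel]
  have : Finite G := Nat.finite_of_card_ne_zero (by rw [hG]; exact (pow_pos hp.pos _).ne')
  constructor
  · intro h
    obtain ⟨w, hmax⟩ := Finite.exists_max (orderOf : G → ℕ)
    have hprime (g : G) : ∃ k ≤ m, orderOf g = p ^ k :=
      (Nat.dvd_prime_pow hp).mp
        (orderOf_dvd_of_pow_eq_one (pow_eq_one_of_not_isCyclic hp hG hnc g))
    obtain ⟨e, hem, he⟩ := hprime w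
    rcases hem.eq_or_lt with rfl | hlt
    · exact nonempty_mulEquiv_or_isModularPGroup hp hodd (by omega) hG he hnc
    · have hexp (g : G) : orderOf g ∣ p ^ e := by
        obtain ⟨k, -, hk⟩ := hprime g
        have := hmax g
        rw [hk, he, Nat.pow_le_pow_iff_right hp.one_lt] at this
        rw [hk]
        exact pow_dvd_pow p this
      have he1 : 1 ≤ e := by
        by_contra! h0
        obtain rfl : e = 0 := by omega
        have : Subsingleton G := ⟨fun a b => by
          have h1 (g : G) : g = 1 := by simpa using hexp g
          rw [h1 a, h1 b]⟩
        exact hnc inferInstance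
      have := lt_numCyclicSubgroups hp hodd he1 (by omega) hG he hexp
      rw [Nat.add_sub_cancel] at this
      omega
  · intro h
    obtain ⟨w, hw⟩ := exists_orderOf_eq hp hG h
    exact numCyclicSubgroups_eq_of_orderOf hp hodd (by omega) hG hw hnc
end

section
/- Let n ≥ 5 be an integer and let G be a group of order 2^n that is not cyclic. Then the number of cyclic subgroups of G satisfies |C(G)| ≥ 2n, and equality holds if and only if G is isomorphic to C_2 × C_{2^{n-1}} or to the modular 2-group M(2^n). -/
/-- `z` is a central involution and `u` another involution such that `{1, z, u, z * u}` is normal. -/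
structure IsNormalKleinPair {G : Type*} [Group G] (z u : G) : Prop where
  z_ne_one : z ≠ 1
  z_sq : z ^ 2 = 1
  z_central : ∀ g, g * z * g⁻¹ = z
  u_ne_one : u ≠ 1
  u_ne_z : u ≠ z
  u_sq : u ^ 2 = 1
  conj_u : ∀ g, g * u * g⁻¹ = u ∨ g * u * g⁻¹ = z * u

section TwoGroup

variable {G : Type*} [Group G]

theorem IsPGroup.exists_zpow_mul_eq_of_odd (hp : IsPGroup 2 G) (x : G) {m : ℤ} (hm : Odd m) :
    ∃ l : ℤ, Odd l ∧ x ^ (m * l) = x := by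
  obtain ⟨k, hk⟩ := hp x
  have hc : IsCoprime m ((2 : ℤ) ^ (k + 1)) := by
    apply IsCoprime.pow_right
    rw [Int.isCoprime_iff_gcd_eq_one, Int.gcd_comm]
    have := Int.odd_iff.mp hm
    exact Int.isCoprime_iff_gcd_eq_one.mp
      ((Int.prime_two.coprime_iff_not_dvd).mpr (by omega))
  obtain ⟨l, v, h⟩ := hc
  refine ⟨l, Int.Odd.of_mul_left (n := m) ⟨-(v * 2 ^ k), ?_⟩, ?_⟩
  · rw [pow_succ] at h
    linarith
  have h1 : x ^ ((2 : ℤ) ^ (k + 1)) = 1 := by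
    rw [pow_succ, zpow_mul]
    have : x ^ ((2 : ℤ) ^ k) = 1 := by exact_mod_cast hk
    rw [this, one_zpow]
  calc x ^ (m * l) = x ^ (l * m + v * 2 ^ (k + 1)) := by
        rw [zpow_add, mul_comm v, zpow_mul x (2 ^ (k + 1)), h1, one_zpow, mul_one, mul_comm]
    _ = x := by rw [h, zpow_one]

theorem IsPGroup.eq_one_of_zpow_odd (hp : IsPGroup 2 G) {x : G} {m : ℤ} (hm : Odd m)
    (h : x ^ m = 1) : x = 1 := by
  obtain ⟨l, -, hl⟩ := hp.exists_zpow_mul_eq_of_odd x hm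
  rw [← hl, zpow_mul, h, one_zpow]

theorem IsPGroup.exists_pow_sq_eq_one (hp : IsPGroup 2 G) {x : G} (hx : x ≠ 1) :
    ∃ k : ℕ, x ^ k ≠ 1 ∧ (x ^ k) ^ 2 = 1 := by
  classical
  have h := hp x
  have h0 : Nat.find h ≠ 0 := fun h0 => hx (by simpa [h0] using Nat.find_spec h)
  obtain ⟨k, hk⟩ := Nat.exists_eq_succ_of_ne_zero h0
  refine ⟨2 ^ k, Nat.find_min h (m := k) (by omega), ?_⟩
  rw [← pow_mul, ← pow_succ, ← Nat.succ_eq_add_one, ← hk]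
  exact Nat.find_spec h

theorem IsPGroup.exists_central_involution_mem [Finite G] (hp : IsPGroup 2 G) (N : Subgroup G)
    [N.Normal] (hN : N ≠ ⊥) : ∃ c ∈ N, c ≠ 1 ∧ c ^ 2 = 1 ∧ ∀ g, g * c * g⁻¹ = c := by
  have hp' : IsPGroup 2 (ConjAct G) := hp.of_equiv ConjAct.toConjAct
  have hdvd : 2 ∣ Nat.card N := by
    rcases (hp.to_subgroup N).card_eq_or_dvd with h | h
    · exact absurd (Subgroup.card_eq_one.mp h) hN
    · exact h
  obtain ⟨b, hb, hb1⟩ := hp'.exists_fixed_point_of_prime_dvd_card_of_fixed_point N hdvd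
    (a := (1 : N)) (fun g => by simp)
  have hbc : ∀ g : G, g * b * g⁻¹ = b := fun g => by
    have := congrArg Subtype.val (hb (ConjAct.toConjAct g))
    rwa [ConjAct.Subgroup.val_conj_smul, ConjAct.smul_def, ConjAct.ofConjAct_toConjAct] at this
  have hb1' : (b : G) ≠ 1 := fun h => hb1 (Subtype.ext h.symm)
  obtain ⟨k, hk1, hk2⟩ := hp.exists_pow_sq_eq_one hb1'
  exact ⟨b ^ k, N.pow_mem b.2 k, hk1, hk2, fun g => by rw [← conj_pow, hbc]⟩

theorem IsPGroup.exists_mem_central_modulo [Finite G] (hp : IsPGroup 2 G) (A D : Subgroup G)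
    [A.Normal] [D.Normal] (h : ¬ D ≤ A) :
    ∃ g ∈ D, g ∉ A ∧ g ^ 2 ∈ A ∧ ∀ x, ∃ b ∈ A, x * g * x⁻¹ = b * g := by
  have hN : D.map (QuotientGroup.mk' A) ≠ ⊥ := fun h' => h (by
    rwa [Subgroup.map_eq_bot_iff, QuotientGroup.ker_mk'] at h')
  have : (D.map (QuotientGroup.mk' A)).Normal :=
    Subgroup.Normal.map inferInstance _ (QuotientGroup.mk'_surjective A)
  obtain ⟨c, ⟨g, hg, rfl⟩, hc1, hc2, hc⟩ :=
    (hp.to_quotient A).exists_central_involution_mem _ hN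
  simp only [QuotientGroup.mk'_apply] at hc1 hc2 hc
  refine ⟨g, hg, fun h' => hc1 ((QuotientGroup.eq_one_iff g).mpr h'),
    (QuotientGroup.eq_one_iff _).mp (by simpa using hc2), fun x => ⟨x * g * x⁻¹ * g⁻¹, ?_, by group⟩⟩
  rw [← QuotientGroup.eq_one_iff]
  have := hc (x : G ⧸ A)
  rw [QuotientGroup.mk_mul, QuotientGroup.mk_mul, QuotientGroup.mk_mul, QuotientGroup.mk_inv,
    QuotientGroup.mk_inv, this, mul_inv_cancel]

theorem eq_or_eq_of_mem_zpowers_of_sq_eq_one [Finite G] {a w z : G}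
    (hw : w ∈ Subgroup.zpowers a) (hz : z ∈ Subgroup.zpowers a) (hz1 : z ≠ 1) (hz2 : z ^ 2 = 1)
    (hw2 : w ^ 2 = 1) : w = 1 ∨ w = z := by
  classical
  let := Fintype.ofFinite (Subgroup.zpowers a)
  by_contra! hcon
  have h := IsCyclic.card_pow_eq_one_le (α := Subgroup.zpowers a) (n := 2) two_pos
  have h3 : ({1, ⟨w, hw⟩, ⟨z, hz⟩} : Finset (Subgroup.zpowers a)) ⊆
      Finset.univ.filter (fun g => g ^ 2 = 1) := by
    intro g hg
    simp only [Finset.mem_insert, Finset.mem_singleton] at hg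
    simp only [Finset.mem_filter, Finset.mem_univ, true_and]
    rcases hg with rfl | rfl | rfl <;> ext <;> simp [hw2, hz2]
  have h4 := Finset.card_le_card h3
  rw [Finset.card_eq_three.mpr ⟨_, _, _, ?_, ?_, ?_, rfl⟩] at h4
  · omega
  · simpa [Subtype.ext_iff] using fun h => hcon.1 h.symm
  · simpa [Subtype.ext_iff] using fun h => hz1 h.symm
  · simpa [Subtype.ext_iff] using hcon.2

/-- The subgroup of elements acting on the normal subgroup `⟨a⟩` by an exponent congruent to `1`
modulo `4`. -/
def oneModFourSubgroup [Finite G] (a : G) : Subgroup G where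
  carrier := {g | ∃ k : ℤ, g * a * g⁻¹ = a ^ (1 + 4 * k)}
  one_mem' := ⟨0, by simp⟩
  mul_mem' := by
    rintro g h ⟨k, hk⟩ ⟨l, hl⟩
    refine ⟨k + l + 4 * k * l, ?_⟩
    calc g * h * a * (g * h)⁻¹ = g * (h * a * h⁻¹) * g⁻¹ := by group
      _ = a ^ ((1 + 4 * k) * (1 + 4 * l)) := by rw [hl, ← conj_zpow, hk, zpow_mul]
      _ = _ := by congr 1; ring
  inv_mem' := by
    rintro g ⟨k, hk⟩
    have key : ∀ n : ℕ, ∃ l : ℤ, g ^ n * a * (g ^ n)⁻¹ = a ^ (1 + 4 * l) := by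
      intro n
      induction n with
      | zero => exact ⟨0, by simp⟩
      | succ n ih =>
        obtain ⟨l, hl⟩ := ih
        refine ⟨k + l + 4 * k * l, ?_⟩
        calc g ^ (n + 1) * a * (g ^ (n + 1))⁻¹ = g * (g ^ n * a * (g ^ n)⁻¹) * g⁻¹ := by
              rw [pow_succ']; group
          _ = a ^ ((1 + 4 * k) * (1 + 4 * l)) := by rw [hl, ← conj_zpow, hk, zpow_mul]
          _ = _ := by congr 1; ring
    obtain ⟨l, hl⟩ := key (orderOf g - 1)
    refine ⟨l, ?_⟩
    have : g ^ (orderOf g - 1) = g⁻¹ := by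
      rw [eq_inv_iff_mul_eq_one, ← pow_succ, Nat.sub_add_cancel (orderOf_pos g), pow_orderOf_eq_one]
    rwa [this] at hl

theorem Subgroup.Normal.exists_conj_eq_zpow {a : G} (ha : (Subgroup.zpowers a).Normal) (g : G) :
    ∃ r : ℤ, g * a * g⁻¹ = a ^ r := by
  obtain ⟨r, hr⟩ := ha.conj_mem a (Subgroup.mem_zpowers a) g
  exact ⟨r, hr.symm⟩

theorem oneModFourSubgroup_normal [Finite G] {a : G} (ha : (Subgroup.zpowers a).Normal) :
    (oneModFourSubgroup a).Normal where
  conj_mem := by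
    rintro g ⟨k, hk⟩ h
    obtain ⟨r, hr⟩ := ha.exists_conj_eq_zpow h⁻¹
    refine ⟨k, ?_⟩
    calc h * g * h⁻¹ * a * (h * g * h⁻¹)⁻¹ = h * (g * (h⁻¹ * a * h⁻¹⁻¹) * g⁻¹) * h⁻¹ := by group
      _ = h * ((a ^ r) ^ (1 + 4 * k)) * h⁻¹ := by
        rw [hr, ← conj_zpow, hk, ← zpow_mul, ← zpow_mul, mul_comm]
      _ = a ^ (1 + 4 * k) := by rw [← hr, conj_zpow]; group

/-- In a finite `2`-group without a normal Klein four-group, let `⟨a⟩` be a normal cyclic subgroup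
of maximal order. Then no element outside `⟨a⟩` acts on it by an exponent `≡ 1 (mod 4)`. -/
theorem oneModFourSubgroup_le_zpowers [Finite G] (hp : IsPGroup 2 G)
    (hK : ¬ ∃ z u : G, IsNormalKleinPair z u) {a : G} (ha1 : a ≠ 1)
    (ha : (Subgroup.zpowers a).Normal)
    (hmax : ∀ b : G, (Subgroup.zpowers b).Normal → orderOf b ≤ orderOf a) :
    oneModFourSubgroup a ≤ Subgroup.zpowers a := by
  by_contra hle
  have := oneModFourSubgroup_normal ha
  obtain ⟨g, ⟨k, hk⟩, hgA, ⟨s, hs⟩, hgc⟩ := hp.exists_mem_central_modulo _ _ hle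
  simp only at hs
  have hodd : Odd (1 + 2 * k) := ⟨k, by ring⟩
  have h8 : a ^ (8 * k) = 1 := by
    apply hp.eq_one_of_zpow_odd hodd
    have h1 : g ^ 2 * a * (g ^ 2)⁻¹ = a ^ ((1 + 4 * k) * (1 + 4 * k)) := by
      calc g ^ 2 * a * (g ^ 2)⁻¹ = g * (g * a * g⁻¹) * g⁻¹ := by rw [pow_two]; group
        _ = _ := by rw [hk, ← conj_zpow, hk, zpow_mul]
    have h2 : g ^ 2 * a * (g ^ 2)⁻¹ = a := by rw [← hs]; group
    rw [h2] at h1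
    rw [← zpow_mul]
    calc a ^ (8 * k * (1 + 2 * k)) = a ^ ((1 + 4 * k) * (1 + 4 * k)) * a⁻¹ := by
          rw [← zpow_sub_one]; congr 1; ring
      _ = 1 := by rw [← h1, mul_inv_cancel]
  have h4 : a ^ (4 * k * s) = 1 := by
    have h1 : g * a ^ s * g⁻¹ = a ^ s := by rw [hs]; group
    rw [← conj_zpow, hk, ← zpow_mul] at h1
    calc a ^ (4 * k * s) = a ^ ((1 + 4 * k) * s) * (a ^ s)⁻¹ := by
          rw [← zpow_neg, ← zpow_add]; congr 1; ring
      _ = 1 := by rw [h1, mul_inv_cancel]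
  rcases Int.even_or_odd s with ⟨t, ht⟩ | hso
  · obtain ⟨l, -, hl⟩ := hp.exists_zpow_mul_eq_of_odd a hodd
    have hu2 : (a ^ (-t * l) * g) ^ 2 = 1 := by
      calc (a ^ (-t * l) * g) ^ 2 = a ^ (-t * l) * (g * a * g⁻¹) ^ (-t * l) * g ^ 2 := by
            rw [conj_zpow, pow_two, pow_two]; group
        _ = (a ^ ((1 + 2 * k) * l)) ^ (-t * 2) * a ^ (2 * t) := by
            rw [hk, ← hs, ← zpow_mul, ← zpow_mul, ← zpow_add, ← zpow_add, ← zpow_add]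
            congr 1; rw [ht]; ring
        _ = 1 := by rw [hl, ← zpow_add]; convert zpow_zero a using 2; ring
    set u := a ^ (-t * l) * g with hu
    have huA : u ∉ Subgroup.zpowers a := fun h => hgA
      ((Subgroup.mul_mem_cancel_left _ (Subgroup.zpow_mem_zpowers a _)).mp h)
    obtain ⟨z, hzA, hz1, hz2, hzc⟩ := hp.exists_central_involution_mem (Subgroup.zpowers a)
      (by simpa using ha1)
    refine hK ⟨z, u, hz1, hz2, hzc, fun h => huA (h ▸ one_mem _), fun h => huA (h ▸ hzA), hu2,
      fun x => ?_⟩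
    obtain ⟨b, ⟨j, hj⟩, hb⟩ := hgc x
    simp only at hj
    obtain ⟨r, hr⟩ := ha.exists_conj_eq_zpow x
    have hconj : x * u * x⁻¹ = a ^ (r * (-t * l) + j + t * l) * u := by
      calc x * u * x⁻¹ = (x * a * x⁻¹) ^ (-t * l) * (x * g * x⁻¹) := by
            rw [conj_zpow, hu]; group
        _ = a ^ (r * (-t * l) + j + t * l) * u := by
            rw [hr, hb, ← hj, hu, ← zpow_mul]; group
    set i := r * (-t * l) + j + t * l
    have hua : u * a * u⁻¹ = a ^ (1 + 4 * k) := by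
      calc u * a * u⁻¹ = a ^ (-t * l) * (g * a * g⁻¹) * (a ^ (-t * l))⁻¹ := by rw [hu]; group
        _ = a ^ (1 + 4 * k) := by rw [hk]; group
    have hi : (a ^ i) ^ 2 = 1 := by
      have h1 : (a ^ i * u) ^ 2 = 1 := by rw [← hconj, conj_pow, hu2]; group
      rw [← zpow_natCast, ← zpow_mul]
      apply hp.eq_one_of_zpow_odd hodd
      calc (a ^ (i * (2 : ℕ))) ^ (1 + 2 * k) = a ^ i * (u * a * u⁻¹) ^ i * u ^ 2 := by
            rw [hu2, mul_one, hua, ← zpow_mul, ← zpow_mul, ← zpow_add]; congr 1; push_cast; ring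
        _ = (a ^ i * u) ^ 2 := by rw [conj_zpow, pow_two, pow_two]; group
        _ = 1 := h1
    rw [hconj]
    rcases eq_or_eq_of_mem_zpowers_of_sq_eq_one (Subgroup.zpow_mem_zpowers a i) hzA hz1 hz2 hi with h | h
    · left; rw [h, one_mul]
    · right; rw [h]
  · obtain ⟨l, -, hl⟩ := hp.exists_zpow_mul_eq_of_odd a hso
    have hag : a ∈ Subgroup.zpowers g := by
      rw [← hl, zpow_mul, hs]
      exact zpow_mem (pow_mem (Subgroup.mem_zpowers g) 2) l
    have hle' : Subgroup.zpowers a ≤ Subgroup.zpowers g := by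
      rwa [Subgroup.zpowers_le]
    have hnorm : (Subgroup.zpowers g).Normal := by
      refine ⟨fun y hy x => ?_⟩
      obtain ⟨i, rfl⟩ := hy
      simp only
      rw [← conj_zpow]
      obtain ⟨b, hbA, hb⟩ := hgc x
      rw [hb]
      exact zpow_mem (mul_mem (hle' hbA) (Subgroup.mem_zpowers g)) i
    have hcard := hmax g hnorm
    rw [← Nat.card_zpowers, ← Nat.card_zpowers] at hcard
    exact hgA (Subgroup.eq_of_le_of_card_ge hle' hcard ▸ Subgroup.mem_zpowers g)

/-- A noncyclic finite `2`-group without a normal Klein four-group has a cyclic subgroup of index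
two such that all elements outside it have order dividing `4`. -/
theorem exists_index_two_of_not_exists_isNormalKleinPair [Finite G] (hp : IsPGroup 2 G)
    (hnc : ¬ IsCyclic G) (hK : ¬ ∃ z u : G, IsNormalKleinPair z u) :
    ∃ a : G, (Subgroup.zpowers a).index = 2 ∧ ∀ g ∉ Subgroup.zpowers a, g ^ 4 = 1 := by
  classical
  obtain ⟨a, ha, hmax⟩ := (Set.toFinite {a : G | (Subgroup.zpowers a).Normal}).exists_maximalFor
    orderOf _ ⟨1, by
      show (Subgroup.zpowers (1 : G)).Normal
      rw [Subgroup.zpowers_one_eq_bot]; infer_instance⟩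
  have ha : (Subgroup.zpowers a).Normal := ha
  have hmax : ∀ b : G, (Subgroup.zpowers b).Normal → orderOf b ≤ orderOf a := fun b hb =>
    (le_total _ _).elim id fun h => hmax hb h
  have hnt : Nontrivial G := by
    by_contra h
    rw [not_nontrivial_iff_subsingleton] at h
    exact hnc inferInstance
  have ha1 : a ≠ 1 := by
    rintro rfl
    obtain ⟨c, -, hc1, -, hc⟩ := hp.exists_central_involution_mem (⊤ : Subgroup G) top_ne_bot
    have h := hmax c ⟨fun y hy x => by
      obtain ⟨i, rfl⟩ := hy
      simp only
      rw [← conj_zpow, hc]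
      exact Subgroup.zpow_mem_zpowers c i⟩
    rw [orderOf_one] at h
    exact hc1 (orderOf_eq_one_iff.mp (le_antisymm h (orderOf_pos c)))
  have hD := oneModFourSubgroup_le_zpowers hp hK ha1 ha hmax
  have hact : ∀ g ∉ Subgroup.zpowers a, ∃ k : ℤ, g * a * g⁻¹ = a ^ (4 * k - 1) := by
    intro g hg
    obtain ⟨r, hr⟩ := ha.exists_conj_eq_zpow g
    rcases Int.even_or_odd r with ⟨t, ht⟩ | hro
    · obtain ⟨j, hj1, hj2⟩ := hp.exists_pow_sq_eq_one ha1
      exfalso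
      apply hj1
      have h1 : g * a ^ j * g⁻¹ = 1 := by
        calc g * a ^ j * g⁻¹ = (a ^ r) ^ j := by rw [← conj_pow, hr]
          _ = ((a ^ j) ^ 2) ^ t := by
            simp only [← zpow_natCast, ← zpow_mul]; congr 1; rw [ht]; push_cast; ring
          _ = 1 := by rw [hj2, one_zpow]
      simpa using h1
    · have h4 : r % 4 = 1 ∨ r % 4 = 3 := by have := Int.odd_iff.mp hro; omega
      rcases h4 with h4 | h4
      · exact absurd (hD ⟨r / 4, by rw [hr]; congr 1; omega⟩) hg
      · exact ⟨r / 4 + 1, by rw [hr]; congr 1; omega⟩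
  have hprod : ∀ g ∉ Subgroup.zpowers a, ∀ h ∉ Subgroup.zpowers a, g * h ∈ Subgroup.zpowers a := by
    intro g hg h hh
    obtain ⟨k, hk⟩ := hact g hg
    obtain ⟨l, hl⟩ := hact h hh
    refine hD ⟨4 * k * l - k - l, ?_⟩
    calc g * h * a * (g * h)⁻¹ = g * (h * a * h⁻¹) * g⁻¹ := by group
      _ = a ^ ((4 * k - 1) * (4 * l - 1)) := by rw [hl, ← conj_zpow, hk, zpow_mul]
      _ = _ := by congr 1; ring
  refine ⟨a, ?_, fun g hg => ?_⟩
  · have hne : ∃ g, g ∉ Subgroup.zpowers a := by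
      by_contra! h
      exact hnc ⟨a, h⟩
    obtain ⟨g, hg⟩ := hne
    rw [Subgroup.index_eq_two_iff]
    refine ⟨g, fun b => ?_⟩
    by_cases hb : b ∈ Subgroup.zpowers a
    · exact Or.inr ⟨hb, fun h => hg ((Subgroup.mul_mem_cancel_left _ hb).mp h)⟩
    · exact Or.inl ⟨hprod b hb g hg, hb⟩
  · obtain ⟨s, hs⟩ := pow_two g ▸ hprod g hg g hg
    simp only at hs
    obtain ⟨k, hk⟩ := hact g hg
    have h1 : g * a ^ s * g⁻¹ = a ^ s := by rw [hs]; group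
    have h2 : a ^ (s * 2) = 1 := by
      apply hp.eq_one_of_zpow_odd (m := 2 * k - 1) ⟨k - 1, by ring⟩
      rw [← conj_zpow, hk, ← zpow_mul] at h1
      rw [← zpow_mul]
      calc a ^ (s * 2 * (2 * k - 1)) = a ^ ((4 * k - 1) * s) * (a ^ s)⁻¹ := by
            rw [← zpow_neg, ← zpow_add]; congr 1; ring
        _ = 1 := by rw [h1, mul_inv_cancel]
    calc g ^ 4 = (g ^ 2) ^ 2 := by rw [← pow_mul]
      _ = a ^ (s * 2) := by rw [← hs, zpow_mul]; norm_cast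
      _ = 1 := h2

variable (G) in
/-- The number of cyclic subgroups of order `2 ^ k`. -/
noncomputable def numCyclicSubgroupsTwoPow (k : ℕ) : ℕ :=
  {H : Subgroup G | IsCyclic H ∧ Nat.card H = 2 ^ k}.ncard

theorem numCyclicSubgroups_eq_sum_s5 [Finite G] {e : ℕ} (he : ∀ g : G, orderOf g ∣ 2 ^ e) :
    numCyclicSubgroups G = ∑ k ∈ Finset.range (e + 1), numCyclicSubgroupsTwoPow G k := by
  classical
  let := Fintype.ofFinite (Subgroup G)
  rw [numCyclicSubgroups, Nat.card_eq_fintype_card, Fintype.card_subtype,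
    Finset.card_eq_sum_card_fiberwise (f := fun H : Subgroup G => Nat.log 2 (Nat.card H))
      (t := Finset.range (e + 1))]
  · refine Finset.sum_congr rfl fun k _ => ?_
    rw [numCyclicSubgroupsTwoPow, ← Set.ncard_coe_finset]
    congr 1
    ext H
    simp only [Finset.coe_filter, Finset.mem_filter, Finset.mem_univ, true_and, Set.mem_ofPred_eq]
    refine and_congr_right fun hH => ⟨fun h => ?_, fun h => by rw [h, Nat.log_pow one_lt_two]⟩
    obtain ⟨g, rfl⟩ := Subgroup.isCyclic_iff_exists_zpowers_eq_top H |>.mp hH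
    rw [Nat.card_zpowers] at h ⊢
    obtain ⟨j, -, hj⟩ := (Nat.dvd_prime_pow Nat.prime_two).mp (he g)
    rw [hj, Nat.log_pow one_lt_two] at h
    rw [hj, h]
  · intro H hH
    have hH : IsCyclic H := by simpa using hH
    obtain ⟨g, rfl⟩ := Subgroup.isCyclic_iff_exists_zpowers_eq_top H |>.mp hH
    obtain ⟨j, hje, hj⟩ := (Nat.dvd_prime_pow Nat.prime_two).mp (he g)
    simp only [Nat.card_zpowers, hj, Nat.log_pow one_lt_two, Finset.coe_range, Set.mem_Iio]
    omega

theorem card_orderOf_eq_two_pow [Fintype G] [DecidableEq G] (k : ℕ) :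
    (Finset.univ.filter fun g : G => orderOf g = 2 ^ k).card =
      numCyclicSubgroupsTwoPow G k * (2 ^ k).totient := by
  classical
  let := Fintype.ofFinite (Subgroup G)
  rw [Finset.card_eq_sum_card_fiberwise (f := Subgroup.zpowers)
    (t := Finset.univ.filter fun H : Subgroup G => IsCyclic H ∧ Nat.card H = 2 ^ k)]
  · rw [Finset.sum_const_nat (m := (2 ^ k).totient)]
    · congr 1
      rw [numCyclicSubgroupsTwoPow, ← Set.ncard_coe_finset]
      simp
    · intro H hH
      obtain ⟨hc, hk⟩ : IsCyclic H ∧ Nat.card H = 2 ^ k := (Finset.mem_filter.mp hH).2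
      have h := IsCyclic.card_orderOf_eq_totient (α := H) (d := 2 ^ k)
        (by rw [← Nat.card_eq_fintype_card, hk])
      rw [← h]
      symm
      refine Finset.card_bij (fun g _ => (g : G)) ?_ (fun _ _ _ _ h => Subtype.ext h) ?_
      · intro g hg
        have hg : orderOf g = 2 ^ k := by simpa using hg
        have hg' : orderOf (g : G) = 2 ^ k := by rwa [Subgroup.orderOf_coe]
        simp only [Finset.mem_filter, Finset.mem_univ, true_and]
        refine ⟨hg', Subgroup.eq_of_le_of_card_ge (by simp) ?_⟩
        rw [Nat.card_zpowers, hg', hk]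
      · intro g hg
        obtain ⟨hg, rfl⟩ := by simpa using hg
        exact ⟨⟨g, Subgroup.mem_zpowers g⟩, by simpa using hg, rfl⟩
  · intro g hg
    have hg : orderOf g = 2 ^ k := by simpa using hg
    simp only [Finset.coe_filter, Finset.mem_univ, true_and, Set.mem_ofPred_eq, Nat.card_zpowers, hg,
      and_true]
    infer_instance

theorem card_eq_sum_numCyclicSubgroupsTwoPow [Finite G] {e : ℕ} (he : ∀ g : G, orderOf g ∣ 2 ^ e) :
    Nat.card G =
      ∑ k ∈ Finset.range (e + 1), numCyclicSubgroupsTwoPow G k * (2 ^ k).totient := by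
  classical
  let := Fintype.ofFinite G
  rw [Nat.card_eq_fintype_card, ← Finset.card_univ,
    Finset.card_eq_sum_card_fiberwise (f := fun g => Nat.log 2 (orderOf g))
      (t := Finset.range (e + 1))]
  · refine Finset.sum_congr rfl fun k _ => ?_
    rw [← card_orderOf_eq_two_pow]
    congr 1
    ext g
    obtain ⟨j, hje, hj⟩ := (Nat.dvd_prime_pow Nat.prime_two).mp (he g)
    simp only [Finset.mem_filter, Finset.mem_univ, true_and, hj, Nat.log_pow one_lt_two]
    exact (Nat.pow_right_injective le_rfl).eq_iff.symm
  · intro g _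
    obtain ⟨j, hje, hj⟩ := (Nat.dvd_prime_pow Nat.prime_two).mp (he g)
    simp only [hj, Nat.log_pow one_lt_two, Finset.coe_range, Set.mem_Iio]
    omega

theorem one_le_numCyclicSubgroupsTwoPow [Finite G] {x : G} {k : ℕ} (hx : orderOf x = 2 ^ k) :
    1 ≤ numCyclicSubgroupsTwoPow G k := by
  rw [numCyclicSubgroupsTwoPow, Nat.one_le_iff_ne_zero, Ne, Set.ncard_eq_zero (Set.toFinite _)]
  exact Set.nonempty_iff_ne_empty.mp ⟨Subgroup.zpowers x, inferInstance, by rw [Nat.card_zpowers, hx]⟩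

theorem two_le_numCyclicSubgroupsTwoPow [Finite G] {x y : G} {k : ℕ} (hx : orderOf x = 2 ^ k)
    (hy : orderOf y = 2 ^ k) (hxy : y ∉ Subgroup.zpowers x) :
    2 ≤ numCyclicSubgroupsTwoPow G k := by
  have hne : Subgroup.zpowers x ≠ Subgroup.zpowers y := fun h =>
    hxy (h ▸ Subgroup.mem_zpowers y)
  rw [numCyclicSubgroupsTwoPow]
  refine (Set.ncard_pair hne).symm.trans_le (Set.ncard_le_ncard ?_ (Set.toFinite _))
  rintro H (rfl | rfl)
  · exact ⟨inferInstance, by rw [Nat.card_zpowers, hx]⟩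
  · exact ⟨inferInstance, by rw [Nat.card_zpowers, hy]⟩

theorem zpowers_ne_zpowers_of_sq_eq_one [Finite G] {x y : G} (hx1 : x ≠ 1) (hx2 : x ^ 2 = 1)
    (hy1 : y ≠ 1) (hy2 : y ^ 2 = 1) (hxy : x ≠ y) : Subgroup.zpowers x ≠ Subgroup.zpowers y := by
  intro h
  rcases eq_or_eq_of_mem_zpowers_of_sq_eq_one (h ▸ Subgroup.mem_zpowers x)
    (Subgroup.mem_zpowers y) hy1 hy2 hx2 with h | h
  · exact hx1 h
  · exact hxy h

namespace IsNormalKleinPair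

variable {z u : G}

theorem commute_z (h : IsNormalKleinPair z u) (g : G) : Commute g z :=
  mul_inv_eq_iff_eq_mul.mp (h.z_central g)

theorem three_le_numCyclicSubgroupsTwoPow_one [Finite G] (h : IsNormalKleinPair z u) :
    3 ≤ numCyclicSubgroupsTwoPow G 1 := by
  have hzu1 : z * u ≠ 1 := fun h' => h.u_ne_z (by
    rw [← mul_one z, ← h', ← mul_assoc, ← pow_two, h.z_sq, one_mul])
  have hzu2 : (z * u) ^ 2 = 1 := by
    rw [(h.commute_z u).symm.mul_pow, h.z_sq, h.u_sq, one_mul]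
  have h1 := zpowers_ne_zpowers_of_sq_eq_one h.z_ne_one h.z_sq h.u_ne_one h.u_sq h.u_ne_z.symm
  have h2 := zpowers_ne_zpowers_of_sq_eq_one h.z_ne_one h.z_sq hzu1 hzu2
    (fun h' => h.u_ne_one (by simpa using h'))
  have h3 := zpowers_ne_zpowers_of_sq_eq_one h.u_ne_one h.u_sq hzu1 hzu2
    (fun h' => h.z_ne_one (by simpa using h'))
  have hord : ∀ {v : G}, v ≠ 1 → v ^ 2 = 1 → Nat.card (Subgroup.zpowers v) = 2 ^ 1 := by
    intro v hv1 hv2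
    rw [Nat.card_zpowers, orderOf_eq_prime hv2 hv1, pow_one]
  have hcard : ({Subgroup.zpowers z, Subgroup.zpowers u, Subgroup.zpowers (z * u)} :
      Set (Subgroup G)).ncard = 3 := Set.ncard_eq_three.mpr ⟨_, _, _, h1, h2, h3, rfl⟩
  rw [numCyclicSubgroupsTwoPow, ← hcard]
  refine Set.ncard_le_ncard ?_ (Set.toFinite _)
  rintro H (rfl | rfl | rfl)
  · exact ⟨inferInstance, hord h.z_ne_one h.z_sq⟩
  · exact ⟨inferInstance, hord h.u_ne_one h.u_sq⟩
  · exact ⟨inferInstance, hord hzu1 hzu2⟩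

/-- Some involution `y` of the Klein four-group lies outside `⟨x⟩`; if it does not commute with `x`,
then `z ∈ ⟨x⟩` and conjugation by `y` multiplies `x` by `z`. -/
theorem exists_notMem_zpowers [Finite G] (h : IsNormalKleinPair z u) (x : G) :
    ∃ y, (y = z ∨ y = u) ∧ y ∉ Subgroup.zpowers x ∧ y ^ 2 = 1 ∧
      (Commute x y ∨ z ∈ Subgroup.zpowers x ∧ y⁻¹ * x * y = x * z) := by
  by_cases hz : z ∈ Subgroup.zpowers x
  · refine ⟨u, Or.inr rfl, fun hu => ?_, h.u_sq, ?_⟩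
    · rcases eq_or_eq_of_mem_zpowers_of_sq_eq_one hu hz h.z_ne_one h.z_sq h.u_sq with h' | h'
      · exact h.u_ne_one h'
      · exact h.u_ne_z h'
    · rcases h.conj_u x with h' | h'
      · exact Or.inl (mul_inv_eq_iff_eq_mul.mp h')
      · refine Or.inr ⟨hz, ?_⟩
        rw [mul_assoc, mul_inv_eq_iff_eq_mul.mp h', ← (h.commute_z u).eq, (h.commute_z x).eq]
        group
  · exact ⟨z, Or.inl rfl, hz, h.z_sq, Or.inl (h.commute_z x)⟩

theorem two_le_numCyclicSubgroupsTwoPow [Finite G]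
    (h : IsNormalKleinPair z u) {x : G} {k : ℕ} (hx : orderOf x = 2 ^ k)
    (hk : 2 ≤ k) (hc : 3 ≤ k ∨ Commute x u) : 2 ≤ numCyclicSubgroupsTwoPow G k := by
  obtain ⟨y, hyzu, hyx, hy2, hy⟩ := h.exists_notMem_zpowers x
  have hxy : x * y ∉ Subgroup.zpowers x := fun h' => hyx
    ((Subgroup.mul_mem_cancel_left _ (Subgroup.mem_zpowers x)).mp h')
  obtain ⟨j, rfl⟩ : ∃ j, k = j + 1 := ⟨k - 1, by omega⟩
  have hpow : ∀ i, (Commute x y ∨ 2 ≤ i) → 1 ≤ i → (x * y) ^ 2 ^ i = x ^ 2 ^ i := by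
    intro i hi hi1
    by_cases hcom : Commute x y
    · rw [hcom.mul_pow]
      obtain ⟨i', rfl⟩ : ∃ i', i = i' + 1 := ⟨i - 1, by omega⟩
      rw [pow_succ' 2 i', pow_mul y, hy2, one_pow, mul_one]
    · have hi := hi.resolve_left hcom
      have hconj := (hy.resolve_left hcom).2
      have hsq : (x * y) ^ 2 = x ^ 2 * z := by
        have : y⁻¹ = y := inv_eq_of_mul_eq_one_left (by rw [← pow_two, hy2])
        rw [this] at hconj
        rw [pow_two, mul_assoc x y, ← mul_assoc y, hconj, ← mul_assoc, pow_two]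
      obtain ⟨i', rfl⟩ : ∃ i', i = i' + 2 := ⟨i - 2, by omega⟩
      rw [pow_add, mul_comm, show (2 ^ 2 : ℕ) = 2 * 2 from rfl, mul_assoc, pow_mul, hsq,
        (h.commute_z _).mul_pow, pow_mul z, h.z_sq, one_pow, mul_one, ← pow_mul]
  have hcom : Commute x y ∨ 2 ≤ j := by
    rcases hc with hc | hc
    · exact Or.inr (by omega)
    · rcases hyzu with rfl | rfl
      · exact Or.inl (h.commute_z x)
      · exact Or.inl hc
  refine _root_.two_le_numCyclicSubgroupsTwoPow hx (orderOf_eq_prime_pow ?_ ?_) hxy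
  · rw [hpow j hcom (by omega)]
    intro h'
    have := orderOf_dvd_of_pow_eq_one h'
    rw [hx, Nat.pow_dvd_pow_iff_le_right one_lt_two] at this
    omega
  · rw [hpow (j + 1) (hcom.imp_right (by omega)) (by omega), ← hx, pow_orderOf_eq_one]

theorem commute_sq (h : IsNormalKleinPair z u) (x : G) : Commute (x ^ 2) u := by
  have hx : x ^ 2 * u * (x ^ 2)⁻¹ = x * (x * u * x⁻¹) * x⁻¹ := by rw [pow_two]; group
  refine mul_inv_eq_iff_eq_mul.mp (hx.trans ?_)
  rcases h.conj_u x with h2 | h2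
  · rw [h2, h2]
  · calc x * (x * u * x⁻¹) * x⁻¹ = (x * z * x⁻¹) * (x * u * x⁻¹) := by rw [conj_mul, ← h2]
      _ = z ^ 2 * u := by rw [h.z_central, h2, pow_two, mul_assoc]
      _ = u := by rw [h.z_sq, one_mul]

end IsNormalKleinPair

theorem totient_two_pow_le {k E : ℕ} (h : k ≤ E + 1) : (2 ^ k).totient ≤ 2 ^ E := by
  rcases k with _ | k
  · simpa using Nat.one_le_two_pow
  · rw [Nat.totient_prime_pow_succ Nat.prime_two]
    simpa using Nat.pow_le_pow_right two_pos (by omega)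

theorem card_le_numCyclicSubgroups_mul [Finite G] {E : ℕ}
    (he : ∀ g : G, orderOf g ∣ 2 ^ (E + 1)) :
    Nat.card G ≤ numCyclicSubgroups G * 2 ^ E := by
  rw [card_eq_sum_numCyclicSubgroupsTwoPow he, numCyclicSubgroups_eq_sum_s5 he, Finset.sum_mul]
  refine Finset.sum_le_sum fun k hk => Nat.mul_le_mul_left _ ?_
  exact totient_two_pow_le (by have := Finset.mem_range.mp hk; omega)

theorem two_pow_add_le_numCyclicSubgroups [Finite G] {E : ℕ}
    (he : ∀ g : G, orderOf g ∣ 2 ^ (E + 1)) (h0 : 1 ≤ numCyclicSubgroupsTwoPow G 0)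
    (h1 : 3 ≤ numCyclicSubgroupsTwoPow G 1)
    (h2 : ∀ k, 2 ≤ k → k ≤ E + 1 → 2 ≤ numCyclicSubgroupsTwoPow G k) :
    Nat.card G + 2 * E * 2 ^ E ≤ numCyclicSubgroups G * 2 ^ E := by
  set b : ℕ → ℕ := fun k => if k = 0 then 1 else if k = 1 then 3 else 2 with hb
  have hbc : ∀ k ≤ E + 1, b k ≤ numCyclicSubgroupsTwoPow G k := by
    intro k hk
    rcases k with _ | _ | k
    · simpa [hb] using h0
    · simpa [hb] using h1
    · simpa [hb] using h2 (k + 2) (by omega) hk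
  have hsum : ∀ F : ℕ, ∑ k ∈ Finset.range (F + 2), b k = 2 * F + 4 := by
    intro F
    induction F with
    | zero => simp [hb, Finset.sum_range_succ]
    | succ F ih => rw [Finset.sum_range_succ, ih]; simp [hb]; omega
  have hsum' : ∀ F : ℕ, ∑ k ∈ Finset.range (F + 2), b k * (2 ^ k).totient = 4 * 2 ^ F := by
    intro F
    induction F with
    | zero => simp [hb, Finset.sum_range_succ]
    | succ F ih =>
      rw [Finset.sum_range_succ, ih, Nat.totient_prime_pow_succ Nat.prime_two]
      simp [hb]
      ring
  have key : ∑ k ∈ Finset.range (E + 2), (numCyclicSubgroupsTwoPow G k * (2 ^ k).totient +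
      b k * 2 ^ E) ≤ ∑ k ∈ Finset.range (E + 2), (numCyclicSubgroupsTwoPow G k * 2 ^ E +
      b k * (2 ^ k).totient) := by
    refine Finset.sum_le_sum fun k hk => ?_
    have hk : k ≤ E + 1 := by have := Finset.mem_range.mp hk; omega
    obtain ⟨d, hd⟩ := Nat.exists_eq_add_of_le (hbc k hk)
    obtain ⟨f, hf⟩ := Nat.exists_eq_add_of_le (totient_two_pow_le hk)
    rw [hd, hf]
    nlinarith [Nat.zero_le (d * f)]
  rw [Finset.sum_add_distrib, Finset.sum_add_distrib, ← Finset.sum_mul, ← Finset.sum_mul, hsum,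
    hsum', ← numCyclicSubgroups_eq_sum_s5 he, ← card_eq_sum_numCyclicSubgroupsTwoPow he] at key
  linarith

theorem IsPGroup.exists_orderOf_dvd [Finite G] [Nontrivial G] (hp : IsPGroup 2 G) :
    ∃ (t : G) (E : ℕ), orderOf t = 2 ^ (E + 1) ∧ ∀ g : G, orderOf g ∣ 2 ^ (E + 1) := by
  have : Fact (Nat.Prime 2) := ⟨Nat.prime_two⟩
  obtain ⟨t, ht⟩ := Finite.exists_max (orderOf : G → ℕ)
  obtain ⟨e, he⟩ := IsPGroup.iff_orderOf.mp hp t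
  obtain ⟨x, hx⟩ := exists_ne (1 : G)
  have he0 : e ≠ 0 := by
    rintro rfl
    have := ht x
    rw [he, pow_zero] at this
    exact hx (orderOf_eq_one_iff.mp (le_antisymm this (orderOf_pos x)))
  obtain ⟨E, rfl⟩ := Nat.exists_eq_succ_of_ne_zero he0
  refine ⟨t, E, he, fun g => ?_⟩
  obtain ⟨k, hk⟩ := IsPGroup.iff_orderOf.mp hp g
  have := ht g
  rw [hk, he, Nat.pow_le_pow_iff_right one_lt_two] at this
  rw [hk]
  exact pow_dvd_pow 2 this

theorem orderOf_pow_two_pow [Finite G] {t : G} {e k : ℕ} (ht : orderOf t = 2 ^ e) (hk : k ≤ e) :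
    orderOf (t ^ 2 ^ (e - k)) = 2 ^ k := by
  rw [orderOf_pow_of_dvd (by positivity) (by rw [ht]; exact pow_dvd_pow 2 (by omega)), ht,
    Nat.pow_div (by omega) two_pos]
  congr 1
  omega

theorem four_mul_lt_two_pow {n : ℕ} (hn : 5 ≤ n) : 4 * n < 2 ^ n := by
  induction n, hn using Nat.le_induction with
  | base => norm_num
  | succ n hn ih => rw [pow_succ]; omega

theorem index_zpowers_eq_two [Finite G] {n : ℕ} (hn : 1 ≤ n) (hG : Nat.card G = 2 ^ n) {x : G}
    (hx : orderOf x = 2 ^ (n - 1)) : (Subgroup.zpowers x).index = 2 := by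
  have h := (Subgroup.zpowers x).card_mul_index
  obtain ⟨m, rfl⟩ := Nat.exists_eq_add_of_le' hn
  rw [Nat.card_zpowers, hx, hG, pow_succ, Nat.add_sub_cancel] at h
  exact Nat.eq_of_mul_eq_mul_left (by positivity) h

theorem IsNormalKleinPair.two_mul_lt_or [Finite G] {z u : G} (h : IsNormalKleinPair z u) {n : ℕ}
    (hn : 5 ≤ n) (hG : Nat.card G = 2 ^ n) (hnc : ¬ IsCyclic G) :
    2 * n < numCyclicSubgroups G ∨
      2 * n ≤ numCyclicSubgroups G ∧ ∃ x : G, orderOf x = 2 ^ (n - 1) := by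
  have hp : IsPGroup 2 G := IsPGroup.of_card hG
  have : Nontrivial G := ⟨z, 1, h.z_ne_one⟩
  obtain ⟨t, E, ht, he⟩ := hp.exists_orderOf_dvd
  have hEn : E + 1 < n := by
    have hdvd := orderOf_dvd_natCard t
    rw [ht, hG, Nat.pow_dvd_pow_iff_le_right one_lt_two] at hdvd
    refine lt_of_le_of_ne hdvd fun h' => hnc (isCyclic_of_orderOf_eq_card t ?_)
    rw [ht, hG, h']
  have hn4 := four_mul_lt_two_pow hn
  rcases Nat.lt_or_ge E 2 with hE | hE
  · left
    have h1 := card_le_numCyclicSubgroups_mul he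
    have h2 : 2 ^ E ≤ 2 ^ 1 := Nat.pow_le_pow_right two_pos (by omega)
    have h3 := Nat.mul_le_mul_left (numCyclicSubgroups G) h2
    omega
  · have h2 : ∀ k, 2 ≤ k → k ≤ E + 1 → 2 ≤ numCyclicSubgroupsTwoPow G k := by
      intro k hk2 hkE
      refine h.two_le_numCyclicSubgroupsTwoPow (orderOf_pow_two_pow ht hkE) hk2 ?_
      rcases Nat.lt_or_ge k 3 with hk | hk
      · right
        have : E + 1 - k = (E - k) + 1 := by omega
        rw [this, pow_succ, pow_mul]
        exact h.commute_sq _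
      · exact Or.inl hk
    have key := two_pow_add_le_numCyclicSubgroups he
      (one_le_numCyclicSubgroupsTwoPow (x := 1) (by simp)) h.three_le_numCyclicSubgroupsTwoPow_one h2
    obtain ⟨f, rfl⟩ := Nat.exists_eq_add_of_le (show E + 2 ≤ n by omega)
    have key' : 4 * 2 ^ f + 2 * E ≤ numCyclicSubgroups G := by
      refine Nat.le_of_mul_le_mul_right (c := 2 ^ E) ?_ (by positivity)
      rw [hG] at key
      refine le_trans (le_of_eq ?_) key
      ring
    have hf : f < 2 ^ f := Nat.lt_two_pow_self
    rcases Nat.eq_zero_or_pos f with rfl | hf0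
    · exact Or.inr ⟨by omega, t, ht⟩
    · left
      omega

theorem two_mul_lt_of_index_two [Finite G] {n : ℕ} (hn : 5 ≤ n) (hG : Nat.card G = 2 ^ n) {a : G}
    (ha : (Subgroup.zpowers a).index = 2) (h4 : ∀ g ∉ Subgroup.zpowers a, g ^ 4 = 1) :
    2 * n < numCyclicSubgroups G := by
  classical
  let := Fintype.ofFinite G
  obtain ⟨m, rfl⟩ := Nat.exists_eq_add_of_le' (show 3 ≤ n by omega)
  have hoa : orderOf a = 2 ^ (m + 2) := by
    have h := (Subgroup.zpowers a).card_mul_index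
    rw [Nat.card_zpowers, ha, hG] at h
    rw [show m + 3 = m + 2 + 1 from rfl, pow_succ] at h
    exact Nat.eq_of_mul_eq_mul_right two_pos h
  have he : ∀ g : G, orderOf g ∣ 2 ^ (m + 2) := by
    intro g
    by_cases hg : g ∈ Subgroup.zpowers a
    · rw [← hoa]
      exact orderOf_dvd_of_mem_zpowers hg
    · refine (orderOf_dvd_of_pow_eq_one (h4 g hg)).trans ?_
      exact pow_dvd_pow 2 (show 2 ≤ m + 2 by omega)
  have hc : ∀ k ≤ m + 2, 1 ≤ numCyclicSubgroupsTwoPow G k := fun k hk =>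
    one_le_numCyclicSubgroupsTwoPow (orderOf_pow_two_pow hoa hk)
  have hout : 2 ^ (m + 2) ≤ numCyclicSubgroupsTwoPow G 1 + numCyclicSubgroupsTwoPow G 2 * 2 := by
    have h1 := card_orderOf_eq_two_pow (G := G) 1
    have h2 := card_orderOf_eq_two_pow (G := G) 2
    rw [show ((2 : ℕ) ^ 1).totient = 1 from rfl, mul_one] at h1
    rw [show ((2 : ℕ) ^ 2).totient = 2 from rfl] at h2
    rw [← h1, ← h2]
    refine le_trans ?_ (Finset.card_union_le _ _)
    have hin : (Finset.univ.filter (· ∈ Subgroup.zpowers a)).card = 2 ^ (m + 2) := by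
      rw [← hoa, ← Nat.card_zpowers, Nat.card_eq_fintype_card, Fintype.card_subtype]
    have hadd := Finset.card_filter_add_card_filter_not (s := (Finset.univ : Finset G))
      (· ∈ Subgroup.zpowers a)
    rw [hin, Finset.card_univ, ← Nat.card_eq_fintype_card, hG,
      show m + 3 = m + 2 + 1 from rfl, pow_succ] at hadd
    have hno := (Nat.add_left_cancel (hadd.trans (mul_two _))).ge
    refine hno.trans (Finset.card_le_card fun g hg => ?_)
    have hg : g ∉ Subgroup.zpowers a := by simpa using hg
    have hd : orderOf g ∣ 2 ^ 2 := orderOf_dvd_of_pow_eq_one (h4 g hg)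
    obtain ⟨j, hj2, hj⟩ := (Nat.dvd_prime_pow Nat.prime_two).mp hd
    have hj0 : j ≠ 0 := by
      rintro rfl
      exact hg (orderOf_eq_one_iff.mp hj ▸ one_mem _)
    simp only [Finset.mem_union, Finset.mem_filter, Finset.mem_univ, true_and, hj]
    interval_cases j <;> simp_all
  rw [numCyclicSubgroups_eq_sum_s5 he, Finset.sum_range_succ', Finset.sum_range_succ',
    Finset.sum_range_succ']
  have hsum : m ≤ ∑ k ∈ Finset.range m, numCyclicSubgroupsTwoPow G (k + 1 + 1 + 1) := by
    calc m = ∑ k ∈ Finset.range m, 1 := by simp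
      _ ≤ _ := Finset.sum_le_sum fun k hk =>
        hc _ (by have := Finset.mem_range.mp hk; omega)
  have h0 := hc 0 (by omega)
  have h5 : 2 * m + 10 < 2 ^ (m + 2) := by
    obtain ⟨j, rfl⟩ := Nat.exists_eq_add_of_le' (show 2 ≤ m by omega)
    have := Nat.lt_two_pow_self (n := j)
    rw [show j + 2 + 2 = j + 4 from rfl, pow_add]
    omega
  simp only [zero_add, Nat.reduceAdd] at *
  omega

/-- `⟨x⟩` has index two in `G` and `y` is an involution outside `⟨x⟩` acting on it by an exponent
congruent to `1` modulo `4`: there are two classes of cyclic subgroups of each order. -/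
theorem numCyclicSubgroups_le_of_conj [Finite G] (hp : IsPGroup 2 G) {n : ℕ} (hn : 1 ≤ n) {x y : G}
    (hx : orderOf x = 2 ^ (n - 1)) (hi : (Subgroup.zpowers x).index = 2)
    (hyx : y ∉ Subgroup.zpowers x) (hy : y ^ 2 = 1) {k : ℤ} (hxy : y⁻¹ * x * y = x ^ (1 + 4 * k)) :
    numCyclicSubgroups G ≤ 2 * n := by
  classical
  let := Fintype.ofFinite (Subgroup G)
  have hyinv : y⁻¹ = y := inv_eq_of_mul_eq_one_left (by rw [← pow_two, hy])
  have hpowers : ∀ w ∈ Subgroup.zpowers x, ∃ j < n, ∃ m : ℤ, Odd m ∧ w = (x ^ 2 ^ j) ^ m := by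
    intro w hw
    by_cases hw1 : w = 1
    · refine ⟨n - 1, by omega, 1, odd_one, ?_⟩
      rw [← hx, pow_orderOf_eq_one, one_zpow, hw1]
    · obtain ⟨i, rfl⟩ := mem_powers_iff_mem_zpowers.mpr hw
      simp only at hw1
      have hi0 : i ≠ 0 := by rintro rfl; simp at hw1
      obtain ⟨j, m, hm, rfl⟩ := Nat.exists_eq_two_pow_mul_odd hi0
      refine ⟨j, ?_, m, by exact_mod_cast hm, by rw [zpow_natCast, ← pow_mul]⟩
      by_contra! hj
      apply hw1
      rw [pow_mul]
      obtain ⟨d, rfl⟩ := Nat.exists_eq_add_of_le (show n - 1 ≤ j by omega)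
      rw [pow_add, pow_mul, ← hx, pow_orderOf_eq_one, one_pow, one_pow]
  have hmem : ∀ a ∈ Subgroup.zpowers x, ∀ m : ℤ, Odd m → a ^ m * y ∈ Subgroup.zpowers (a * y) := by
    rintro a ⟨i, rfl⟩ m ⟨j, rfl⟩
    simp only
    have hsq : (x ^ i * y) ^ 2 = ((x ^ i) ^ 2) ^ (1 + 2 * k) := by
      calc (x ^ i * y) ^ 2 = x ^ i * (y⁻¹ * x * y⁻¹⁻¹) ^ i := by
            rw [conj_zpow, inv_inv, hyinv, pow_two]; group
        _ = _ := by
          rw [inv_inv, hxy, ← zpow_mul, ← zpow_add, ← zpow_natCast, ← zpow_mul, ← zpow_mul]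
          congr 1; push_cast; ring
    obtain ⟨l, -, hl⟩ := hp.exists_zpow_mul_eq_of_odd ((x ^ i) ^ 2) (m := 1 + 2 * k) ⟨k, by ring⟩
    have h1 : (x ^ i) ^ 2 ∈ Subgroup.zpowers (x ^ i * y) := by
      rw [← hl, zpow_mul, ← hsq]
      exact zpow_mem (pow_mem (Subgroup.mem_zpowers _) 2) l
    have h2 : (x ^ i) ^ (2 * j + 1) * y = ((x ^ i) ^ 2) ^ j * (x ^ i * y) := by
      rw [zpow_add, zpow_mul, zpow_one, mul_assoc]; norm_cast
    rw [h2]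
    exact mul_mem (zpow_mem h1 j) (Subgroup.mem_zpowers _)
  have heq : ∀ a ∈ Subgroup.zpowers x, ∀ m : ℤ, Odd m →
      Subgroup.zpowers (a ^ m * y) = Subgroup.zpowers (a * y) := by
    intro a ha m hm
    apply le_antisymm
    · rw [Subgroup.zpowers_le]
      exact hmem a ha m hm
    · obtain ⟨l, hl, hla⟩ := hp.exists_zpow_mul_eq_of_odd a hm
      have := hmem (a ^ m) (zpow_mem ha m) l hl
      rwa [← zpow_mul, hla, ← Subgroup.zpowers_le] at this
  have heq1 : ∀ a : G, ∀ m : ℤ, Odd m → Subgroup.zpowers (a ^ m) = Subgroup.zpowers a := by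
    intro a m hm
    apply le_antisymm
    · rw [Subgroup.zpowers_le]
      exact Subgroup.zpow_mem_zpowers a m
    · obtain ⟨l, hl, hla⟩ := hp.exists_zpow_mul_eq_of_odd a hm
      rw [Subgroup.zpowers_le]
      have h := Subgroup.zpow_mem_zpowers (a ^ m) l
      rwa [← zpow_mul, hla] at h
  rw [numCyclicSubgroups, Nat.card_eq_fintype_card, Fintype.card_subtype]
  calc (Finset.univ.filter fun H : Subgroup G => IsCyclic H).card
      ≤ ((Finset.range n).image (fun j => Subgroup.zpowers (x ^ 2 ^ j)) ∪
        (Finset.range n).image (fun j => Subgroup.zpowers (x ^ 2 ^ j * y))).card := by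
        refine Finset.card_le_card fun H hH => ?_
        have hH : IsCyclic H := by simpa using hH
        obtain ⟨g, rfl⟩ := Subgroup.isCyclic_iff_exists_zpowers_eq_top H |>.mp hH
        simp only [Finset.mem_union, Finset.mem_image, Finset.mem_range]
        by_cases hg : g ∈ Subgroup.zpowers x
        · obtain ⟨j, hj, m, hm, rfl⟩ := hpowers g hg
          exact Or.inl ⟨j, hj, (heq1 _ m hm).symm⟩
        · have hgy : g * y ∈ Subgroup.zpowers x := by
            rw [Subgroup.mul_mem_iff_of_index_two hi]
            exact iff_of_false hg hyx
          obtain ⟨j, hj, m, hm, hgm⟩ := hpowers _ hgy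
          refine Or.inr ⟨j, hj, ?_⟩
          rw [← heq _ (pow_mem (Subgroup.mem_zpowers x) _) m hm, ← hgm, mul_assoc, ← pow_two, hy,
            mul_one]
    _ ≤ n + n := (Finset.card_union_le _ _).trans (add_le_add
        (Finset.card_image_le.trans (Finset.card_range n).le)
        (Finset.card_image_le.trans (Finset.card_range n).le))
    _ = 2 * n := by ring

theorem nonempty_mulEquiv_of_commute_s5 [Finite G] {m : ℕ} {x y : G} (hx : orderOf x = m)
    (hi : (Subgroup.zpowers x).index = 2) (hyx : y ∉ Subgroup.zpowers x) (hy : y ^ 2 = 1)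
    (hxy : Commute x y) : Nonempty (G ≃* Multiplicative (ZMod 2 × ZMod m)) := by
  have hy1 : y ≠ 1 := fun h => hyx (h ▸ one_mem _)
  have hyo : orderOf y = 2 := orderOf_eq_prime hy hy1
  have hcomm : ∀ (a : Subgroup.zpowers y) (b : Subgroup.zpowers x),
      Commute ((Subgroup.zpowers y).subtype a) ((Subgroup.zpowers x).subtype b) := by
    rintro ⟨_, i, rfl⟩ ⟨_, j, rfl⟩
    exact hxy.symm.zpow_zpow i j
  let f := MonoidHom.noncommCoprod _ _ hcomm
  have hinj : Function.Injective f := by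
    rw [MonoidHom.noncommCoprod_injective]
    refine ⟨Subtype.val_injective, Subtype.val_injective, ?_⟩
    rw [Subgroup.range_subtype, Subgroup.range_subtype, Subgroup.disjoint_def]
    intro w hwy hwx
    rcases eq_or_eq_of_mem_zpowers_of_sq_eq_one hwy (Subgroup.mem_zpowers y) hy1 hy
      (orderOf_dvd_iff_pow_eq_one.mp (hyo ▸ orderOf_dvd_of_mem_zpowers hwy)) with h | h
    · exact h
    · exact absurd (h ▸ hwx) hyx
  have hcard : Nat.card (Subgroup.zpowers y × Subgroup.zpowers x) = Nat.card G := by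
    rw [Nat.card_prod, ← (Subgroup.zpowers x).card_mul_index, hi, Nat.card_zpowers y, hyo, mul_comm]
  have hbij : Function.Bijective f := (Nat.bijective_iff_injective_and_card f).mpr ⟨hinj, hcard⟩
  have e1 : Subgroup.zpowers y ≃* Multiplicative (ZMod 2) :=
    mulEquivOfCyclicCardEq (by simp [hyo])
  have e2 : Subgroup.zpowers x ≃* Multiplicative (ZMod m) :=
    mulEquivOfCyclicCardEq (by
      rw [Nat.card_zpowers, hx]
      exact ((Nat.card_congr Multiplicative.toAdd).trans (Nat.card_zmod m)).symm)
  exact ⟨(MulEquiv.ofBijective f hbij).symm.trans ((e1.prodCongr e2).trans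
    (MulEquiv.prodMultiplicative _ _).symm)⟩

theorem isModularPGroup_of_conj [Finite G] {n : ℕ} (hG : Nat.card G = 2 ^ n) {x y : G}
    (hx : orderOf x = 2 ^ (n - 1)) (hi : (Subgroup.zpowers x).index = 2)
    (hyx : y ∉ Subgroup.zpowers x) (hy : y ^ 2 = 1) (hxy : y⁻¹ * x * y = x ^ (1 + 2 ^ (n - 2))) :
    IsModularPGroup G 2 n := by
  refine ⟨hG, x, y, by rw [← hx, pow_orderOf_eq_one], hy, hxy, ?_⟩
  rw [eq_top_iff]
  intro g _
  have hxc : Subgroup.zpowers x ≤ Subgroup.closure {x, y} := by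
    rw [Subgroup.zpowers_le]
    exact Subgroup.subset_closure (by simp)
  have hyc : y ∈ Subgroup.closure {x, y} := Subgroup.subset_closure (by simp)
  by_cases hg : g ∈ Subgroup.zpowers x
  · exact hxc hg
  · refine (Subgroup.mul_mem_cancel_right _ hyc).mp (hxc ?_)
    rw [Subgroup.mul_mem_iff_of_index_two hi]
    exact iff_of_false hg hyx

open scoped Pointwise in
theorem IsModularPGroup.exists_generators [Finite G] {n : ℕ} (hn : 3 ≤ n) (hnc : ¬ IsCyclic G)
    (h : IsModularPGroup G 2 n) : ∃ x y : G, orderOf x = 2 ^ (n - 1) ∧ y ∉ Subgroup.zpowers x ∧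
      y ^ 2 = 1 ∧ y⁻¹ * x * y = x ^ (1 + 2 ^ (n - 2)) := by
  obtain ⟨hG, x, y, hx, hy, hxy, hcl⟩ := h
  have hyinv : y⁻¹ = y := inv_eq_of_mul_eq_one_left (by rw [← pow_two, hy])
  have hconj : ∀ w ∈ Subgroup.zpowers x, y * w * y⁻¹ ∈ Subgroup.zpowers x := by
    rintro _ ⟨i, rfl⟩
    simp only
    rw [← conj_zpow, ← hyinv, inv_inv, hxy]
    exact zpow_mem (pow_mem (Subgroup.mem_zpowers x) _) i
  have hnorm : (Subgroup.zpowers x).Normal := by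
    rw [← Subgroup.normalizer_eq_top_iff, eq_top_iff, ← hcl, Subgroup.closure_le]
    rintro w (rfl | rfl)
    · exact Subgroup.le_normalizer (Subgroup.mem_zpowers w)
    · rw [SetLike.mem_coe, Subgroup.mem_normalizer_iff]
      refine fun v => ⟨hconj v, fun hv => ?_⟩
      have := hconj _ hv
      rwa [← mul_assoc, ← mul_assoc, mul_assoc _ w⁻¹, hyinv, ← pow_two, hy, one_mul, mul_one] at this
  have hyx : y ∉ Subgroup.zpowers x := by
    intro hyx
    have htop : Subgroup.zpowers x = ⊤ := by
      rw [eq_top_iff, ← hcl, Subgroup.closure_le]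
      rintro w (rfl | rfl)
      · exact Subgroup.mem_zpowers w
      · exact hyx
    exact hnc ⟨x, fun g => htop.ge (Subgroup.mem_top g)⟩
  refine ⟨x, y, ?_, hyx, hy, hxy⟩
  have hsup : Subgroup.zpowers x ⊔ Subgroup.zpowers y = ⊤ := by
    rw [eq_top_iff, ← hcl, Subgroup.closure_le]
    rintro w (rfl | rfl)
    · exact Subgroup.mem_sup_left (Subgroup.mem_zpowers w)
    · exact Subgroup.mem_sup_right (Subgroup.mem_zpowers w)
  have hle : 2 ^ n ≤ orderOf x * 2 := by
    calc 2 ^ n = Nat.card ((Subgroup.zpowers x : Set G) * (Subgroup.zpowers y : Set G) : Set G) := by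
          rw [← Subgroup.normal_mul, hsup, Subgroup.coe_top, Nat.card_univ, hG]
      _ ≤ Nat.card (Subgroup.zpowers x) * Nat.card (Subgroup.zpowers y) := Set.natCard_mul_le
      _ ≤ orderOf x * 2 := by
        rw [Nat.card_zpowers, Nat.card_zpowers]
        exact Nat.mul_le_mul_left _ (orderOf_le_of_pow_eq_one two_pos hy)
  refine le_antisymm (orderOf_le_of_pow_eq_one (by positivity) hx) ?_
  obtain ⟨m, rfl⟩ := Nat.exists_eq_add_of_le' (show 1 ≤ n by omega)
  rw [pow_succ] at hle
  exact Nat.le_of_mul_le_mul_right hle two_pos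

end TwoGroup

theorem secondMin_two {n : ℕ} (hn : 5 ≤ n) (G : Type*) [Group G]
    (hG : Nat.card G = 2 ^ n) (hnc : ¬ IsCyclic G) :
    2 * n ≤ numCyclicSubgroups G ∧
      (numCyclicSubgroups G = 2 * n ↔
        Nonempty (G ≃* Multiplicative (ZMod 2 × ZMod (2 ^ (n - 1)))) ∨
          IsModularPGroup G 2 n) := by
  have : Finite G := Nat.finite_of_card_ne_zero (by rw [hG]; positivity)
  have hp : IsPGroup 2 G := IsPGroup.of_card hG
  have key : 2 * n < numCyclicSubgroups G ∨ 2 * n ≤ numCyclicSubgroups G ∧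
      (Nonempty (G ≃* Multiplicative (ZMod 2 × ZMod (2 ^ (n - 1)))) ∨ IsModularPGroup G 2 n) := by
    by_cases hK : ∃ z u : G, IsNormalKleinPair z u
    · obtain ⟨z, u, h⟩ := hK
      refine (h.two_mul_lt_or hn hG hnc).imp_right (And.imp_right ?_)
      rintro ⟨x, hx⟩
      have hi := index_zpowers_eq_two (by omega) hG hx
      obtain ⟨y, -, hyx, hy, hc | ⟨hz, hc⟩⟩ := h.exists_notMem_zpowers x
      · exact Or.inl (nonempty_mulEquiv_of_commute_s5 hx hi hyx hy hc)
      · right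
        refine isModularPGroup_of_conj hG hx hi hyx hy ?_
        have hpow : orderOf (x ^ 2 ^ (n - 2)) = 2 := by
          have := orderOf_pow_two_pow hx (show 1 ≤ n - 1 by omega)
          rwa [pow_one, show n - 1 - 1 = n - 2 by omega] at this
        rcases eq_or_eq_of_mem_zpowers_of_sq_eq_one (pow_mem (Subgroup.mem_zpowers x) _) hz
          h.z_ne_one h.z_sq (hpow ▸ pow_orderOf_eq_one (x ^ 2 ^ (n - 2))) with h1 | h1
        · simp [h1] at hpow
        · rw [hc, pow_add, pow_one, h1]
    · obtain ⟨a, ha, h4⟩ := exists_index_two_of_not_exists_isNormalKleinPair hp hnc hK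
      exact Or.inl (two_mul_lt_of_index_two hn hG ha h4)
  have hle : 2 * n ≤ numCyclicSubgroups G := key.elim le_of_lt And.left
  refine ⟨hle, fun h => ?_, fun h => le_antisymm ?_ hle⟩
  · rcases key with h' | h'
    · omega
    · exact h'.2
  · rcases h with ⟨⟨e⟩⟩ | h
    · have hx : orderOf (e.symm (Multiplicative.ofAdd (0, 1))) = 2 ^ (n - 1) := by
        rw [MulEquiv.orderOf_eq, orderOf_ofAdd_eq_addOrderOf, Prod.addOrderOf]
        simp
      refine numCyclicSubgroups_le_of_conj hp (by omega) hx (index_zpowers_eq_two (by omega) hG hx)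
        (y := e.symm (Multiplicative.ofAdd (1, 0))) ?_ ?_ (k := 0) ?_
      · rintro ⟨i, hi⟩
        have hi : (Multiplicative.ofAdd ((0, 1) : ZMod 2 × ZMod (2 ^ (n - 1)))) ^ i =
            Multiplicative.ofAdd (1, 0) := e.symm.injective (by simpa using hi)
        rw [← ofAdd_zsmul, Multiplicative.ofAdd.injective.eq_iff, Prod.ext_iff] at hi
        simp at hi
      · rw [← map_pow, ← ofAdd_nsmul]
        have h2 : 2 • ((1, 0) : ZMod 2 × ZMod (2 ^ (n - 1))) = 0 :=
          Prod.ext (by simp; rfl) (by simp)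
        rw [h2, ofAdd_zero, map_one]
      · rw [← map_inv, ← map_mul, ← map_mul, mul_comm (Multiplicative.ofAdd _)⁻¹, inv_mul_cancel_right]
        simp
    · obtain ⟨x, y, hx, hyx, hy, hxy⟩ := h.exists_generators (by omega) hnc
      refine numCyclicSubgroups_le_of_conj hp (by omega) hx (index_zpowers_eq_two (by omega) hG hx)
        hyx hy (k := 2 ^ (n - 4)) ?_
      rw [hxy, ← zpow_natCast]
      congr 1
      obtain ⟨m, rfl⟩ := Nat.exists_eq_add_of_le' (show 4 ≤ n by omega)
      simp only [Nat.add_sub_cancel, show m + 4 - 2 = m + 2 from rfl]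
      push_cast
      ring
end

section
/- Let p be an odd prime, n ≥ 3 an integer, and G a group of order p^n with exp(G) ≠ p. If Ω_1(G) ≠ G, then the number of cyclic subgroups of G satisfies |C(G)| ≤ 2p^{n-2} + p^{n-3} + p^{n-4} + ... + p + 2. -/
open Finset in
/-- A finite cyclic subgroup `H` has exactly `φ |H|` generators. -/
theorem card_filter_zpowers_eq {G : Type*} [Group G] [Fintype G] [DecidableEq (Subgroup G)]
    (H : Subgroup G) [IsCyclic H] :
    #{x : G | Subgroup.zpowers x = H} = (Nat.card H).totient := by
  classical
  rw [← IsCyclic.card_orderOf_eq_totient (α := H) (d := Nat.card H)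
    (by rw [Nat.card_eq_fintype_card]), ← Finset.card_map (Function.Embedding.subtype _)]
  congr 1
  ext x
  simp only [mem_filter, mem_univ, true_and, mem_map, Function.Embedding.subtype_apply,
    Subtype.exists]
  constructor
  · rintro rfl
    exact ⟨x, Subgroup.mem_zpowers x, by rw [Subgroup.orderOf_mk, Nat.card_zpowers], rfl⟩
  · rintro ⟨y, hy, hord, rfl⟩
    rw [Subgroup.orderOf_mk, ← Nat.card_zpowers] at hord
    exact Subgroup.eq_of_le_of_card_ge (Subgroup.zpowers_le.mpr hy) hord.ge

open Finset in
/-- If every cyclic subgroup has generators of total weight at least `c`, then `c` times the number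
of cyclic subgroups is at most the total weight of the group. -/
theorem mul_numCyclicSubgroups_le_sum {G : Type*} [Group G] [Fintype G]
    [DecidableEq (Subgroup G)] (w : G → ℕ) (c : ℕ)
    (h : ∀ H : Subgroup G, IsCyclic H → c ≤ ∑ x : G with Subgroup.zpowers x = H, w x) :
    c * numCyclicSubgroups G ≤ ∑ x, w x := by
  classical
  have hmaps : ∀ x ∈ (univ : Finset G),
      Subgroup.zpowers x ∈ (univ : Finset (Subgroup G)).filter (fun H : Subgroup G => IsCyclic H) :=
    fun x _ => by simpa using (inferInstance : IsCyclic (Subgroup.zpowers x))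
  rw [← sum_fiberwise_of_maps_to hmaps, numCyclicSubgroups, Nat.card_eq_fintype_card,
    Fintype.card_subtype, mul_comm, ← smul_eq_mul]
  exact card_nsmul_le_sum _ _ _ fun H hH => h H (mem_filter.mp hH).2

/-- In a group of order `p ^ n`, a proper subgroup has order at most `p ^ (n - 1)`. -/
theorem card_le_pow_pred_of_ne_top {G : Type*} [Group G] {p n : ℕ} (hp : p.Prime)
    (hG : Nat.card G = p ^ n) {K : Subgroup G} (hK : K ≠ ⊤) : Nat.card K ≤ p ^ (n - 1) := by
  have : Finite G := Nat.finite_of_card_ne_zero (by rw [hG]; exact pow_ne_zero _ hp.ne_zero)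
  obtain ⟨k, hk, hcard⟩ := (Nat.dvd_prime_pow hp).mp (hG ▸ K.card_subgroup_dvd_card)
  rw [hcard]
  refine Nat.pow_le_pow_right hp.pos ?_
  have : k ≠ n := by
    rintro rfl
    exact hK (Subgroup.eq_top_of_card_eq K (hcard.trans hG.symm))
  omega

open Finset in
/-- Counting the cyclic subgroups of a `p`-group by their generators: nontrivial elements of
exponent `p` count `p` times, elements of higher order once. -/
theorem numCyclicSubgroups_mul_le {G : Type*} [Group G] {p n : ℕ} (hp : p.Prime)
    (hG : Nat.card G = p ^ n) :
    p * (p - 1) * numCyclicSubgroups G + p ≤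
      p * (p - 1) + p ^ n + (p - 1) * Nat.card {x : G // x ^ p = 1} := by
  classical
  have hfin : Finite G := Nat.finite_of_card_ne_zero (by rw [hG]; exact pow_ne_zero _ hp.ne_zero)
  have : Fintype G := Fintype.ofFinite G
  let w : G → ℕ := fun x => if x = 1 then p * (p - 1) else if x ^ p = 1 then p else 1
  have hw : ∑ x, w x + p =
      p * (p - 1) + p ^ n + (p - 1) * Nat.card {x : G // x ^ p = 1} := by
    have hpoint : ∀ x : G, w x + (if x = 1 then p else 0) =
        (if x = 1 then p * (p - 1) else 0) + 1 + (p - 1) * (if x ^ p = 1 then 1 else 0) := by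
      intro x
      have := hp.pos
      by_cases h1 : x = 1
      · simp [w, h1]; omega
      · by_cases h2 : x ^ p = 1 <;> simp [w, h1, h2]; omega
    have hsum := Finset.sum_congr (rfl : (univ : Finset G) = univ) fun x _ => hpoint x
    simp only [sum_add_distrib, ← mul_sum, sum_ite_eq', mem_univ, if_true, sum_boole,
      Finset.sum_const, smul_eq_mul, mul_one, Nat.cast_id] at hsum
    rw [hsum, card_univ, ← Nat.card_eq_fintype_card, hG, Nat.card_eq_fintype_card,
      Fintype.card_subtype]
  refine le_trans (Nat.add_le_add_right
    (mul_numCyclicSubgroups_le_sum w (p * (p - 1)) fun H hH => ?_) p) hw.le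
  obtain ⟨k, -, hcard⟩ := (Nat.dvd_prime_pow hp).mp (hG ▸ H.card_subgroup_dvd_card)
  have hgen := card_filter_zpowers_eq H
  rw [hcard] at hgen
  have hord : ∀ x ∈ ({x : G | Subgroup.zpowers x = H} : Finset G), orderOf x = p ^ k := by
    intro x hx
    rw [← Nat.card_zpowers, (mem_filter.mp hx).2, hcard]
  match k with
  | 0 =>
    have hbot : H = ⊥ := Subgroup.card_eq_one.mp (by simpa using hcard)
    have hmem : (1 : G) ∈ ({x : G | Subgroup.zpowers x = H} : Finset G) := by simp [hbot]
    calc p * (p - 1) = w 1 := by simp [w]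
      _ ≤ _ := single_le_sum (fun _ _ => Nat.zero_le _) hmem
  | 1 =>
    rw [pow_one, Nat.totient_prime hp] at hgen
    have hle : ∀ x ∈ ({x : G | Subgroup.zpowers x = H} : Finset G), p ≤ w x := by
      intro x hx
      have hx' : orderOf x = p := by simpa using hord x hx
      have h1 : x ≠ 1 := by
        rintro rfl
        exact hp.ne_one (by simpa using hx'.symm)
      have h2 : x ^ p = 1 := hx' ▸ pow_orderOf_eq_one x
      simp [w, h1, h2]
    simpa [hgen, mul_comm] using card_nsmul_le_sum _ w p hle
  | k + 2 =>
    rw [Nat.totient_prime_pow_succ hp] at hgen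
    have hle : ∀ x ∈ ({x : G | Subgroup.zpowers x = H} : Finset G), 1 ≤ w x := by
      intro x _
      have := hp.pos
      have : 0 < p * (p - 1) := Nat.mul_pos hp.pos (Nat.sub_pos_of_lt hp.one_lt)
      simp only [w]
      split_ifs <;> omega
    calc p * (p - 1) ≤ p ^ (k + 1) * (p - 1) :=
          Nat.mul_le_mul_right _ (Nat.le_self_pow (Nat.succ_ne_zero k) p)
      _ ≤ _ := by simpa [hgen] using card_nsmul_le_sum _ w 1 hle

theorem secondMax_ineq {p n : ℕ} (hp : p.Prime) (hodd : Odd p) (hn : 3 ≤ n)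
    (G : Type*) [Group G] (hG : Nat.card G = p ^ n) (hexp : Monoid.exponent G ≠ p)
    (hOmega : Subgroup.closure {x : G | x ^ p = 1} ≠ ⊤) :
    numCyclicSubgroups G ≤ 2 * p ^ (n - 2) + (∑ i ∈ Finset.Icc 1 (n - 3), p ^ i) + 2 := by
  have hfin : Finite G := Nat.finite_of_card_ne_zero (by rw [hG]; exact pow_ne_zero _ hp.ne_zero)
  have hS : Nat.card {x : G // x ^ p = 1} ≤ p ^ (n - 1) :=
    (Nat.card_mono (Set.toFinite _) Subgroup.subset_closure).trans
      (card_le_pow_pred_of_ne_top hp hG hOmega)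
  have hmain := numCyclicSubgroups_mul_le hp hG
  obtain ⟨m, rfl⟩ := Nat.exists_eq_add_of_le' hn
  obtain ⟨q, rfl⟩ := Nat.exists_eq_add_of_le' hp.one_lt.le
  have hq : 0 < q := by have := hp.one_lt; omega
  simp only [Nat.add_sub_cancel, show m + 3 - 1 = m + 2 from rfl,
    show m + 3 - 2 = m + 1 from rfl] at *
  have hgeom : q * ∑ i ∈ Finset.Icc 1 m, (q + 1) ^ i + (q + 1) = (q + 1) ^ (m + 1) := by
    clear * -
    induction m with
    | zero => simp
    | succ m ih =>
      rw [Finset.sum_Icc_succ_top (by omega), pow_succ _ (m + 1), ← ih]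
      ring
  refine Nat.le_of_mul_le_mul_left ?_ (Nat.mul_pos (Nat.succ_pos q) hq)
  have hS' := Nat.mul_le_mul_left q hS
  generalize ∑ i ∈ Finset.Icc 1 m, (q + 1) ^ i = s at *
  have h2 : (q + 1) ^ (m + 2) = (q + 1) * (q + 1) ^ (m + 1) := by ring
  have h3 : (q + 1) ^ (m + 3) = (q + 1) * ((q + 1) * (q + 1) ^ (m + 1)) := by ring
  rw [h2] at hS'
  rw [h3] at hmain
  rw [← hgeom] at hS' hmain ⊢
  nlinarith
end

section
/- Let p be an odd prime, n ≥ 3 an integer, and G a group of order p^n with exp(G) ≠ p and Ω_1(G) ≠ G. Then |C(G)| = 2p^{n-2} + p^{n-3} + p^{n-4} + ... + p + 2 if and only if exp(G) = p^2 and Ω_{{1}}(G) = Ω_1(G) is a subgroup of index p in G. -/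
open Finset in
theorem sum_inv_totient_orderOf_eq_numCyclicSubgroups (G : Type*) [Group G] [Fintype G] :
    ∑ x : G, ((orderOf x).totient : ℚ)⁻¹ = numCyclicSubgroups G := by
  classical
  have : Fintype {H : Subgroup G // IsCyclic H} := Fintype.ofFinite _
  let f : G → {H : Subgroup G // IsCyclic H} := fun x => ⟨Subgroup.zpowers x, inferInstance⟩
  rw [numCyclicSubgroups, Nat.card_eq_fintype_card, ← Finset.card_univ,
    ← Finset.sum_fiberwise univ f, Finset.cast_card]
  refine Finset.sum_congr rfl fun ⟨H, hH⟩ _ => ?_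
  have hord : ∀ x ∈ univ.filter (fun x => f x = ⟨H, hH⟩), orderOf x = Nat.card H := by
    intro x hx
    have hx : Subgroup.zpowers x = H := by simpa [f] using hx
    rw [← hx, Nat.card_zpowers]
  have hcard : #(univ.filter (fun x => f x = ⟨H, hH⟩)) = (Nat.card H).totient := by
    have key := IsCyclic.card_orderOf_eq_totient (α := H) (d := Nat.card H)
      Nat.card_eq_fintype_card.dvd
    rw [← key]
    symm
    refine Finset.card_bij (fun x _ => (x : G)) ?_ (fun _ _ _ _ h => Subtype.ext h) ?_
    · intro x hx
      have hx : orderOf x = Nat.card H := by simpa using hx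
      simp only [mem_filter, mem_univ, true_and, f, Subtype.mk.injEq]
      refine Subgroup.eq_of_le_of_card_ge ((Subgroup.zpowers_le).2 x.2) ?_
      rw [Nat.card_zpowers, Subgroup.orderOf_coe, hx]
    · intro x hx
      have h := hord x hx
      have hx : Subgroup.zpowers x = H := by simpa [f] using hx
      have hm : x ∈ H := hx ▸ Subgroup.mem_zpowers x
      refine ⟨⟨x, hm⟩, ?_, rfl⟩
      simpa [Subgroup.orderOf_mk] using h
  rw [Finset.sum_congr rfl fun x hx => by rw [hord x hx], Finset.sum_const, hcard, nsmul_eq_mul]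
  exact mul_inv_cancel₀ (by exact_mod_cast (Nat.totient_pos.2 Nat.card_pos).ne')

/-- The value of `p * (p - 1) / φ (orderOf x)` when `x` has order dividing `p ^ 2`. -/
noncomputable def cyclicWeight {G : Type*} [Group G] (p : ℕ) (x : G) : ℚ :=
  open Classical in if x = 1 then p * (p - 1) else if x ^ p = 1 then p else 1

theorem le_cyclicWeight_and_eq_iff {p n : ℕ} (hp : p.Prime) {G : Type*} [Group G]
    (hG : Nat.card G = p ^ n) (x : G) :
    (p * (p - 1) : ℚ) * ((orderOf x).totient : ℚ)⁻¹ ≤ cyclicWeight p x ∧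
      ((p * (p - 1) : ℚ) * ((orderOf x).totient : ℚ)⁻¹ = cyclicWeight p x ↔ x ^ p ^ 2 = 1) := by
  have hp1 : (0 : ℚ) < p - 1 := by
    have : (1 : ℚ) < p := by exact_mod_cast hp.one_lt
    linarith
  have hp0 : (0 : ℚ) < p := by exact_mod_cast hp.pos
  obtain ⟨k, -, hk⟩ := (Nat.dvd_prime_pow hp).1 (hG ▸ orderOf_dvd_natCard x)
  have hpow (j : ℕ) : x ^ p ^ j = 1 ↔ k ≤ j := by
    rw [← orderOf_dvd_iff_pow_eq_one, hk, Nat.pow_dvd_pow_iff_le_right hp.one_lt]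
  have h0 : x = 1 ↔ k ≤ 0 := by simpa using hpow 0
  have h1 : x ^ p = 1 ↔ k ≤ 1 := by simpa using hpow 1
  rw [cyclicWeight, hpow 2, h0, h1, hk]
  rcases k with _ | _ | k
  · simp
  · simp [Nat.totient_prime hp, Nat.cast_sub hp.one_le]
    field_simp
    simp
  · have htot : ((p ^ (k + 2)).totient : ℚ) = p ^ k * (p * (p - 1)) := by
      rw [Nat.totient_prime_pow_succ hp]
      push_cast [Nat.cast_sub hp.one_le]
      ring
    have hq : (p * (p - 1) : ℚ) * ((p ^ (k + 2)).totient : ℚ)⁻¹ = ((p : ℚ) ^ k)⁻¹ := by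
      rw [htot]
      field_simp
    rw [hq]
    simp only [Nat.le_zero, Nat.add_eq_zero_iff, if_neg (show ¬ k + 1 + 1 ≤ 1 by lia)]
    refine ⟨?_, ?_⟩
    · simpa using inv_le_one_of_one_le₀ (one_le_pow₀ (by exact_mod_cast hp.one_le : (1 : ℚ) ≤ p))
    · have : (p : ℚ) ^ k = 1 ↔ k = 0 := by
        have := Nat.pow_eq_one (a := p) (n := k)
        have h2 := hp.one_lt.ne'
        norm_cast
        simp [h2]
      simp [this]

open Finset in
theorem sum_cyclicWeight (p : ℕ) (G : Type*) [Group G] [Fintype G] :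
    ∑ x : G, cyclicWeight p x =
      p * (p - 1) - p + Nat.card G + (p - 1) * Set.ncard {x : G | x ^ p = 1} := by
  classical
  have h (x : G) : cyclicWeight p x =
      (if x = 1 then (p * (p - 1) - p : ℚ) else 0) + 1 + (p - 1) * if x ^ p = 1 then 1 else 0 := by
    unfold cyclicWeight
    split_ifs <;> simp_all
  have hc : Set.ncard {x : G | x ^ p = 1} = #{x : G | x ^ p = 1} := by
    rw [← Set.ncard_coe_finset]
    simp
  simp only [h, Finset.sum_add_distrib, ← Finset.mul_sum, hc]
  simp [Nat.card_eq_fintype_card]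

theorem secondMax_value (p m : ℕ) :
    ((2 * p ^ (m + 1) + (∑ i ∈ Finset.Icc 1 m, p ^ i) + 2 : ℕ) : ℚ) * (p * (p - 1)) =
      p * (p - 1) - p + p ^ (m + 3) + (p - 1) * p ^ (m + 2) := by
  have h : (∑ i ∈ Finset.Icc 1 m, (p : ℚ) ^ i) * (p - 1) = p ^ (m + 1) - p := by
    induction m with
    | zero => simp
    | succ m ih =>
      rw [Finset.sum_Icc_succ_top (by lia), add_mul, ih]
      ring
  push_cast
  linear_combination (p : ℚ) * h

theorem secondMax_eq {p n : ℕ} (hp : p.Prime) (hodd : Odd p) (hn : 3 ≤ n)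
    (G : Type*) [Group G] (hG : Nat.card G = p ^ n) (hexp : Monoid.exponent G ≠ p)
    (hOmega : Subgroup.closure {x : G | x ^ p = 1} ≠ ⊤) :
    numCyclicSubgroups G = 2 * p ^ (n - 2) + (∑ i ∈ Finset.Icc 1 (n - 3), p ^ i) + 2 ↔
      Monoid.exponent G = p ^ 2 ∧
        (Subgroup.closure {x : G | x ^ p = 1} : Set G) = {x : G | x ^ p = 1} ∧
          (Subgroup.closure {x : G | x ^ p = 1}).index = p := by
  obtain ⟨m, rfl⟩ := Nat.exists_eq_add_of_le' hn
  have hfin : Finite G := Nat.finite_of_card_ne_zero (hG ▸ pow_ne_zero _ hp.ne_zero)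
  have : Fintype G := Fintype.ofFinite G
  have hp1 : (0 : ℚ) < p - 1 := by
    have : (1 : ℚ) < p := by exact_mod_cast hp.one_lt
    linarith
  have hp0 : (0 : ℚ) < p := by exact_mod_cast hp.pos
  set S : Set G := {x : G | x ^ p = 1} with hS
  set K := Subgroup.closure S with hK
  have hKcard : Nat.card K = (K : Set G).ncard := (Nat.card_coe_set_eq _)
  have hSK : S.ncard ≤ (K : Set G).ncard :=
    Set.ncard_le_ncard Subgroup.subset_closure (Set.toFinite _)
  have hKle : (K : Set G).ncard ≤ p ^ (m + 2) := by
    obtain ⟨j, hj, hjK⟩ := (Nat.dvd_prime_pow hp).1 (hG ▸ K.card_subgroup_dvd_card)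
    rw [← hKcard, hjK]
    refine Nat.pow_le_pow_right hp.pos ?_
    by_contra hlt
    exact hOmega (Subgroup.eq_top_of_card_eq K (by rw [hjK, hG, show j = m + 3 by lia]))
  have hsum := sum_inv_totient_orderOf_eq_numCyclicSubgroups G
  have hw := sum_cyclicWeight p G
  rw [hG] at hw
  push_cast at hw
  have hval := secondMax_value p m
  have hmul : (numCyclicSubgroups G : ℚ) * (p * (p - 1)) =
      ∑ x : G, (p * (p - 1) : ℚ) * ((orderOf x).totient : ℚ)⁻¹ := by
    rw [← hsum, ← Finset.mul_sum, mul_comm]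
  have hle : ∑ x : G, (p * (p - 1) : ℚ) * ((orderOf x).totient : ℚ)⁻¹ ≤
      ∑ x : G, cyclicWeight p x :=
    Finset.sum_le_sum fun x _ => (le_cyclicWeight_and_eq_iff hp hG x).1
  have heq : ∑ x : G, (p * (p - 1) : ℚ) * ((orderOf x).totient : ℚ)⁻¹ =
      ∑ x : G, cyclicWeight p x ↔ ∀ x : G, x ^ p ^ 2 = 1 := by
    rw [Finset.sum_eq_sum_iff_of_le fun x _ => (le_cyclicWeight_and_eq_iff hp hG x).1]
    simp only [Finset.mem_univ, true_imp_iff, (le_cyclicWeight_and_eq_iff hp hG _).2]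
  have hcount : numCyclicSubgroups G =
      2 * p ^ (m + 1) + (∑ i ∈ Finset.Icc 1 m, p ^ i) + 2 ↔
        (∀ x : G, x ^ p ^ 2 = 1) ∧ S.ncard = p ^ (m + 2) := by
    rw [← Nat.cast_inj (R := ℚ), ← mul_left_inj' (mul_pos hp0 hp1).ne', hval, hmul, ← heq]
    constructor
    · intro h
      have hb : (S.ncard : ℚ) ≤ p ^ (m + 2) := by exact_mod_cast hSK.trans hKle
      have hb' : (p ^ (m + 2) : ℚ) ≤ S.ncard := by
        refine le_of_mul_le_mul_left ?_ hp1
        linarith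
      have hb'' := le_antisymm hb hb'
      refine ⟨?_, by exact_mod_cast hb''⟩
      rw [h, hw, hb'']
    · rintro ⟨h, hc⟩
      rw [h, hw, hc]
      push_cast
      rfl
  have hindex : K.index = p ↔ (K : Set G).ncard = p ^ (m + 2) := by
    have hmul := K.card_mul_index
    rw [hG, hKcard] at hmul
    constructor
    · intro h
      rw [h, pow_succ p (m + 2)] at hmul
      exact Nat.eq_of_mul_eq_mul_right hp.pos hmul
    · intro h
      rw [h, pow_succ p (m + 2)] at hmul
      exact Nat.eq_of_mul_eq_mul_left (pow_pos hp.pos _) hmul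
  rw [show m + 3 - 2 = m + 1 by lia, show m + 3 - 3 = m by lia, hcount, hindex]
  constructor
  · rintro ⟨hx, hc⟩
    have hKc : (K : Set G).ncard = p ^ (m + 2) := le_antisymm hKle (hc ▸ hSK)
    refine ⟨?_, ?_, hKc⟩
    · obtain ⟨j, hj, hje⟩ := (Nat.dvd_prime_pow hp).1 (Monoid.exponent_dvd_of_forall_pow_eq_one hx)
      interval_cases j
      · exfalso
        refine hOmega ((Subgroup.eq_top_iff' K).2 fun x => Subgroup.subset_closure ?_)
        have := Monoid.pow_exponent_eq_one x
        rw [hje, pow_zero, pow_one] at this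
        simp [hS, this]
      · exact absurd (by simpa using hje) hexp
      · exact hje
    · exact (Set.eq_of_subset_of_ncard_le Subgroup.subset_closure (by rw [hKc, hc])
        (Set.toFinite _)).symm
  · rintro ⟨he, hKS, hKc⟩
    exact ⟨fun x => he ▸ Monoid.pow_exponent_eq_one x, hKS ▸ hKc⟩
end

section
/- Let p be a prime and G a group of order p^n with exp(G) = p^m where m ≥ 2. Then |C(G)| ≤ (p^n + p^2 - p - 1 + (p-1)^2 · c_1(G)) / (p^2 - p), and equality holds if and only if exp(G) = p^2. -/
/-- The number of subgroups of `G` of order `d`. -/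
noncomputable def numSubgroupsOfOrder (G : Type*) [Group G] (d : ℕ) : ℕ :=
  Nat.card {H : Subgroup G // Nat.card H = d}

theorem card_zpowers_eq_fiber {G : Type*} [Group G] [Finite G] (H : Subgroup G) [IsCyclic H] :
    Nat.card {g : G // Subgroup.zpowers g = H} = (Nat.card H).totient := by
  classical
  have := Fintype.ofFinite H
  rw [← IsCyclic.card_orderOf_eq_totient (α := H) (d := Nat.card H) (by simp),
    ← Fintype.card_subtype, ← Nat.card_eq_fintype_card]
  refine Nat.card_congr
    { toFun := fun g => ⟨⟨g.1, Subgroup.zpowers_le.1 g.2.le⟩, ?_⟩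
      invFun := fun x => ⟨x.1.1, ?_⟩
      left_inv := fun _ => rfl
      right_inv := fun _ => rfl }
  · rw [Subgroup.orderOf_mk, ← Nat.card_zpowers, g.2]
  · refine Subgroup.eq_of_le_of_card_ge (Subgroup.zpowers_le.2 x.1.2) ?_
    rw [Nat.card_zpowers, Subgroup.orderOf_coe, x.2]

theorem sum_totient_card_isCyclic (G : Type*) [Group G] [Finite G]
    [Fintype {H : Subgroup G // IsCyclic H}] :
    ∑ H : {H : Subgroup G // IsCyclic H}, (Nat.card H.1).totient = Nat.card G := by
  let f : G → {H : Subgroup G // IsCyclic H} := fun g => ⟨Subgroup.zpowers g, inferInstance⟩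
  rw [Nat.card_congr (Equiv.sigmaFiberEquiv f).symm, Nat.card_sigma]
  refine Finset.sum_congr rfl fun H _ => ?_
  have := H.2
  rw [← card_zpowers_eq_fiber H.1]
  exact Nat.card_congr (Equiv.subtypeEquivRight fun g => by simp [f, Subtype.ext_iff])

theorem sq_sub_le_totient_prime_pow {p : ℕ} (hp : p.Prime) (k : ℕ) :
    (p : ℚ) ^ 2 - p ≤ (p ^ k).totient + (if p ^ k = 1 then (p : ℚ) ^ 2 - p - 1 else 0) +
        (if p ^ k = p then ((p : ℚ) - 1) ^ 2 else 0) ∧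
      ((p : ℚ) ^ 2 - p = (p ^ k).totient + (if p ^ k = 1 then (p : ℚ) ^ 2 - p - 1 else 0) +
        (if p ^ k = p then ((p : ℚ) - 1) ^ 2 else 0) ↔ k ≤ 2) := by
  have h1 : (1 : ℚ) < p := by exact_mod_cast hp.one_lt
  have hc : ((p - 1 : ℕ) : ℚ) = p - 1 := by
    rw [Nat.cast_sub hp.one_le, Nat.cast_one]
  match k with
  | 0 => simp [hp.ne_one.symm]
  | 1 =>
    have h : (p : ℚ) ^ 2 - p = (p - 1) + (p - 1) ^ 2 := by ring
    simp [hp.ne_one, Nat.totient_prime hp, hc, h]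
  | j + 2 =>
    have e1 : p ^ (j + 2) ≠ 1 := (Nat.one_lt_pow (by omega) hp.one_lt).ne'
    have e2 : p ^ (j + 2) ≠ p := fun h => by
      have := Nat.pow_right_injective hp.two_le (h.trans (pow_one p).symm)
      omega
    rw [if_neg e1, if_neg e2, Nat.totient_prime_pow_succ hp]
    push_cast
    rw [hc, add_zero, add_zero, show (p : ℚ) ^ 2 - p = p * (p - 1) by ring]
    have hpos : (0 : ℚ) < p - 1 := by linarith
    refine ⟨mul_le_mul_of_nonneg_right (le_self_pow₀ h1.le (by omega)) hpos.le, ?_⟩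
    rw [mul_left_inj' hpos.ne']
    constructor
    · intro h
      have h' : p ^ 1 = p ^ (j + 1) := by rw [pow_one]; exact_mod_cast h
      have := Nat.pow_right_injective hp.two_le h'
      omega
    · intro h
      obtain rfl : j = 0 := by omega
      simp

theorem card_isCyclic_subtype_card_eq_prime {p : ℕ} (hp : p.Prime) (G : Type*) [Group G] :
    Nat.card {H : {H : Subgroup G // IsCyclic H} // Nat.card H.1 = p} =
      numSubgroupsOfOrder G p := by
  have := Fact.mk hp
  exact Nat.card_congr (Equiv.subtypeSubtypeEquivSubtype
    (p := fun H : Subgroup G => IsCyclic H) (q := fun H : Subgroup G => Nat.card H = p)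
    fun {_} h => isCyclic_of_prime_card h)

theorem card_isCyclic_subtype_card_eq_one (G : Type*) [Group G] :
    Nat.card {H : {H : Subgroup G // IsCyclic H} // Nat.card H.1 = 1} = 1 := by
  rw [Nat.card_eq_one_iff_unique]
  refine ⟨⟨fun a b => ?_⟩, ⟨⟨⟨⊥, inferInstance⟩, Subgroup.card_bot⟩⟩⟩
  rw [Subtype.ext_iff, Subtype.ext_iff, Subgroup.eq_bot_of_card_eq _ a.2,
    Subgroup.eq_bot_of_card_eq _ b.2]

theorem exponent_dvd_iff_card_isCyclic_dvd (G : Type*) [Group G] (d : ℕ) :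
    Monoid.exponent G ∣ d ↔ ∀ H : {H : Subgroup G // IsCyclic H}, Nat.card H.1 ∣ d := by
  rw [Monoid.exponent_dvd]
  constructor
  · rintro h ⟨H, hH⟩
    obtain ⟨g, rfl⟩ := (Subgroup.isCyclic_iff_exists_zpowers_eq_top H).1 hH
    simpa [Nat.card_zpowers] using h g
  · intro h g
    simpa [Nat.card_zpowers] using h ⟨Subgroup.zpowers g, inferInstance⟩

theorem cyclicCount_upper_bound {p n m : ℕ} (hp : p.Prime) (hm : 2 ≤ m)
    (G : Type*) [Group G] (hG : Nat.card G = p ^ n)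
    (hexp : Monoid.exponent G = p ^ m) :
    (numCyclicSubgroups G : ℚ) ≤
        ((p : ℚ) ^ n + (p : ℚ) ^ 2 - p - 1 + ((p : ℚ) - 1) ^ 2 * numSubgroupsOfOrder G p) /
          ((p : ℚ) ^ 2 - p) ∧
      ((numCyclicSubgroups G : ℚ) =
          ((p : ℚ) ^ n + (p : ℚ) ^ 2 - p - 1 + ((p : ℚ) - 1) ^ 2 * numSubgroupsOfOrder G p) /
            ((p : ℚ) ^ 2 - p) ↔
        Monoid.exponent G = p ^ 2) := by
  classical
  have : Finite G := Nat.finite_of_card_ne_zero (hG ▸ pow_ne_zero n hp.ne_zero)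
  have := Fintype.ofFinite {H : Subgroup G // IsCyclic H}
  have h1 : (1 : ℚ) < p := by exact_mod_cast hp.one_lt
  have hpos : (0 : ℚ) < (p : ℚ) ^ 2 - p := by nlinarith
  let w : {H : Subgroup G // IsCyclic H} → ℚ := fun H =>
    (Nat.card H.1).totient + (if Nat.card H.1 = 1 then (p : ℚ) ^ 2 - p - 1 else 0) +
      (if Nat.card H.1 = p then ((p : ℚ) - 1) ^ 2 else 0)
  have hcard (H : {H : Subgroup G // IsCyclic H}) : ∃ k, Nat.card H.1 = p ^ k := by
    obtain ⟨k, -, hk⟩ := (Nat.dvd_prime_pow hp).1 (hG ▸ Subgroup.card_subgroup_dvd_card H.1)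
    exact ⟨k, hk⟩
  have hle (H : {H : Subgroup G // IsCyclic H}) : (p : ℚ) ^ 2 - p ≤ w H := by
    obtain ⟨k, hk⟩ := hcard H
    simpa only [w, hk] using (sq_sub_le_totient_prime_pow hp k).1
  have heq (H : {H : Subgroup G // IsCyclic H}) :
      (p : ℚ) ^ 2 - p = w H ↔ Nat.card H.1 ∣ p ^ 2 := by
    obtain ⟨k, hk⟩ := hcard H
    rw [hk, Nat.pow_dvd_pow_iff_le_right hp.one_lt]
    simpa only [w, hk] using (sq_sub_le_totient_prime_pow hp k).2
  have hconst : ∑ _H : {H : Subgroup G // IsCyclic H}, ((p : ℚ) ^ 2 - p) =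
      numCyclicSubgroups G * ((p : ℚ) ^ 2 - p) := by
    rw [Finset.sum_const, Finset.card_univ, nsmul_eq_mul, numCyclicSubgroups,
      Nat.card_eq_fintype_card]
  have hsum : ∑ H, w H =
      (p : ℚ) ^ n + (p : ℚ) ^ 2 - p - 1 + ((p : ℚ) - 1) ^ 2 * numSubgroupsOfOrder G p := by
    simp only [w, Finset.sum_add_distrib, ← Finset.sum_filter, Finset.sum_const, nsmul_eq_mul]
    rw [← Nat.cast_sum, sum_totient_card_isCyclic, hG, ← Fintype.card_subtype,
      ← Fintype.card_subtype, ← Nat.card_eq_fintype_card, ← Nat.card_eq_fintype_card,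
      card_isCyclic_subtype_card_eq_one, card_isCyclic_subtype_card_eq_prime hp]
    push_cast
    ring
  rw [← hsum, le_div_iff₀ hpos, eq_div_iff hpos.ne', ← hconst]
  refine ⟨Finset.sum_le_sum fun H _ => hle H, ?_⟩
  rw [Finset.sum_eq_sum_iff_of_le fun H _ => hle H]
  simp only [Finset.mem_univ, true_imp_iff, heq]
  rw [← exponent_dvd_iff_card_isCyclic_dvd, hexp]
  exact ⟨fun h => Nat.dvd_antisymm h (pow_dvd_pow p hm), fun h => h.dvd⟩
end

section
/- Let p be a prime and n ≥ 2 an integer. The number of cyclic subgroups of the abelian group C_p × C_{p^{n-1}} is (n-1)p + 2. -/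
open Finset in
/-- In a finite group, every cyclic subgroup of order `d` has `φ d` generators, so the elements of
order `d` are `φ d` times as many as the cyclic subgroups of order `d`. -/
theorem card_orderOf_eq_card_isCyclic_mul_totient {G : Type*} [Group G] [Finite G] (d : ℕ) :
    Nat.card {x : G // orderOf x = d} =
      Nat.card {H : Subgroup G // IsCyclic H ∧ Nat.card H = d} * d.totient := by
  classical
  have := Fintype.ofFinite G
  have := Fintype.ofFinite (Subgroup G)
  rw [Nat.card_eq_fintype_card, Nat.card_eq_fintype_card, Fintype.card_subtype,
    Fintype.card_subtype, card_eq_sum_card_fiberwise (f := Subgroup.zpowers)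
      (t := {H : Subgroup G | IsCyclic H ∧ Nat.card H = d})]
  · refine sum_const_nat fun H hH ↦ ?_
    obtain ⟨_, hHd⟩ := (mem_filter.1 hH).2
    rw [← IsCyclic.card_orderOf_eq_totient (α := H) (by rw [← Nat.card_eq_fintype_card, hHd]),
      ← card_map (Function.Embedding.subtype (· ∈ H))]
    congr 1
    ext x
    simp only [mem_filter, mem_univ, true_and, mem_map, Function.Embedding.subtype_apply,
      Subtype.exists, Subgroup.orderOf_mk, exists_and_left, exists_prop, exists_eq_right_right]
    refine and_congr_right fun hx ↦ ⟨fun h ↦ h ▸ Subgroup.mem_zpowers x, fun h ↦ ?_⟩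
    exact Subgroup.eq_of_le_of_card_ge (Subgroup.zpowers_le.2 h)
      (by rw [Nat.card_zpowers, hx, hHd])
  · intro x hx
    simp only [coe_filter, mem_univ, true_and, Set.mem_ofPred_eq] at hx ⊢
    exact ⟨inferInstance, by rw [Nat.card_zpowers, hx]⟩

/-- The cyclic subgroups of a finite group of exponent dividing `p ^ N`, sorted by their order. -/
theorem numCyclicSubgroups_eq_sum_of_orderOf_dvd_prime_pow {G : Type*} [Group G] [Finite G]
    {p N : ℕ} (hp : p.Prime) (hG : ∀ x : G, orderOf x ∣ p ^ N) :
    numCyclicSubgroups G = ∑ k ∈ Finset.range (N + 1),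
      Nat.card {H : Subgroup G // IsCyclic H ∧ Nat.card H = p ^ k} := by
  classical
  have := Fintype.ofFinite (Subgroup G)
  have hcard (H : Subgroup G) (hH : IsCyclic H) : ∃ j ≤ N, Nat.card H = p ^ j := by
    obtain ⟨x, hx⟩ := hH.exists_ofOrder_eq_natCard
    rw [← hx, ← Subgroup.orderOf_coe]
    exact (Nat.dvd_prime_pow hp).1 (hG x)
  have hfilter (P : Subgroup G → Prop) : Nat.card {H // P H} = (Finset.univ.filter P).card := by
    rw [Nat.card_eq_fintype_card, Fintype.card_subtype]
  simp only [numCyclicSubgroups, hfilter]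
  rw [Finset.card_eq_sum_card_fiberwise (f := fun H : Subgroup G ↦ Nat.log p (Nat.card H))
    (t := Finset.range (N + 1))]
  · refine Finset.sum_congr rfl fun k _ ↦ ?_
    congr 1
    ext H
    simp only [Finset.mem_filter, Finset.mem_univ, true_and]
    refine and_congr_right fun hH ↦ ?_
    obtain ⟨j, -, hj⟩ := hcard H hH
    rw [hj, Nat.log_pow hp.one_lt, Nat.pow_right_inj hp.one_lt]
  · intro H hH
    obtain ⟨j, hjN, hj⟩ := hcard H (Finset.mem_filter.1 hH).2
    simp only [hj, Nat.log_pow hp.one_lt, Finset.coe_range, Set.mem_Iio]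
    exact Nat.lt_succ_of_le hjN

theorem addOrderOf_mk_of_ne_zero {p m : ℕ} (hp : p.Prime) (a : ZMod p) {b : ZMod (p ^ m)}
    (hb : b ≠ 0) : addOrderOf (a, b) = addOrderOf b := by
  rw [Prod.addOrderOf_mk]
  refine Nat.lcm_eq_right ?_
  have ha : addOrderOf a ∣ p := by simpa using addOrderOf_dvd_natCard a
  have hb' : addOrderOf b ∣ p ^ m := by simpa using addOrderOf_dvd_natCard b
  obtain ⟨j, -, hj⟩ := (Nat.dvd_prime_pow hp).1 hb'
  have hj0 : j ≠ 0 := by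
    rintro rfl
    exact hb (AddMonoid.addOrderOf_eq_one_iff.1 (by simpa using hj))
  exact ha.trans (hj ▸ dvd_pow_self p hj0)

open Finset in
/-- The number of elements of order `p ^ (k + 1)` in `ZMod p × ZMod (p ^ m)`. -/
theorem card_addOrderOf_eq_prime_pow_succ {p m k : ℕ} (hp : p.Prime) (hk : k < m) :
    Nat.card {x : ZMod p × ZMod (p ^ m) // addOrderOf x = p ^ (k + 1)} =
      (p + if k = 0 then 1 else 0) * (p ^ (k + 1)).totient := by
  classical
  have : NeZero p := ⟨hp.ne_zero⟩
  have hpk : p ^ (k + 1) ≠ 1 := (Nat.one_lt_pow k.succ_ne_zero hp.one_lt).ne'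
  have hunion : ({x : ZMod p × ZMod (p ^ m) | addOrderOf x = p ^ (k + 1)} : Finset _) =
      univ ×ˢ ({b | addOrderOf b = p ^ (k + 1)} : Finset (ZMod (p ^ m))) ∪
        ({a | addOrderOf a = p ^ (k + 1)} : Finset (ZMod p)) ×ˢ {0} := by
    ext ⟨a, b⟩
    by_cases hb : b = 0
    · simp [hb, Prod.addOrderOf_mk, hpk.symm]
    · simp [Ne.symm hb, addOrderOf_mk_of_ne_zero hp a hb]
  have hfst : #({a | addOrderOf a = p ^ (k + 1)} : Finset (ZMod p)) =
      (if k = 0 then 1 else 0) * (p ^ (k + 1)).totient := by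
    split_ifs with hk0
    · rw [one_mul, IsAddCyclic.card_addOrderOf_eq_totient (by simp [hk0])]
    · rw [zero_mul, card_eq_zero, filter_eq_empty_iff]
      intro a _ ha
      have : p ^ (k + 1) ∣ p ^ 1 := ha ▸ by simpa using addOrderOf_dvd_natCard a
      have := (Nat.pow_dvd_pow_iff_le_right hp.one_lt).1 this
      omega
  rw [Nat.card_eq_fintype_card, Fintype.card_subtype, hunion, card_union_of_disjoint,
    card_product, card_product, hfst, IsAddCyclic.card_addOrderOf_eq_totient
      (by rw [ZMod.card]; exact pow_dvd_pow p hk), card_univ, ZMod.card, card_singleton]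
  · ring
  · rw [disjoint_left]
    rintro ⟨a, b⟩ h₁ h₂
    simp only [mem_product, mem_filter, mem_univ, true_and, mem_singleton] at h₁ h₂
    exact hpk (by rw [← h₁, h₂.2, addOrderOf_zero])

theorem numCyclic_Cp_times_Cpn {p n : ℕ} (hp : p.Prime) (hn : 2 ≤ n) :
    numCyclicSubgroups (Multiplicative (ZMod p × ZMod (p ^ (n - 1)))) = (n - 1) * p + 2 := by
  obtain ⟨m, rfl⟩ : ∃ m, n = m + 2 := ⟨n - 2, by omega⟩
  rw [show m + 2 - 1 = m + 1 by omega]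
  have : NeZero p := ⟨hp.ne_zero⟩
  set G := Multiplicative (ZMod p × ZMod (p ^ (m + 1)))
  have hG (x : G) : orderOf x ∣ p ^ (m + 1) := by
    rw [← ofAdd_toAdd x, orderOf_ofAdd_eq_addOrderOf, Prod.addOrderOf, Nat.lcm_dvd_iff]
    exact ⟨(by simpa using addOrderOf_dvd_natCard x.toAdd.1 : _ ∣ p).trans
      (dvd_pow_self p m.succ_ne_zero), by simpa using addOrderOf_dvd_natCard x.toAdd.2⟩
  have hone : Nat.card {H : Subgroup G // IsCyclic H ∧ Nat.card H = p ^ 0} = 1 := by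
    have h := card_orderOf_eq_card_isCyclic_mul_totient (G := G) 1
    simpa using h.symm
  have hsucc (k : ℕ) (hk : k < m + 1) :
      Nat.card {H : Subgroup G // IsCyclic H ∧ Nat.card H = p ^ (k + 1)} =
        p + if k = 0 then 1 else 0 := by
    have h := card_orderOf_eq_card_isCyclic_mul_totient (G := G) (p ^ (k + 1))
    have h' := card_addOrderOf_eq_prime_pow_succ hp hk
    refine Nat.eq_of_mul_eq_mul_right (Nat.totient_pos.2 (pow_pos hp.pos _)) (h.symm.trans ?_)
    rw [← h']
    exact Nat.card_congr (Multiplicative.toAdd.subtypeEquiv fun x ↦ by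
      rw [← orderOf_ofAdd_eq_addOrderOf, ofAdd_toAdd])
  rw [numCyclicSubgroups_eq_sum_of_orderOf_dvd_prime_pow hp hG, Finset.sum_range_succ', hone,
    Finset.sum_congr rfl fun k hk ↦ hsucc k (Finset.mem_range.1 hk)]
  simp [Finset.sum_add_distrib]
end

section
/- Let p be a prime and n ≥ 3 an integer (with n ≥ 4 if p = 2). The number of cyclic subgroups of the modular p-group M(p^n) is (n-1)p + 2. -/
/-- Every element of order `d` generates a cyclic subgroup of order `d`, and each such subgroup has
`φ d` generators. -/
theorem card_isCyclic_card_eq_mul_totient (G : Type*) [Group G] [Finite G] (d : ℕ) :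
    Nat.card {H : Subgroup G // IsCyclic H ∧ Nat.card H = d} * d.totient =
      {g : G | orderOf g = d}.ncard := by
  classical
  have := Fintype.ofFinite {H : Subgroup G // IsCyclic H ∧ Nat.card H = d}
  have hfib (H : {H : Subgroup G // IsCyclic H ∧ Nat.card H = d}) :
      Nat.card {h : H.1 // orderOf h = d} = d.totient := by
    obtain ⟨H, hH, hc⟩ := H
    have := Fintype.ofFinite H
    rw [Nat.card_eq_fintype_card, Fintype.card_subtype]
    exact IsCyclic.card_orderOf_eq_totient (by simp [← Nat.card_eq_fintype_card, hc])
  have hsig : Nat.card (Σ H : {H : Subgroup G // IsCyclic H ∧ Nat.card H = d},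
      {h : H.1 // orderOf h = d}) =
      Nat.card {H : Subgroup G // IsCyclic H ∧ Nat.card H = d} * d.totient := by
    rw [Nat.card_sigma]
    simp [hfib]
  rw [← hsig, ← Nat.card_coe_set_eq]
  refine Nat.card_eq_of_bijective
    (fun a => (⟨a.2.1.1, by simpa using a.2.2⟩ : {g : G | orderOf g = d})) ⟨?_, ?_⟩
  · have key (H : Subgroup G) (hc : Nat.card H = d) (h : G) (hm : h ∈ H) (ho : orderOf h = d) :
        H = Subgroup.zpowers h := by
      refine (Subgroup.eq_of_le_of_card_ge ?_ ?_).symm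
      · simpa using hm
      · rw [Nat.card_zpowers, ho, hc]
    rintro ⟨⟨H, hH, hc⟩, ⟨⟨h, hm⟩, ho⟩⟩ ⟨⟨K, hK, hc'⟩, ⟨⟨k, hm'⟩, ho'⟩⟩ e
    simp only [Subtype.mk.injEq] at e
    subst e
    rw [Subgroup.orderOf_mk] at ho
    obtain rfl : H = K := (key H hc h hm ho).trans (key K hc' h hm' ho).symm
    rfl
  · rintro ⟨g, hg⟩
    exact ⟨⟨⟨Subgroup.zpowers g, inferInstance, by rw [Nat.card_zpowers]; exact hg⟩,
      ⟨⟨g, Subgroup.mem_zpowers g⟩, by rw [Subgroup.orderOf_mk]; exact hg⟩⟩, rfl⟩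

/-- The number of elements of order `p ^ (k + 1)` is a difference of two torsion counts. -/
theorem ncard_orderOf_eq_prime_pow_succ (G : Type*) [Group G] [Finite G] {p : ℕ} (hp : p.Prime)
    (k : ℕ) :
    {g : G | orderOf g = p ^ (k + 1)}.ncard + {g : G | g ^ p ^ k = 1}.ncard =
      {g : G | g ^ p ^ (k + 1) = 1}.ncard := by
  have := Fact.mk hp
  have hsub : {g : G | g ^ p ^ k = 1} ⊆ {g : G | g ^ p ^ (k + 1) = 1} := by
    intro g (hg : g ^ p ^ k = 1)
    simp [pow_succ, pow_mul, hg]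
  rw [← Set.ncard_sdiff_add_ncard_of_subset hsub]
  congr 2
  ext g
  constructor
  · intro (hg : orderOf g = p ^ (k + 1))
    refine ⟨orderOf_dvd_iff_pow_eq_one.1 hg.dvd, fun h : g ^ p ^ k = 1 => ?_⟩
    have := orderOf_dvd_of_pow_eq_one h
    rw [hg, Nat.pow_dvd_pow_iff_le_right hp.one_lt] at this
    omega
  · rintro ⟨h1, h2⟩
    exact orderOf_eq_prime_pow h2 h1

/-- In a finite `p`-group satisfying `g ^ p ^ m = 1`, cyclic subgroups are counted by order. -/
theorem numCyclicSubgroups_eq_sum_s12 (G : Type*) [Group G] [Finite G] {p : ℕ} (hp : p.Prime)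
    (m : ℕ) (hexp : ∀ g : G, g ^ p ^ m = 1) :
    numCyclicSubgroups G = ∑ k ∈ Finset.range (m + 1),
      Nat.card {H : Subgroup G // IsCyclic H ∧ Nat.card H = p ^ k} := by
  rw [Finset.sum_range (fun k => Nat.card {H : Subgroup G // IsCyclic H ∧ Nat.card H = p ^ k}),
    ← Nat.card_sigma]
  symm
  refine Nat.card_eq_of_bijective
    (fun a => (⟨a.2.1, a.2.2.1⟩ : {H : Subgroup G // IsCyclic H})) ⟨?_, ?_⟩
  · rintro ⟨i, H, hH, hc⟩ ⟨j, K, hK, hc'⟩ e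
    simp only [Subtype.mk.injEq] at e
    subst e
    obtain rfl : i = j := Fin.ext (Nat.pow_right_injective hp.two_le (hc.symm.trans hc'))
    rfl
  · rintro ⟨H, hH⟩
    obtain ⟨g, rfl⟩ := Subgroup.isCyclic_iff_exists_zpowers_eq_top H |>.1 hH
    obtain ⟨k, hk, hk'⟩ := (Nat.dvd_prime_pow hp).1 (orderOf_dvd_of_pow_eq_one (hexp g))
    exact ⟨⟨⟨k, by omega⟩, Subgroup.zpowers g, hH, by rw [Nat.card_zpowers, hk']⟩, rfl⟩

/-- The number of cyclic subgroups of a group having the same number of `p ^ k`-torsion elements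
as `ℤ/p^m × ℤ/p`. -/
theorem numCyclicSubgroups_of_ncard_torsion (G : Type*) [Group G] [Finite G] {p : ℕ}
    (hp : p.Prime) (m : ℕ) (hexp : ∀ g : G, g ^ p ^ (m + 1) = 1)
    (htors : ∀ k, 1 ≤ k → k ≤ m + 1 → {g : G | g ^ p ^ k = 1}.ncard = p ^ (k + 1)) :
    numCyclicSubgroups G = (m + 1) * p + 2 := by
  have h0 : Nat.card {H : Subgroup G // IsCyclic H ∧ Nat.card H = p ^ 0} = 1 := by
    have h := card_isCyclic_card_eq_mul_totient G (p ^ 0)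
    simpa using h
  have hpos : 0 < p - 1 := Nat.sub_pos_of_lt hp.one_lt
  obtain ⟨q, rfl⟩ : ∃ q, p = q + 1 := ⟨p - 1, by omega⟩
  rw [Nat.add_sub_cancel] at hpos
  have h1 : Nat.card {H : Subgroup G // IsCyclic H ∧ Nat.card H = (q + 1) ^ (0 + 1)} =
      q + 1 + 1 := by
    have h := card_isCyclic_card_eq_mul_totient G ((q + 1) ^ (0 + 1))
    have h' := ncard_orderOf_eq_prime_pow_succ G hp 0
    rw [← h, htors (0 + 1) (by omega) (by omega), Nat.totient_prime_pow_succ hp] at h'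
    simp only [pow_zero, pow_one, Set.ofPred_eq_eq_singleton, Set.ncard_singleton, one_mul,
      Nat.add_sub_cancel] at h'
    refine Nat.eq_of_mul_eq_mul_right hpos ?_
    linear_combination h'
  have h2 (k : ℕ) (hk : k < m) :
      Nat.card {H : Subgroup G // IsCyclic H ∧ Nat.card H = (q + 1) ^ (k + 1 + 1)} = q + 1 := by
    have h := card_isCyclic_card_eq_mul_totient G ((q + 1) ^ (k + 1 + 1))
    have h' := ncard_orderOf_eq_prime_pow_succ G hp (k + 1)
    rw [← h, htors (k + 1 + 1) (by omega) (by omega), htors (k + 1) (by omega) (by omega),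
      Nat.totient_prime_pow_succ hp, Nat.add_sub_cancel] at h'
    refine Nat.eq_of_mul_eq_mul_right (Nat.mul_pos (pow_pos hp.pos (k + 1)) hpos) ?_
    linear_combination h'
  rw [numCyclicSubgroups_eq_sum_s12 G hp (m + 1) hexp, Finset.sum_range_succ', Finset.sum_range_succ',
    h0, h1, Finset.sum_congr rfl fun k hk => h2 k (Finset.mem_range.1 hk)]
  simp
  ring

theorem mul_pow_of_mul_eq_mul_pow {M : Type*} [Monoid M] {a h : M} {s : ℕ}
    (hc : h * a = a * h ^ s) (m : ℕ) :
    (a * h) ^ m = a ^ m * h ^ ∑ t ∈ Finset.range m, s ^ t := by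
  have hpow (e : ℕ) : h ^ e * a = a * h ^ (s * e) := by
    induction e with
    | zero => simp
    | succ e ih => rw [pow_succ, mul_assoc, hc, ← mul_assoc, ih, mul_assoc, ← pow_add, mul_add_one]
  induction m with
  | zero => simp
  | succ m ih =>
    rw [pow_succ, ih, mul_assoc, ← mul_assoc _ a h, hpow, pow_succ a, Finset.sum_range_succ',
      pow_zero, pow_succ h]
    simp only [mul_assoc, Finset.mul_sum, pow_succ']

/-- If `s ≡ 1` modulo `p` (modulo `4` when `p = 2`), then `1 + s + ⋯ + s ^ (p - 1)` is `p` times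
an integer prime to `p`. -/
theorem exists_geom_sum_eq_mul_coprime {p s : ℕ} (hp : p.Prime) (hs : s ≡ 1 [MOD p])
    (hs2 : p = 2 → s ≡ 1 [MOD 4]) :
    ∃ u, ∑ t ∈ Finset.range p, s ^ t = p * u ∧ p.Coprime u := by
  rcases hp.eq_two_or_odd' with rfl | hodd
  · have h4 : s % 4 = 1 := hs2 rfl
    refine ⟨(s + 1) / 2, ?_, ?_⟩
    · simp [Finset.sum_range_succ]
      omega
    · rw [Nat.coprime_two_left, Nat.odd_iff]
      omega
  · obtain ⟨c, hc⟩ : (p : ℤ) ∣ s - 1 := by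
      simpa using (Nat.modEq_iff_dvd.1 hs.symm)
    have hsq := odd_sq_dvd_geom_sum₂_sub (R := ℤ) 1 c hodd
    rw [← hc] at hsq
    simp only [add_sub_cancel, one_pow, mul_one] at hsq
    obtain ⟨e, he⟩ := hsq
    have hsum : ((∑ t ∈ Finset.range p, s ^ t : ℕ) : ℤ) = p * (1 + p * e) := by
      push_cast
      linear_combination he
    obtain ⟨u, hu⟩ : p ∣ ∑ t ∈ Finset.range p, s ^ t := by
      rw [← Int.natCast_dvd_natCast, hsum]
      exact dvd_mul_right _ _
    refine ⟨u, hu, (Nat.Prime.coprime_iff_not_dvd hp).2 fun hd => ?_⟩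
    rw [hu, Nat.cast_mul] at hsum
    have hu' : (u : ℤ) = 1 + p * e := mul_left_cancel₀ (by exact_mod_cast hp.ne_zero) hsum
    rw [← Int.natCast_dvd_natCast, hu', dvd_add_left (dvd_mul_right _ _)] at hd
    exact hp.one_lt.ne' (by exact_mod_cast Int.eq_one_of_dvd_one (by positivity) hd)

theorem pow_mul_pow_comm_of_conj {G : Type*} [Group G] {x y : G} {r : ℕ}
    (hxy : y⁻¹ * x * y = x ^ r) (i j : ℕ) : x ^ i * y ^ j = y ^ j * (x ^ i) ^ r ^ j := by
  have h1 (e : ℕ) : x ^ e * y = y * x ^ (e * r) := by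
    rw [mul_comm, pow_mul, ← hxy]
    have := conj_pow (a := y⁻¹) (b := x) (i := e)
    rw [inv_inv] at this
    rw [this]
    group
  induction j with
  | zero => simp
  | succ j ih => rw [pow_succ y, ← mul_assoc, ih, mul_assoc, ← pow_mul, h1, mul_assoc, ← pow_mul,
      pow_succ r, mul_assoc]

theorem exists_pow_mul_pow_of_conj {G : Type*} [Group G] [Finite G] {x y : G} {r : ℕ}
    (hxy : y⁻¹ * x * y = x ^ r) (hgen : Subgroup.closure {x, y} = ⊤) (g : G) :
    ∃ j i : ℕ, y ^ j * x ^ i = g := by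
  have hg : g ∈ (Subgroup.closure {x, y}).toSubmonoid := by simp [hgen]
  rw [Subgroup.closure_toSubmonoid_of_finite] at hg
  induction hg using Submonoid.closure_induction with
  | mem g hg =>
    rcases hg with rfl | rfl
    · exact ⟨0, 1, by simp⟩
    · exact ⟨1, 0, by simp⟩
  | one => exact ⟨0, 0, by simp⟩
  | mul a b _ _ iha ihb =>
    obtain ⟨j, i, rfl⟩ := iha
    obtain ⟨k, l, rfl⟩ := ihb
    refine ⟨j + k, i * r ^ k + l, ?_⟩
    rw [mul_assoc, ← mul_assoc (x ^ i), pow_mul_pow_comm_of_conj hxy, pow_add, pow_add, pow_mul]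
    simp only [mul_assoc]

theorem numCyclic_modular {p n : ℕ} (hp : p.Prime) (hn : 3 ≤ n) (hn2 : p = 2 → 4 ≤ n)
    (G : Type*) [Group G] (hG : IsModularPGroup G p n) :
    numCyclicSubgroups G = (n - 1) * p + 2 := by
  obtain ⟨hcard, x, y, hx, hy, hxy, hgen⟩ := hG
  obtain ⟨m, rfl⟩ : ∃ m, n = m + 2 := ⟨n - 2, by omega⟩
  simp only [Nat.add_sub_cancel, show m + 2 - 1 = m + 1 by omega] at hx hxy ⊢
  have : Finite G := Nat.finite_of_card_ne_zero (by rw [hcard]; exact (pow_pos hp.pos _).ne')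
  let f : Fin p × Subgroup.zpowers x → G := fun a => y ^ (a.1 : ℕ) * a.2
  have hf : Function.Surjective f := by
    intro g
    obtain ⟨j, i, rfl⟩ := exists_pow_mul_pow_of_conj hxy hgen g
    refine ⟨(⟨j % p, Nat.mod_lt _ hp.pos⟩, ⟨x ^ i, Subgroup.npow_mem_zpowers x i⟩), ?_⟩
    simp only [f]
    rw [← pow_eq_pow_mod j hy]
  have hdom : Nat.card (Fin p × Subgroup.zpowers x) = p * orderOf x := by
    rw [Nat.card_prod, Nat.card_zpowers, Nat.card_fin]
  have hord : orderOf x = p ^ (m + 1) := by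
    refine le_antisymm (orderOf_le_of_pow_eq_one (pow_pos hp.pos _) hx) ?_
    have h := Nat.card_le_card_of_surjective f hf
    rw [hdom, hcard, pow_succ'] at h
    exact Nat.le_of_mul_le_mul_left h hp.pos
  have hbij : Function.Bijective f :=
    (Nat.bijective_iff_surjective_and_card f).2 ⟨hf, by rw [hdom, hcard, hord, ← pow_succ']⟩
  have hpow (a : Fin p × Subgroup.zpowers x) (k : ℕ) :
      f a ^ p ^ (k + 1) = 1 ↔ a.2 ^ p ^ (k + 1) = 1 := by
    obtain ⟨j, h, hh⟩ := a
    obtain ⟨i, rfl⟩ := (mem_powers_iff_mem_zpowers (x := x)).2 hh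
    have hr {d : ℕ} (hd : d ∣ p ^ m) : (1 + p ^ m) ^ (j : ℕ) ≡ 1 [MOD d] := by
      have : 1 + p ^ m ≡ 1 [MOD d] := by
        simpa using ((Nat.modEq_zero_iff_dvd.2 hd).add_left 1)
      simpa using this.pow j
    obtain ⟨u, hu, hcop⟩ := exists_geom_sum_eq_mul_coprime hp (hr (dvd_pow_self p (by omega)))
      (fun h2 => hr (by subst h2; exact pow_dvd_pow 2 (show 2 ≤ m by have := hn2 rfl; omega)))
    have hp1 : (y ^ (j : ℕ) * x ^ i) ^ p = (x ^ i) ^ (p * u) := by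
      rw [mul_pow_of_mul_eq_mul_pow (pow_mul_pow_comm_of_conj hxy i j), hu,
        ← pow_mul, mul_comm (j : ℕ), pow_mul y, hy, one_pow, one_mul]
    have hcop' : (orderOf ((x ^ i) ^ p ^ (k + 1))).Coprime u := by
      refine Nat.Coprime.coprime_dvd_left
        (orderOf_pow_dvd _ |>.trans (orderOf_pow_dvd i)) ?_
      rw [hord]
      exact hcop.pow_left _
    have hpk : (y ^ (j : ℕ) * x ^ i) ^ p ^ (k + 1) = ((x ^ i) ^ p ^ (k + 1)) ^ u := by
      rw [pow_succ', pow_mul, hp1]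
      simp only [← pow_mul]
      congr 1
      ring
    rw [← Subtype.coe_inj]
    change (y ^ (j : ℕ) * x ^ i) ^ p ^ (k + 1) = 1 ↔ (x ^ i) ^ p ^ (k + 1) = 1
    rw [hpk]
    refine ⟨fun h => ?_, fun h => by rw [h, one_pow]⟩
    rw [← orderOf_eq_one_iff]
    exact Nat.eq_one_of_dvd_coprimes hcop' dvd_rfl (orderOf_dvd_of_pow_eq_one h)
  refine numCyclicSubgroups_of_ncard_torsion G hp m (fun g => ?_) fun k hk hkm => ?_
  · obtain ⟨a, rfl⟩ := hf g
    rw [hpow, ← hord, ← Nat.card_zpowers]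
    exact pow_card_eq_one'
  · obtain ⟨k, rfl⟩ : ∃ l, k = l + 1 := ⟨k - 1, by omega⟩
    have himage : {g : G | g ^ p ^ (k + 1) = 1} =
        f '' (Set.univ ×ˢ {h | h ^ p ^ (k + 1) = 1}) := by
      ext g
      obtain ⟨a, rfl⟩ := hf g
      rw [hbij.injective.mem_set_image]
      simpa using hpow a k
    have hker : {h : Subgroup.zpowers x | h ^ p ^ (k + 1) = 1}.ncard = p ^ (k + 1) := by
      let _ : CommGroup (Subgroup.zpowers x) := IsCyclic.commGroup
      have h := IsCyclic.card_powMonoidHom_ker (G := Subgroup.zpowers x) (p ^ (k + 1))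
      rw [Nat.card_zpowers, hord, Nat.gcd_eq_right (pow_dvd_pow p hkm)] at h
      exact h
    rw [himage, Set.ncard_image_of_injective _ hbij.injective, Set.ncard_prod, hker,
      Set.ncard_univ, Nat.card_fin, ← pow_succ']
end

section
/- For every integer n ≥ 4, the number of cyclic subgroups of the quasi-dihedral (semidihedral) group QD_{2^n} of order 2^n is 3·2^{n-3} + n. -/
/-- `G` is (isomorphic to) the quasi-dihedral (semidihedral) group
`QD(2^n) = ⟨x, y | x^(2^(n-1)) = y^2 = 1, yxy = x^(2^(n-2)-1)⟩` of order `2^n`: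
it has order `2^n` and is generated by two elements satisfying the defining relations. -/
def IsQuasiDihedralGroup (G : Type*) [Group G] (n : ℕ) : Prop :=
  Nat.card G = 2 ^ n ∧ ∃ x y : G, x ^ 2 ^ (n - 1) = 1 ∧ y ^ 2 = 1 ∧
    y * x * y = x ^ (2 ^ (n - 2) - 1) ∧ Subgroup.closure {x, y} = ⊤

/-- Conjugation by `y` on powers of `x`, written as a commutation rule. -/
lemma mul_pow_eq_pow_mul_of_conj {G : Type*} [Group G] {x y : G} {r : ℕ} (hy : y ^ 2 = 1)
    (hyx : y * x * y = x ^ r) (k : ℕ) : y * x ^ k = x ^ (k * r) * y := by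
  have hyy : y * y = 1 := by rw [← pow_two, hy]
  have hyi : y⁻¹ = y := inv_eq_of_mul_eq_one_left hyy
  have hconj : (y * x * y⁻¹) ^ k = y * x ^ k * y⁻¹ := conj_pow
  rw [hyi, hyx, ← pow_mul, mul_comm] at hconj
  rw [hconj, mul_assoc, mul_assoc, hyy, mul_one]

/-- Every element of `⟨x, y⟩` has the form `x ^ k` or `x ^ k * y`. -/
lemma exists_eq_pow_or_pow_mul {G : Type*} [Group G] {x y : G} {N r : ℕ} (hN : 0 < N)
    (hx : x ^ N = 1) (hy : y ^ 2 = 1) (hyx : y * x * y = x ^ r)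
    (htop : Subgroup.closure {x, y} = ⊤) (g : G) :
    ∃ k < N, g = x ^ k ∨ g = x ^ k * y := by
  have hyy : y * y = 1 := by rw [← pow_two, hy]
  have hcomm := mul_pow_eq_pow_mul_of_conj hy hyx
  have hinv (k : ℕ) : (x ^ k)⁻¹ = x ^ (k * (N - 1)) := by
    refine inv_eq_of_mul_eq_one_right ?_
    obtain ⟨M, rfl⟩ : ∃ M, N = M + 1 := ⟨N - 1, by omega⟩
    rw [← pow_add, show k + k * (M + 1 - 1) = (M + 1) * k by simp; ring, pow_mul, hx, one_pow]
  suffices h : ∃ k : ℕ, g = x ^ k ∨ g = x ^ k * y by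
    obtain ⟨k, hk⟩ := h
    exact ⟨k % N, Nat.mod_lt _ hN, by rwa [← pow_eq_pow_mod k hx]⟩
  have hg : g ∈ Subgroup.closure {x, y} := htop ▸ Subgroup.mem_top g
  induction hg using Subgroup.closure_induction with
  | mem g hg =>
    rcases hg with rfl | rfl
    · exact ⟨1, Or.inl (pow_one _).symm⟩
    · exact ⟨0, Or.inr (by simp)⟩
  | one => exact ⟨0, Or.inl (pow_zero _).symm⟩
  | mul a b _ _ ha hb =>
    obtain ⟨i, rfl | rfl⟩ := ha <;> obtain ⟨j, rfl | rfl⟩ := hb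
    · exact ⟨i + j, Or.inl (pow_add _ _ _).symm⟩
    · exact ⟨i + j, Or.inr (by rw [pow_add, mul_assoc])⟩
    · exact ⟨i + j * r, Or.inr (by rw [mul_assoc, hcomm, pow_add, mul_assoc])⟩
    · exact ⟨i + j * r, Or.inl (by
        rw [mul_assoc, ← mul_assoc y, hcomm, mul_assoc, hyy, mul_one, pow_add])⟩
  | inv a _ ha =>
    obtain ⟨i, rfl | rfl⟩ := ha
    · exact ⟨_, Or.inl (hinv i)⟩
    · exact ⟨_, Or.inr (by rw [mul_inv_rev, hinv, inv_eq_of_mul_eq_one_left hyy, hcomm])⟩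

/-- If `|G| = 2 N`, the normal form `x ^ k * y ^ e` is unique. -/
lemma normalForm_unique {G : Type*} [Group G] {x y : G} {N : ℕ} (hN : 0 < N)
    (hcard : Nat.card G = 2 * N) (hsurj : ∀ g : G, ∃ k < N, g = x ^ k ∨ g = x ^ k * y) :
    (∀ i < N, ∀ j < N, x ^ i = x ^ j → i = j) ∧ ∀ i < N, ∀ j < N, x ^ i ≠ x ^ j * y := by
  have : Finite G := Nat.finite_of_card_ne_zero (by omega)
  have := Fintype.ofFinite G
  let f : Fin N ⊕ Fin N → G := Sum.elim (fun k => x ^ (k : ℕ)) (fun k => x ^ (k : ℕ) * y)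
  have hf : Function.Bijective f := by
    rw [Fintype.bijective_iff_surjective_and_card]
    refine ⟨fun g => ?_, ?_⟩
    · obtain ⟨k, hk, rfl | rfl⟩ := hsurj g
      · exact ⟨Sum.inl ⟨k, hk⟩, rfl⟩
      · exact ⟨Sum.inr ⟨k, hk⟩, rfl⟩
    · rw [← Nat.card_eq_fintype_card (α := G), hcard]
      simp [two_mul]
  refine ⟨fun i hi j hj h => ?_, fun i hi j hj h => ?_⟩
  · simpa using hf.1 (a₁ := Sum.inl ⟨i, hi⟩) (a₂ := Sum.inl ⟨j, hj⟩) h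
  · simpa using hf.1 (a₁ := Sum.inl ⟨i, hi⟩) (a₂ := Sum.inr ⟨j, hj⟩) h

/-- A power of an element `x` of order dividing `2 ^ s` generates the same subgroup as some
`x ^ 2 ^ j` with `j ≤ s`. -/
lemma exists_zpowers_pow_two_pow {G : Type*} [Group G] {x : G} {s : ℕ} (hx : x ^ 2 ^ s = 1)
    (k : ℕ) : ∃ j ≤ s, Subgroup.zpowers (x ^ k) = Subgroup.zpowers (x ^ 2 ^ j) := by
  obtain ⟨j, hj, hgcd⟩ := (Nat.dvd_prime_pow Nat.prime_two).1 (Nat.gcd_dvd_right k (2 ^ s))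
  refine ⟨j, hj, le_antisymm ?_ ?_⟩
  · rw [Subgroup.zpowers_le]
    obtain ⟨c, hc⟩ := hgcd ▸ Nat.gcd_dvd_left k (2 ^ s)
    rw [hc, pow_mul]
    exact Subgroup.npow_mem_zpowers _ _
  · rw [Subgroup.zpowers_le, ← hgcd]
    have hb := Nat.gcd_eq_gcd_ab k (2 ^ s)
    refine ⟨Nat.gcdA k (2 ^ s), ?_⟩
    dsimp only
    rw [← zpow_natCast x (k.gcd _), hb, zpow_add, zpow_mul, zpow_mul, zpow_natCast, zpow_natCast,
      hx, one_zpow, mul_one]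

/-- A member of the cyclic group generated by `g` with `g ^ 4 = 1` is one of four powers. -/
lemma exists_lt_four_pow_eq {G : Type*} [Group G] {g h : G} (hg : g ^ 4 = 1)
    (hh : h ∈ Subgroup.zpowers g) : h = 1 ∨ h = g ∨ h = g ^ 2 ∨ h = g ^ 3 := by
  have hfin : IsOfFinOrder g := isOfFinOrder_iff_pow_eq_one.2 ⟨4, by norm_num, hg⟩
  obtain ⟨k, rfl⟩ := hfin.mem_powers_iff_mem_zpowers.2 hh
  dsimp only
  rw [pow_eq_pow_mod k hg]
  have : k % 4 < 4 := Nat.mod_lt _ (by norm_num)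
  interval_cases k % 4 <;> simp

theorem numCyclic_quasidihedral {n : ℕ} (hn : 4 ≤ n) (G : Type*) [Group G]
    (hG : IsQuasiDihedralGroup G n) :
    numCyclicSubgroups G = 3 * 2 ^ (n - 3) + n := by
  obtain ⟨hcard, x, y, hx, hy, hyx, htop⟩ := hG
  obtain ⟨t, rfl⟩ : ∃ t, n = t + 3 := ⟨n - 3, by omega⟩
  simp only [show t + 3 - 1 = t + 2 by omega, show t + 3 - 2 = t + 1 by omega,
    show t + 3 - 3 = t by omega] at *
  obtain ⟨h, hh⟩ : ∃ h, h = 2 ^ t := ⟨_, rfl⟩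
  have hpos : 0 < h := by rw [hh]; positivity
  have h1 : 2 ^ (t + 1) = 2 * h := by rw [hh]; ring
  have h2 : 2 ^ (t + 2) = 4 * h := by rw [hh]; ring
  have hN : 0 < 4 * h := by omega
  have hx' : x ^ (4 * h) = 1 := h2 ▸ hx
  rw [h1] at hyx
  have hsurj := exists_eq_pow_or_pow_mul hN hx' hy hyx htop
  obtain ⟨hinj, hne⟩ := normalForm_unique hN (by rw [hcard, hh]; ring) hsurj
  have hne' (i j : ℕ) : x ^ i ≠ x ^ j * y := by
    rw [pow_eq_pow_mod i hx', pow_eq_pow_mod j hx']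
    exact hne _ (Nat.mod_lt _ hN) _ (Nat.mod_lt _ hN)
  have hsq (k : ℕ) : (x ^ k * y) ^ 2 = x ^ (k * (2 * h)) := by
    obtain ⟨r, hr⟩ : ∃ r, 2 * h = r + 1 := ⟨2 * h - 1, by omega⟩
    rw [pow_two, mul_assoc, ← mul_assoc y, mul_pow_eq_pow_mul_of_conj hy hyx, mul_assoc,
      ← pow_two, hy, mul_one, ← pow_add, hr]
    congr 1
    simp; ring
  have hsq_even (k : ℕ) : (x ^ (2 * k) * y) ^ 2 = 1 := by
    rw [hsq, show 2 * k * (2 * h) = 4 * h * k by ring, pow_mul, hx', one_pow]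
  have hsq_odd (k : ℕ) : (x ^ (2 * k + 1) * y) ^ 2 = x ^ (2 * h) := by
    rw [hsq, show (2 * k + 1) * (2 * h) = 4 * h * k + 2 * h by ring, pow_add, pow_mul, hx',
      one_pow, one_mul]
  have hcube_odd (k : ℕ) : (x ^ (2 * k + 1) * y) ^ 3 = x ^ (2 * (k + h) + 1) * y := by
    rw [pow_succ, hsq_odd, ← mul_assoc, ← pow_add]
    congr 2; ring
  have hfour (k : ℕ) : (x ^ k * y) ^ 4 = 1 := by
    rw [show 4 = 2 * 2 by norm_num, pow_mul, hsq, ← pow_mul,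
      show k * (2 * h) * 2 = 4 * h * k by ring, pow_mul, hx', one_pow]
  have hmem {i j : ℕ} (hij : x ^ i * y ∈ Subgroup.zpowers (x ^ j * y)) :
      x ^ i * y = x ^ j * y ∨ x ^ i * y = (x ^ j * y) ^ 3 := by
    rcases exists_lt_four_pow_eq (hfour j) hij with e | e | e | e
    · exact absurd (by rw [e, pow_zero]) (hne' 0 i)
    · exact Or.inl e
    · exact absurd (by rw [e, hsq]) (hne' (j * (2 * h)) i)
    · exact Or.inr e
  have hnot (i j : ℕ) : Subgroup.zpowers (x ^ i) ≠ Subgroup.zpowers (x ^ j * y) := by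
    intro he
    have hm : x ^ j * y ∈ Subgroup.zpowers x :=
      (Subgroup.zpowers_le.2 (Subgroup.npow_mem_zpowers x i))
        (he ▸ Subgroup.mem_zpowers (x ^ j * y))
    have hfin : IsOfFinOrder x := isOfFinOrder_iff_pow_eq_one.2 ⟨_, hN, hx'⟩
    obtain ⟨k, hk⟩ := hfin.mem_powers_iff_mem_zpowers.2 hm
    exact hne' k j hk
  have horder : orderOf x = 2 ^ (t + 2) := by
    refine Nat.dvd_antisymm (orderOf_dvd_of_pow_eq_one hx) ?_
    have hlt := Nat.mod_lt (orderOf x) hN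
    have := hinj _ hlt 0 hN (by rw [← pow_eq_pow_mod _ hx', pow_orderOf_eq_one, pow_zero])
    rw [h2]
    exact Nat.dvd_of_mod_eq_zero this
  let f : Fin (t + 3) ⊕ Fin (2 * h) ⊕ Fin h → {H : Subgroup G // IsCyclic H} :=
    Sum.elim (fun j => ⟨Subgroup.zpowers (x ^ 2 ^ (j : ℕ)), inferInstance⟩)
      (Sum.elim (fun k => ⟨Subgroup.zpowers (x ^ (2 * (k : ℕ)) * y), inferInstance⟩)
        (fun k => ⟨Subgroup.zpowers (x ^ (2 * (k : ℕ) + 1) * y), inferInstance⟩))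
  have hf : Function.Bijective f := by
    constructor
    · rintro (⟨i, hi⟩ | ⟨i, hi⟩ | ⟨i, hi⟩) (⟨j, hj⟩ | ⟨j, hj⟩ | ⟨j, hj⟩) he <;>
        replace he := congrArg Subtype.val he <;>
        simp only [f, Sum.elim_inl, Sum.elim_inr] at he
      · have ho := congrArg (fun H : Subgroup G => Nat.card H) he
        simp only [Nat.card_zpowers] at ho
        rw [orderOf_pow_of_dvd (by positivity) (horder ▸ pow_dvd_pow 2 (by omega)),
          orderOf_pow_of_dvd (by positivity) (horder ▸ pow_dvd_pow 2 (by omega)), horder,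
          Nat.pow_div (by omega) (by norm_num), Nat.pow_div (by omega) (by norm_num)] at ho
        have := Nat.pow_right_injective le_rfl ho
        simp only [Sum.inl.injEq, Fin.mk.injEq]
        omega
      · exact absurd he (hnot _ _)
      · exact absurd he (hnot _ _)
      · exact absurd he.symm (hnot _ _)
      · have hij : x ^ (2 * i) * y = x ^ (2 * j) * y := by
          rcases hmem (he ▸ Subgroup.mem_zpowers _) with e | e
          · exact e
          · rwa [pow_succ, hsq_even, one_mul] at e
        have := hinj _ (by omega) _ (by omega) (mul_right_cancel hij)
        simp only [Sum.inl.injEq, Sum.inr.injEq, Fin.mk.injEq]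
        omega
      · rcases hmem (he ▸ Subgroup.mem_zpowers _) with e | e
        · have := hinj _ (by omega) _ (by omega) (mul_right_cancel e)
          omega
        · rw [hcube_odd] at e
          have := hinj _ (by omega) _ (by omega) (mul_right_cancel e)
          omega
      · exact absurd he.symm (hnot _ _)
      · rcases hmem (he.symm ▸ Subgroup.mem_zpowers _) with e | e
        · have := hinj _ (by omega) _ (by omega) (mul_right_cancel e)
          omega
        · rw [hcube_odd] at e
          have := hinj _ (by omega) _ (by omega) (mul_right_cancel e)
          omega
      · simp only [Sum.inr.injEq, Fin.mk.injEq]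
        rcases hmem (he ▸ Subgroup.mem_zpowers _) with e | e
        · have := hinj _ (by omega) _ (by omega) (mul_right_cancel e)
          omega
        · rw [hcube_odd] at e
          have := hinj _ (by omega) _ (by omega) (mul_right_cancel e)
          omega
    · rintro ⟨H, hH⟩
      obtain ⟨g, rfl⟩ := Subgroup.isCyclic_iff_exists_zpowers_eq_top H |>.1 hH
      obtain ⟨k, hk, rfl | rfl⟩ := hsurj g
      · obtain ⟨j, hj, hz⟩ := exists_zpowers_pow_two_pow hx k
        exact ⟨Sum.inl ⟨j, by omega⟩, Subtype.ext hz.symm⟩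
      · obtain ⟨i, rfl | rfl⟩ := Nat.even_or_odd' k
        · exact ⟨Sum.inr (Sum.inl ⟨i, by omega⟩), rfl⟩
        · by_cases hi : i < h
          · exact ⟨Sum.inr (Sum.inr ⟨i, hi⟩), rfl⟩
          · refine ⟨Sum.inr (Sum.inr ⟨i - h, by omega⟩), Subtype.ext ?_⟩
            have hcube := hcube_odd (i - h)
            rw [Nat.sub_add_cancel (by omega)] at hcube
            simp only [f, Sum.elim_inr]
            refine le_antisymm ?_ ?_ <;> rw [Subgroup.zpowers_le]
            · refine ⟨3, ?_⟩
              dsimp only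
              rw [← hcube, show (3 : ℤ) = (3 : ℕ) by rfl, zpow_natCast, ← pow_mul,
                show 3 * 3 = 4 * 2 + 1 by norm_num, pow_succ, pow_mul, hfour, one_pow, one_mul]
            · rw [← hcube]
              exact Subgroup.npow_mem_zpowers _ _
  rw [numCyclicSubgroups, ← Nat.card_eq_of_bijective f hf, ← hh]
  simp
  ring
end
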